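/- Let f ∈ ℝ[x₁,…,xₙ] be a nonconstant polynomial and φ : ℝⁿ → ℂ a C^∞ function with compact support. Then there exists a meromorphic function G on ℂ such that G(s) = Z(f,φ;s) for every s with Re(s) > 0, and every pole of G is a negative rational number. -/

import Mathlib

open MeasureTheory Filter

/-- The integrand `|f(x)|^s · φ(x)` of the real zeta function, where
`|f(x)|^s := exp(s · log |f(x)|)` if `f(x) ≠ 0` and `0` if `f(x) = 0`. -/
noncomputable def realZetaIntegrand {n : ℕ} (f : MvPolynomial (Fin n) ℝ)
    (φ : (Fin n → ℝ) → ℂ) (s : ℂ) (x : Fin n → ℝ) : ℂ :=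
  (if MvPolynomial.eval x f = 0 then 0
    else Complex.exp (s * (Real.log |MvPolynomial.eval x f| : ℂ))) * φ x

/-- The real zeta function `Z(f,φ;s) = ∫_{ℝⁿ} |f(x)|^s φ(x) dx`. -/
noncomputable def realZeta {n : ℕ} (f : MvPolynomial (Fin n) ℝ)
    (φ : (Fin n → ℝ) → ℂ) (s : ℂ) : ℂ :=
  ∫ x : Fin n → ℝ, realZetaIntegrand f φ s x

/-- `s₀` is a pole of `G`: `‖G‖` tends to infinity along the punctured neighbourhood filter. -/
def IsPole (G : ℂ → ℂ) (s₀ : ℂ) : Prop :=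
  Filter.Tendsto (fun s => ‖G s‖) (nhdsWithin s₀ {s₀}ᶜ) Filter.atTop



set_option linter.unusedSimpArgs false
set_option linter.unusedVariables false

namespace RZ
noncomputable section
open MvPolynomial

variable {n : ℕ} {A : Type} [CommRing A]

/-- The localization `A[x]_f`. -/
abbrev ZP (f : MvPolynomial (Fin n) A) : Type := Localization.Away f

/-- The canonical map `A[x] → A[x]_f`. -/
abbrev toP (f : MvPolynomial (Fin n) A) : MvPolynomial (Fin n) A →+* ZP f :=
  algebraMap _ _

variable (f : MvPolynomial (Fin n) A)

/-- The inverse of `f`. -/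
def finv : ZP f := IsLocalization.Away.invSelf f

lemma f_mul_finv : toP f f * finv f = 1 := IsLocalization.Away.mul_invSelf f

lemma isUnit_f : IsUnit (toP f f) := IsUnit.of_mul_eq_one _ (f_mul_finv f)

lemma surjP (p : ZP f) : ∃ (k : ℕ) (r : MvPolynomial (Fin n) A), toP f f ^ k * p = toP f r := by
  obtain ⟨k, r, h⟩ := IsLocalization.Away.surj f p
  exact ⟨k, r, by rw [mul_comm]; exact h⟩

lemma surjP' (p : ZP f) : ∃ (k : ℕ) (r : MvPolynomial (Fin n) A), p = toP f r * finv f ^ k := by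
  obtain ⟨k, r, h⟩ := surjP f p
  refine ⟨k, r, ?_⟩
  rw [← h, mul_right_comm, ← mul_pow, f_mul_finv, one_pow, one_mul]

/-- auxiliary hom to dual numbers -/
def dualHom (i : Fin n) : MvPolynomial (Fin n) A →ₐ[A] TrivSqZeroExt (ZP f) (ZP f) :=
  MvPolynomial.aeval fun j => TrivSqZeroExt.inl (toP f (X j)) +
    TrivSqZeroExt.inr (if j = i then 1 else 0)

lemma dualHom_fst (i : Fin n) (r : MvPolynomial (Fin n) A) : (dualHom f i r).fst = toP f r := by
  have h : ((TrivSqZeroExt.fstHom A (ZP f) (ZP f)).comp (dualHom f i)) =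
    (Algebra.algHom A (MvPolynomial (Fin n) A) (ZP f)) := by
    apply MvPolynomial.algHom_ext
    intro j
    simp only [dualHom, AlgHom.comp_apply, aeval_X]
    change (TrivSqZeroExt.inl (toP f (X j)) + TrivSqZeroExt.inr (if j = i then 1 else 0)
      : TrivSqZeroExt (ZP f) (ZP f)).fst = toP f (X j)
    rw [TrivSqZeroExt.fst_add, TrivSqZeroExt.fst_inl, TrivSqZeroExt.fst_inr, add_zero]
  exact DFunLike.congr_fun h r

lemma dualHom_snd (i : Fin n) (r : MvPolynomial (Fin n) A) :
    (dualHom f i r).snd = toP f (pderiv i r) := by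
  induction r using MvPolynomial.induction_on with
  | C a =>
    have : dualHom f i (C a) = algebraMap A _ a := (dualHom f i).commutes a
    rw [this, TrivSqZeroExt.algebraMap_eq_inl']; simp
  | add p q hp hq => simp [hp, hq]
  | mul_X p j hp =>
    simp only [map_mul, TrivSqZeroExt.snd_mul, hp, dualHom_fst, Derivation.leibniz]
    simp only [dualHom, aeval_X, TrivSqZeroExt.snd_add, TrivSqZeroExt.snd_inl, TrivSqZeroExt.fst_add,
      TrivSqZeroExt.fst_inl, TrivSqZeroExt.fst_inr, TrivSqZeroExt.snd_inr, zero_add, add_zero, pderiv_X,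
      MulOpposite.smul_eq_mul_unop, MulOpposite.unop_op, smul_eq_mul, map_add, map_mul]
    by_cases h : j = i
    · subst h; simp; ring
    · simp [h, Pi.single_apply]; try ring

/-- extension to the localization -/
def dualHom' (i : Fin n) : ZP f →+* TrivSqZeroExt (ZP f) (ZP f) :=
  IsLocalization.Away.lift (g := (dualHom f i).toRingHom) f (by
    rw [TrivSqZeroExt.isUnit_iff_isUnit_fst]
    simpa [dualHom_fst] using isUnit_f f)

lemma dualHom'_toP (i : Fin n) (r : MvPolynomial (Fin n) A) :
    dualHom' f i (toP f r) = dualHom f i r := by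
  simp only [dualHom']
  exact IsLocalization.Away.lift_eq f _ r

lemma dualHom'_fst (i : Fin n) (p : ZP f) : (dualHom' f i p).fst = p := by
  have h : (TrivSqZeroExt.fstHom A (ZP f) (ZP f)).toRingHom.comp (dualHom' f i) = RingHom.id _ := by
    apply IsLocalization.ringHom_ext (Submonoid.powers f)
    ext r
    · change (dualHom' f i (toP f (C r))).fst = toP f (C r)
      rw [dualHom'_toP, dualHom_fst]
    · simp [dualHom'_toP, dualHom_fst]
  exact DFunLike.congr_fun h p

/-- partial derivative on `A[x]_f` -/
def dP (i : Fin n) : Derivation A (ZP f) (ZP f) where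
  toFun p := (dualHom' f i p).snd
  map_add' p q := by simp
  map_smul' a p := by
    have h : dualHom' f i (algebraMap A (ZP f) a) = TrivSqZeroExt.inl (algebraMap A (ZP f) a) := by
      rw [IsScalarTower.algebraMap_apply A (MvPolynomial (Fin n) A) (ZP f), dualHom'_toP]
      exact ((dualHom f i).commutes a)
    simp [Algebra.smul_def, h]
  map_one_eq_zero' := by simp
  leibniz' p q := by
    simp [TrivSqZeroExt.snd_mul, dualHom'_fst, mul_comm]

lemma dP_toP (i : Fin n) (r : MvPolynomial (Fin n) A) :
    dP f i (toP f r) = toP f (pderiv i r) := by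
  change (dualHom' f i (toP f r)).snd = _
  rw [dualHom'_toP, dualHom_snd]

lemma der_ext {D D' : Derivation A (ZP f) (ZP f)}
    (h : ∀ r, D (toP f r) = D' (toP f r)) : D = D' := by
  ext p
  obtain ⟨k, r, hk⟩ := surjP f p
  have h1 : D (toP f f ^ k * p) = D' (toP f f ^ k * p) := by rw [hk, h]
  rw [← map_pow] at h1
  simp only [Derivation.leibniz, h, smul_eq_mul] at h1
  have h2 := add_right_cancel h1
  rw [map_pow] at h2
  exact ((isUnit_f f).pow k).mul_left_cancel h2

lemma der_ext_X {D D' : Derivation A (ZP f) (ZP f)}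
    (h : ∀ j, D (toP f (X j)) = D' (toP f (X j))) : D = D' := by
  apply der_ext
  intro r
  induction r using MvPolynomial.induction_on with
  | C a =>
    have : toP f (C a) = algebraMap A (ZP f) a := by
      rw [IsScalarTower.algebraMap_apply A (MvPolynomial (Fin n) A) (ZP f)]; rfl
    rw [this]; simp
  | add p q hp hq => simp [hp, hq]
  | mul_X p j hp => simp [hp, h]

lemma dP_X (i j : Fin n) : dP f i (toP f (X j)) = if j = i then 1 else 0 := by
  rw [dP_toP, pderiv_X]
  by_cases h : j = i <;> simp [h, Pi.single_apply]

lemma dP_comm (i j : Fin n) (p : ZP f) : dP f i (dP f j p) = dP f j (dP f i p) := by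
  have h : ⁅dP f i, dP f j⁆ = 0 := by
    apply der_ext_X
    intro l
    rw [Derivation.commutator_apply, dP_X, dP_X]
    split_ifs <;> simp
  have := DFunLike.congr_fun h p
  rw [Derivation.commutator_apply] at this
  exact sub_eq_zero.mp this

lemma dP_finv (i : Fin n) : dP f i (finv f) = - toP f (pderiv i f) * finv f ^ 2 := by
  have h : dP f i (toP f f * finv f) = 0 := by rw [f_mul_finv]; simp
  rw [Derivation.leibniz, dP_toP, smul_eq_mul, smul_eq_mul] at h
  have h2 := f_mul_finv f
  linear_combination (finv f) * h - (dP f i (finv f)) * h2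

/-- logarithmic derivative `∂_i f / f` -/
def gP (i : Fin n) : ZP f := toP f (pderiv i f) * finv f

lemma gP_closed (i j : Fin n) : dP f i (gP f j) = dP f j (gP f i) := by
  simp only [gP, Derivation.leibniz, dP_toP, dP_finv, smul_eq_mul]
  have : pderiv i (pderiv j f) = pderiv j (pderiv i f) := by
    have h : ⁅(pderiv i : Derivation A (MvPolynomial (Fin n) A) (MvPolynomial (Fin n) A)),
        (pderiv j : Derivation A (MvPolynomial (Fin n) A) (MvPolynomial (Fin n) A))⁆ = 0 := by
      apply MvPolynomial.derivation_ext
      intro l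
      rw [Derivation.commutator_apply, pderiv_X, pderiv_X]
      rw [Pi.single_apply, Pi.single_apply]; split_ifs <;> simp
    have := DFunLike.congr_fun h f
    rw [Derivation.commutator_apply] at this
    exact sub_eq_zero.mp this
  rw [this]; ring

/-- `A[x]_f[s]` -/
abbrev ZE (f : MvPolynomial (Fin n) A) : Type := Polynomial (ZP f)

/-- coefficientwise derivation -/
def dE (i : Fin n) : Derivation A (ZE f) (ZE f) :=
  ((PolynomialModule.equivPolynomialSelf : PolynomialModule (ZP f) (ZP f) ≃ₗ[Polynomial (ZP f)] _)
    ).toLinearMap.compDer (dP f i).mapCoeffs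

lemma dE_coeff (i : Fin n) (p : ZE f) (k : ℕ) : (dE f i p).coeff k = dP f i (p.coeff k) := rfl

@[simp] lemma dE_C (i : Fin n) (p : ZP f) : dE f i (Polynomial.C p) = Polynomial.C (dP f i p) := by
  ext k; rw [dE_coeff, Polynomial.coeff_C, Polynomial.coeff_C]; split_ifs <;> simp

@[simp] lemma dE_X (i : Fin n) : dE f i (Polynomial.X) = 0 := by
  ext k; rw [dE_coeff, Polynomial.coeff_X]; split_ifs <;> simp

end
end RZ


set_option linter.unusedSimpArgs false
set_option linter.unusedVariables false
namespace RZ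
noncomputable section

/-- Commuting-variable monomials in a noncommutative ring. -/
def cpow {n : ℕ} {W : Type*} [Ring W] (Y : Fin n → W) (h : ∀ i j, Commute (Y i) (Y j))
    (β : Fin n →₀ ℕ) : W :=
  Finset.univ.noncommProd (fun i => Y i ^ β i)
    (show Set.Pairwise _ (Function.onFun Commute fun i => Y i ^ β i) from
      fun i _ j _ _ => (h i j).pow_pow _ _)

section
variable {n : ℕ} {W : Type*} [Ring W] (Y : Fin n → W) (h : ∀ i j, Commute (Y i) (Y j))

@[simp] lemma cpow_zero : cpow Y h 0 = 1 := by
  unfold cpow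
  rw [Finset.noncommProd_eq_pow_card _ _ _ 1] <;> simp

lemma cpow_add (α β : Fin n →₀ ℕ) : cpow Y h (α + β) = cpow Y h α * cpow Y h β := by
  unfold cpow
  rw [← Finset.noncommProd_mul_distrib]
  · apply Finset.noncommProd_congr rfl
    intro i _
    simp [pow_add]
  · intro i _ j _ _
    exact (h _ _).pow_pow _ _

lemma cpow_single (i : Fin n) (k : ℕ) : cpow Y h (Finsupp.single i k) = Y i ^ k := by
  unfold cpow
  refine (Finset.mul_noncommProd_erase Finset.univ (Finset.mem_univ i) _ _).symm.trans ?_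
  refine (congrArg (_ * ·) (Finset.noncommProd_eq_pow_card _ _ _ 1 ?_)).trans ?_
  · intro j hj
    simp [Finsupp.single_apply, (Finset.ne_of_mem_erase hj).symm]
  · simp

lemma commute_cpow (c : W) (hc : ∀ i, Commute c (Y i)) (β : Fin n →₀ ℕ) :
    Commute c (cpow Y h β) := by
  unfold cpow
  apply Finset.noncommProd_commute
  intro i _
  exact (hc i).pow_right _

lemma cpow_succ (i : Fin n) (β : Fin n →₀ ℕ) :
    cpow Y h (β + Finsupp.single i 1) = Y i * cpow Y h β := by
  rw [add_comm, cpow_add, cpow_single, pow_one]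

lemma expo_induction {p : (Fin n →₀ ℕ) → Prop} (h0 : p 0)
    (h1 : ∀ α i, p α → p (α + Finsupp.single i 1)) (α) : p α := by
  suffices H : ∀ (m : ℕ) (α : Fin n →₀ ℕ), α.degree = m → p α from H _ α rfl
  intro m
  induction m with
  | zero =>
    intro α hα
    rw [Finsupp.degree_eq_zero_iff] at hα
    rw [hα]; exact h0
  | succ m ih =>
    intro α hα
    have hne : α ≠ 0 := by rintro rfl; simp at hα
    obtain ⟨i, hi⟩ := Finsupp.ne_iff.mp hne
    have hle : Finsupp.single i 1 ≤ α := by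
      rw [Finsupp.single_le_iff]; simp at hi; omega
    rw [← tsub_add_cancel_of_le hle]
    apply h1
    apply ih
    have h2 := congrArg Finsupp.degree (tsub_add_cancel_of_le hle)
    rw [map_add, Finsupp.degree_single] at h2
    omega

lemma comm_cpow (c : W) (i : Fin n) (hc : ∀ j, c * Y j = Y j * c + if j = i then 1 else 0)
    (β : Fin n →₀ ℕ) :
    c * cpow Y h β = cpow Y h β * c + (β i) • cpow Y h (β - Finsupp.single i 1) := by
  induction β using expo_induction with
  | h0 => simp
  | h1 β j ih =>
    rw [cpow_succ, ← mul_assoc, hc, add_mul, mul_assoc, ih, mul_add, ← mul_assoc, add_assoc]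
    congr 1
    by_cases hj : j = i
    · subst hj
      rw [if_pos rfl, one_mul, add_tsub_cancel_right, mul_smul_comm, ← cpow_succ]
      simp only [Finsupp.add_apply, Finsupp.single_eq_same, add_smul, one_smul]
      congr 1
      by_cases hb : β j = 0
      · simp [hb]
      · congr 2
        ext l
        by_cases hl : l = j
        · subst hl; simp; omega
        · simp [Finsupp.single_apply, Ne.symm hl]
    · rw [if_neg hj, zero_mul, add_zero, mul_smul_comm, ← cpow_succ]
      simp only [Finsupp.add_apply, Finsupp.single_apply, if_neg hj, add_zero]
      congr 2
      ext l
      by_cases hl : l = j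
      · subst hl; simp [Finsupp.single_apply, Ne.symm hj]
      · simp [Finsupp.single_apply, Ne.symm hl]
end
end
end RZ


set_option linter.unusedSimpArgs false
set_option linter.unusedVariables false
namespace RZ
noncomputable section

/-- A pair of tuples satisfying the Weyl relations. -/
structure Weyl (n : ℕ) (W : Type*) [Ring W] where
  /-- multiplication operators -/
  X : Fin n → W
  /-- derivations -/
  Y : Fin n → W
  hX : ∀ i j, Commute (X i) (X j)
  hY : ∀ i j, Commute (Y i) (Y j)
  hYX : ∀ i j, Y i * X j = X j * Y i + if j = i then 1 else 0

section
variable {n : ℕ}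
/-- left part of exponent -/
def lft {α τ : Type} (μ : α ⊕ τ →₀ ℕ) : α →₀ ℕ :=
  μ.comapDomain Sum.inl Sum.inl_injective.injOn
/-- right part of exponent -/
def rgt {α τ : Type} (μ : α ⊕ τ →₀ ℕ) : τ →₀ ℕ :=
  μ.comapDomain Sum.inr Sum.inr_injective.injOn

variable {α τ : Type} (μ ν : α ⊕ τ →₀ ℕ)
@[simp] lemma lft_apply (i) : lft μ i = μ (Sum.inl i) := rfl
@[simp] lemma rgt_apply (i) : rgt μ i = μ (Sum.inr i) := rfl
@[simp] lemma lft_add : lft (μ + ν) = lft μ + lft ν := by ext; simp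
@[simp] lemma rgt_add : rgt (μ + ν) = rgt μ + rgt ν := by ext; simp
@[simp] lemma lft_sub : lft (μ - ν) = lft μ - lft ν := by ext; simp
@[simp] lemma rgt_sub : rgt (μ - ν) = rgt μ - rgt ν := by ext; simp
@[simp] lemma lft_zero : lft (0 : α ⊕ τ →₀ ℕ) = 0 := by ext; simp
@[simp] lemma rgt_zero : rgt (0 : α ⊕ τ →₀ ℕ) = 0 := by ext; simp
@[simp] lemma lft_inl (i : α) (k : ℕ) :
    lft (Finsupp.single (Sum.inl i : α ⊕ τ) k) = Finsupp.single i k := by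
  classical
  ext j; simp [Finsupp.single_apply]
@[simp] lemma rgt_inl (i : α) (k : ℕ) :
    rgt (Finsupp.single (Sum.inl i : α ⊕ τ) k) = 0 := by
  classical
  ext j; simp [Finsupp.single_apply]
@[simp] lemma lft_inr (i : τ) (k : ℕ) :
    lft (Finsupp.single (Sum.inr i : α ⊕ τ) k) = 0 := by
  classical
  ext j; simp [Finsupp.single_apply]
@[simp] lemma rgt_inr (i : τ) (k : ℕ) :
    rgt (Finsupp.single (Sum.inr i : α ⊕ τ) k) = Finsupp.single i k := by
  classical
  ext j; simp [Finsupp.single_apply]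

lemma sum_induction {p : (Fin n ⊕ Fin n →₀ ℕ) → Prop} (h0 : p 0)
    (h1 : ∀ α i, p α → p (α + Finsupp.single (Sum.inl i) 1))
    (h2 : ∀ α i, lft α = 0 → p α → p (α + Finsupp.single (Sum.inr i) 1)) (α) : p α := by
  suffices H : ∀ (a b : Fin n →₀ ℕ) (α : Fin n ⊕ Fin n →₀ ℕ), lft α = a → rgt α = b → p α from
    H _ _ α rfl rfl
  intro a b
  have hext : ∀ α β : Fin n ⊕ Fin n →₀ ℕ, lft α = lft β → rgt α = rgt β → α = β := by
    intro α β h1 h2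
    ext (i | i)
    · exact DFunLike.congr_fun h1 i
    · exact DFunLike.congr_fun h2 i
  have surj : ∀ a b, ∃ α : Fin n ⊕ Fin n →₀ ℕ, lft α = a ∧ rgt α = b := by
    intro a b
    refine ⟨Finsupp.sumElim a b, ?_, ?_⟩ <;> ext <;> simp
  induction a using expo_induction with
  | h0 =>
    induction b using expo_induction with
    | h0 =>
      intro α hl hr
      rw [hext α 0 (by simpa using hl) (by simpa using hr)]; exact h0
    | h1 b i ih =>
      intro α hl hr
      obtain ⟨α', hl', hr'⟩ := surj 0 b
      rw [hext α (α' + Finsupp.single (Sum.inr i) 1) (by simp [hl, hl']) (by simp [hr, hr'])]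
      exact h2 _ _ hl' (ih _ hl' hr')
  | h1 a i ih =>
    intro α hl hr
    obtain ⟨α', hl', hr'⟩ := surj a b
    rw [hext α (α' + Finsupp.single (Sum.inl i) 1) (by simp [hl, hl']) (by simp [hr, hr'])]
    exact h1 _ _ (ih _ hl' hr')
end

namespace Weyl
variable {n : ℕ} {W : Type*} [Ring W] (w : Weyl n W)

/-- normally ordered monomial -/
def mon (μ : Fin n ⊕ Fin n →₀ ℕ) : W := cpow w.X w.hX (lft μ) * cpow w.Y w.hY (rgt μ)

@[simp] lemma mon_zero : w.mon 0 = 1 := by simp [mon]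

lemma X_mul_mon (i : Fin n) (μ) : w.X i * w.mon μ = w.mon (μ + Finsupp.single (Sum.inl i) 1) := by
  simp only [mon, lft_add, rgt_add, lft_inl, rgt_inl, add_zero, cpow_succ, mul_assoc]

lemma mon_mul_Y (i : Fin n) (μ) : w.mon μ * w.Y i = w.mon (μ + Finsupp.single (Sum.inr i) 1) := by
  simp only [mon, lft_add, rgt_add, lft_inr, rgt_inr, add_zero, cpow_succ, mul_assoc]
  congr 1
  exact ((commute_cpow w.Y w.hY (w.Y i) (fun j => w.hY i j) _).eq).symm

lemma Y_mul_mon (i : Fin n) (μ) : w.Y i * w.mon μ = w.mon μ * w.Y i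
    + (μ (Sum.inl i)) • w.mon (μ - Finsupp.single (Sum.inl i) 1) := by
  simp only [mon, lft_sub, rgt_sub, lft_inl, rgt_inl, tsub_zero]
  rw [← mul_assoc, comm_cpow w.X w.hX (w.Y i) i (fun j => w.hYX i j), add_mul, mul_assoc,
    (commute_cpow w.Y w.hY (w.Y i) (fun j => w.hY i j) _).eq, mul_assoc, smul_mul_assoc]
  rfl

lemma mon_mul_X (i : Fin n) (μ) : w.mon μ * w.X i = w.X i * w.mon μ
    + (μ (Sum.inr i)) • w.mon (μ - Finsupp.single (Sum.inr i) 1) := by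
  simp only [mon, lft_sub, rgt_sub, lft_inr, rgt_inr, tsub_zero]
  have h1 := comm_cpow w.Y w.hY (-w.X i) i (fun j => by
    have := w.hYX j i
    by_cases h : j = i
    · subst h; simp only [if_true] at this ⊢; rw [neg_mul, mul_neg, this]; abel
    · simp only [h, Ne.symm h, if_false] at this ⊢; rw [neg_mul, mul_neg, this]; simp) (rgt μ)
  have h2 : cpow w.Y w.hY (rgt μ) * w.X i = w.X i * cpow w.Y w.hY (rgt μ) +
      (rgt μ i) • cpow w.Y w.hY (rgt μ - Finsupp.single i 1) := by
    rw [neg_mul, mul_neg] at h1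
    rw [← sub_eq_iff_eq_add'] 
    rw [neg_eq_iff_eq_neg, neg_add, neg_neg] at h1
    rw [h1]; abel
  rw [mul_assoc, h2, mul_add, ← mul_assoc, ← mul_assoc,
    (commute_cpow w.X w.hX (w.X i) (fun j => w.hX i j) _).eq, mul_smul_comm]
  rfl

end Weyl
end
end RZ


set_option linter.unusedSimpArgs false
set_option linter.unusedVariables false
namespace RZ
noncomputable section

namespace Weyl
open MvPolynomial
section
variable {n : ℕ} {F : Type} [Field F] {V : Type} [AddCommGroup V] [Module F V]
  (w : Weyl n (Module.End F V))

/-- normal ordering map -/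
def q : MvPolynomial (Fin n ⊕ Fin n) F →ₗ[F] Module.End F V :=
  (MvPolynomial.basisMonomials _ F).constr F w.mon

lemma q_monomial (μ) (c : F) : w.q (monomial μ c) = c • w.mon μ := by
  have : monomial μ c = c • (MvPolynomial.basisMonomials (Fin n ⊕ Fin n) F μ) := by
    simp [MvPolynomial.smul_monomial]
  rw [this, map_smul, q, Module.Basis.constr_basis]

lemma q_one : w.q 1 = 1 := by
  have := w.q_monomial 0 1
  simpa using this

lemma Y_mul_q (i : Fin n) (a) : w.Y i * w.q a = w.q a * w.Y i + w.q (pderiv (Sum.inl i) a) := by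
  induction a using MvPolynomial.induction_on' with
  | monomial μ c =>
    rw [pderiv_monomial, q_monomial, q_monomial, mul_smul_comm, Y_mul_mon, smul_add, smul_mul_assoc,
      mul_smul, Nat.cast_smul_eq_nsmul]
  | add a b ha hb => simp only [map_add, mul_add, add_mul, ha, hb]; abel

lemma q_mul_X (i : Fin n) (a) : w.q a * w.X i = w.X i * w.q a + w.q (pderiv (Sum.inr i) a) := by
  induction a using MvPolynomial.induction_on' with
  | monomial μ c =>
    rw [pderiv_monomial, q_monomial, q_monomial, mul_smul_comm, smul_mul_assoc, mon_mul_X, smul_add,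
      mul_smul, Nat.cast_smul_eq_nsmul]
  | add a b ha hb => simp only [map_add, mul_add, add_mul, ha, hb]; abel

lemma X_mul_q (i : Fin n) (a) : w.X i * w.q a = w.q (a * MvPolynomial.X (Sum.inl i)) := by
  induction a using MvPolynomial.induction_on' with
  | monomial μ c =>
    rw [MvPolynomial.X, monomial_mul, q_monomial, q_monomial, mul_smul_comm, mul_one, X_mul_mon]
  | add a b ha hb => simp only [map_add, mul_add, add_mul, ha, hb]

lemma q_mul_Y (i : Fin n) (a) : w.q a * w.Y i = w.q (a * MvPolynomial.X (Sum.inr i)) := by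
  induction a using MvPolynomial.induction_on' with
  | monomial μ c =>
    rw [MvPolynomial.X, monomial_mul, q_monomial, q_monomial, smul_mul_assoc, mul_one, mon_mul_Y]
  | add a b ha hb => simp only [map_add, mul_add, add_mul, ha, hb]

lemma totalDegree_pderiv_lt' (i) (a : MvPolynomial (Fin n ⊕ Fin n) F) (j : ℕ)
    (h : a.totalDegree ≤ j + 1) : (pderiv i a).totalDegree ≤ j := by
  classical
  rw [totalDegree] at *
  apply Finset.sup_le
  intro m hm
  rw [mem_support_iff, coeff_pderiv] at hm
  have h1 : m + Finsupp.single i 1 ∈ a.support := by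
    rw [mem_support_iff]; intro h0; apply hm; rw [h0, zero_mul]
  have h2 := (Finset.le_sup (f := fun s : (Fin n ⊕ Fin n) →₀ ℕ => s.sum fun _ e => e) h1).trans h
  rw [Finsupp.sum_add_index' (by simp) (by simp), Finsupp.sum_single_index rfl] at h2
  omega

/-- filtered pieces of `D u` -/
def Vf (u : V) (j : ℕ) : Submodule F V :=
  (restrictTotalDegree (Fin n ⊕ Fin n) F j).map (w.q.flip u)

/-- `D u` -/
def Du (u : V) : Submodule F V := LinearMap.range (w.q.flip u)

lemma mem_Du {u v : V} : v ∈ w.Du u ↔ ∃ a, w.q a u = v := Iff.rfl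

lemma Vf_le_Du (u : V) (j) : w.Vf u j ≤ w.Du u := by
  rintro _ ⟨a, _, rfl⟩; exact ⟨a, rfl⟩

lemma mem_Vf {u : V} {j} {v} : v ∈ w.Vf u j ↔ ∃ a, a.totalDegree ≤ j ∧ w.q a u = v := by
  simp only [Vf, Submodule.mem_map, mem_restrictTotalDegree]; rfl

lemma Du_X {u v : V} (i) (h : v ∈ w.Du u) : w.X i v ∈ w.Du u := by
  obtain ⟨a, rfl⟩ := h
  refine ⟨a * MvPolynomial.X (Sum.inl i), ?_⟩
  change w.q _ u = _
  rw [← X_mul_q]; rfl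

lemma Y_mul_q' (i : Fin n) (a) :
    w.Y i * w.q a = w.q (a * MvPolynomial.X (Sum.inr i) + pderiv (Sum.inl i) a) := by
  rw [Y_mul_q, map_add, q_mul_Y]

lemma Du_Y {u v : V} (i) (h : v ∈ w.Du u) : w.Y i v ∈ w.Du u := by
  obtain ⟨a, rfl⟩ := h
  refine ⟨a * MvPolynomial.X (Sum.inr i) + pderiv (Sum.inl i) a, ?_⟩
  change w.q _ u = _
  rw [← Y_mul_q']; rfl

lemma cpow_mem {L : Submodule F V} (Z : Fin n → Module.End F V) (hZ)
    (h : ∀ i, ∀ v ∈ L, Z i v ∈ L) (β) : ∀ v ∈ L, cpow Z hZ β v ∈ L := by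
  induction β using expo_induction with
  | h0 => simp
  | h1 β i ih => intro v hv; rw [cpow_succ]; exact h i _ (ih v hv)

lemma q_mem {L : Submodule F V} (hX : ∀ i, ∀ v ∈ L, w.X i v ∈ L) (hY : ∀ i, ∀ v ∈ L, w.Y i v ∈ L)
    (a) : ∀ v ∈ L, w.q a v ∈ L := by
  induction a using MvPolynomial.induction_on' with
  | monomial μ c =>
    intro v hv
    rw [q_monomial]
    exact L.smul_mem _ (cpow_mem _ _ hX _ _ (cpow_mem _ _ hY _ _ hv))
  | add a b ha hb => intro v hv; rw [map_add]; exact L.add_mem (ha v hv) (hb v hv)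

lemma Vf_X {u v : V} {j} (i) (h : v ∈ w.Vf u j) : w.X i v ∈ w.Vf u (j + 1) := by
  rw [mem_Vf] at *
  obtain ⟨a, ha, rfl⟩ := h
  refine ⟨a * MvPolynomial.X (Sum.inl i), ?_, ?_⟩
  · refine (totalDegree_mul _ _).trans ?_
    rw [totalDegree_X]; omega
  rw [← X_mul_q]; rfl

lemma Vf_Y {u v : V} {j} (i) (h : v ∈ w.Vf u j) : w.Y i v ∈ w.Vf u (j + 1) := by
  rw [mem_Vf] at *
  obtain ⟨a, ha, rfl⟩ := h
  refine ⟨a * MvPolynomial.X (Sum.inr i) + pderiv (Sum.inl i) a, ?_, ?_⟩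
  · refine (totalDegree_add _ _).trans (max_le ?_ ?_)
    · refine (totalDegree_mul _ _).trans ?_
      rw [totalDegree_X]; omega
    · exact (totalDegree_pderiv_lt' _ _ _ (ha.trans (Nat.le_succ _))).trans (Nat.le_succ _)
  rw [← Y_mul_q']; rfl

lemma Vf_mono {u : V} {j k} (hjk : j ≤ k) : w.Vf u j ≤ w.Vf u k := by
  intro v hv
  rw [mem_Vf] at *
  obtain ⟨a, ha, h⟩ := hv
  exact ⟨a, ha.trans hjk, h⟩

lemma mon_Vf {u v : V} {j} (h : v ∈ w.Vf u j) (μ) : w.mon μ v ∈ w.Vf u (j + μ.degree) := by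
  induction μ using sum_induction with
  | h0 => simpa using h
  | h1 α i ih =>
    rw [← X_mul_mon, map_add, Finsupp.degree_single, ← add_assoc]
    exact w.Vf_X i ih
  | h2 α i hα ih =>
    have h0 : α (Sum.inl i) = 0 := DFunLike.congr_fun hα i
    have := w.Y_mul_mon i α
    rw [h0, zero_smul, add_zero] at this
    rw [← mon_mul_Y, ← this, map_add, Finsupp.degree_single, ← add_assoc]
    exact w.Vf_Y i ih

lemma q_Vf {u v : V} {j k} {a} (ha : a.totalDegree ≤ k) (h : v ∈ w.Vf u j) :
    w.q a v ∈ w.Vf u (j + k) := by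
  rw [a.as_sum, map_sum, LinearMap.sum_apply]
  apply Submodule.sum_mem
  intro m hm
  rw [q_monomial]
  apply Submodule.smul_mem
  have h1 := w.mon_Vf h m
  have h2 : m.degree ≤ k := (le_totalDegree hm).trans ha
  exact w.Vf_mono (by omega) h1

lemma eq_C_of_pderiv [CharZero F] (a : MvPolynomial (Fin n ⊕ Fin n) F)
    (h : ∀ i, pderiv i a = 0) : a = C (coeff 0 a) := by
  classical
  ext μ
  rw [coeff_C]
  split_ifs with h0
  · rw [h0]
  · obtain ⟨i, hi⟩ := Finsupp.ne_iff.mp (Ne.symm h0)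
    have hle : Finsupp.single i 1 ≤ μ := by
      rw [Finsupp.single_le_iff]; simp at hi; omega
    have h1 : coeff (μ - Finsupp.single i 1) (pderiv i a) = 0 := by rw [h]; simp
    rw [coeff_pderiv, tsub_add_cancel_of_le hle, mul_eq_zero] at h1
    rcases h1 with h1 | h1
    · exact h1
    · exact absurd h1 (Nat.cast_add_one_ne_zero _)

lemma inj [CharZero F] {L : Submodule F V} (hX : ∀ i, ∀ v ∈ L, w.X i v ∈ L)
    (hY : ∀ i, ∀ v ∈ L, w.Y i v ∈ L) {u : V} (hu : u ∉ L) (j : ℕ) :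
    ∀ a : MvPolynomial (Fin n ⊕ Fin n) F, a.totalDegree ≤ j → (∀ v ∈ w.Vf u j, w.q a v ∈ L) →
      a = 0 := by
  have hu0 : ∀ j, u ∈ w.Vf u j := fun j => (w.mem_Vf).2 ⟨1, by simp, by rw [q_one]; rfl⟩
  have hconst : ∀ c : F, w.q (C c) u ∈ L → c = 0 := by
    intro c hc
    by_contra h0
    apply hu
    have : w.q (C c) = c • 1 := by
      have := w.q_monomial 0 c
      simpa using this
    rw [this] at hc
    exact (L.smul_mem_iff h0).1 hc
  induction j with
  | zero =>
    intro a ha hk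
    rw [Nat.le_zero, totalDegree_eq_zero_iff_eq_C] at ha
    have := hk u (hu0 0)
    rw [ha] at this ⊢
    rw [hconst _ this, C_0]
  | succ j ih =>
    intro a ha hk
    have hd : ∀ i, pderiv i a = 0 := by
      intro i
      apply ih _ (totalDegree_pderiv_lt' _ _ _ ha)
      have hmono : ∀ v ∈ w.Vf u j, v ∈ w.Vf u (j+1) := by
        intro v hv
        rw [mem_Vf] at *
        obtain ⟨a, ha, h⟩ := hv
        exact ⟨a, ha.trans (Nat.le_succ _), h⟩
      intro v hv
      rcases i with i | i
      · have := congrArg (fun T : Module.End F V => T v) (w.Y_mul_q i a)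
        simp only [Module.End.mul_apply, LinearMap.add_apply] at this
        rw [← sub_eq_iff_eq_add'] at this
        rw [← this]
        exact L.sub_mem (hY _ _ (hk _ (hmono v hv))) (hk _ (w.Vf_Y i hv))
      · have := congrArg (fun T : Module.End F V => T v) (w.q_mul_X i a)
        simp only [Module.End.mul_apply, LinearMap.add_apply] at this
        rw [← sub_eq_iff_eq_add'] at this
        rw [← this]
        exact L.sub_mem (hk _ (w.Vf_X i hv)) (hX _ _ (hk _ (hmono v hv)))
    have hC := eq_C_of_pderiv a hd
    have := hk u (hu0 _)
    rw [hC] at this ⊢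
    rw [hconst _ this, C_0]

end
end Weyl
end
end RZ


set_option linter.unusedSimpArgs false
set_option linter.unusedVariables false
namespace RZ
noncomputable section

namespace Weyl
open MvPolynomial
section
variable {n : ℕ} {F : Type} [Field F] {V : Type} [AddCommGroup V] [Module F V]
  (w : Weyl n (Module.End F V))

lemma card_le_of {ι Q T : Type} [Fintype ι] [AddCommGroup Q] [Module F Q] [AddCommGroup T] [Module F T]
    [FiniteDimensional F Q] [FiniteDimensional F T] (B : ι → (Q →ₗ[F] T))
    (h : ∀ g : ι → F, ∑ i, g i • B i = 0 → ∀ i, g i = 0) :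
    Fintype.card ι ≤ Module.finrank F Q * Module.finrank F T := by
  have h1 : LinearIndependent F B := Fintype.linearIndependent_iff.2 h
  have := h1.fintype_card_le_finrank
  rwa [Module.finrank_linearMap] at this

lemma count [CharZero F] {L : Submodule F V} (hX : ∀ i, ∀ v ∈ L, w.X i v ∈ L)
    (hY : ∀ i, ∀ v ∈ L, w.Y i v ∈ L) {u : V} (hu : u ∉ L) (m : ℕ)
    (hfin : ∀ j, FiniteDimensional F (w.Vf u j)) :
    (m + 1) ^ n ≤ Module.finrank F ((w.Vf u (4 * n * m)).map L.mkQ) := by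
  set j := 2 * n * m with hj
  set P := w.Vf u j with hP
  set K : Submodule F P := L.comap P.subtype with hK
  obtain ⟨Q, hQ⟩ := K.exists_isCompl
  have hjj : j + j = 4 * n * m := by rw [hj]; ring
  set T := (w.Vf u (4 * n * m)).map L.mkQ with hT
  have : FiniteDimensional F P := hfin j
  have : FiniteDimensional F (w.Vf u (4 * n * m)) := hfin _
  have : FiniteDimensional F T := by rw [hT]; infer_instance
  let ex : (Fin n ⊕ Fin n → Fin (m + 1)) → (Fin n ⊕ Fin n →₀ ℕ) := fun γ =>
    Finsupp.equivFunOnFinite.symm fun a => (γ a : ℕ)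
  have hex : Function.Injective ex := by
    intro γ γ' h
    have h := Finsupp.equivFunOnFinite.symm.injective h
    ext a
    exact congrFun h a
  have hdeg : ∀ γ (c : F), (monomial (ex γ) c).totalDegree ≤ j := by
    intro γ c
    refine (totalDegree_monomial_le _ _).trans ?_
    rw [Finsupp.sum_fintype _ _ (by simp)]
    calc _ ≤ ∑ a : Fin n ⊕ Fin n, m := Finset.sum_le_sum fun a _ => by
            simp only [ex, Finsupp.equivFunOnFinite_symm_apply_apply]
            exact Nat.lt_succ_iff.mp (γ a).2
      _ = j := by
            rw [Finset.sum_const, Finset.card_univ, Fintype.card_sum, Fintype.card_fin,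
              smul_eq_mul, hj]; ring
  have hmem : ∀ γ, ∀ v : Q, (L.mkQ ∘ₗ w.q (monomial (ex γ) 1) ∘ₗ P.subtype ∘ₗ Q.subtype) v ∈ T := by
    intro γ v
    refine Submodule.mem_map_of_mem ?_
    rw [← hjj]
    exact w.q_Vf (hdeg γ 1) v.1.2
  have hcard := card_le_of (F := F) (Q := Q) (T := T) (fun γ =>
    (L.mkQ ∘ₗ w.q (monomial (ex γ) 1) ∘ₗ P.subtype ∘ₗ Q.subtype).codRestrict T (hmem γ)) (by
    intro g hg
    have ha : (∑ γ, monomial (ex γ) (g γ)) = 0 := by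
      refine w.inj hX hY hu j _ ?_ ?_
      · exact totalDegree_finsetSum_le fun γ _ => hdeg γ _
      intro v hv
      have hv' : (⟨v, hv⟩ : P) ∈ K ⊔ Q := by rw [hQ.sup_eq_top]; trivial
      obtain ⟨k, hk, q, hq, hkq⟩ := Submodule.mem_sup.1 hv'
      have h1 : v = k.1 + q.1 := by rw [← Submodule.coe_add, hkq]
      rw [h1, map_add]
      refine L.add_mem (w.q_mem hX hY _ _ hk) ?_
      have h2 := congrArg (fun g : Q →ₗ[F] T => (g ⟨q, hq⟩ : V ⧸ L)) hg
      simp only [LinearMap.sum_apply, LinearMap.smul_apply, Submodule.coe_sum, Submodule.coe_smul,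
        LinearMap.codRestrict_apply, LinearMap.comp_apply, Submodule.subtype_apply,
        LinearMap.zero_apply, Submodule.coe_zero, ← map_smul, ← map_sum] at h2
      rw [← LinearMap.mem_ker, Submodule.ker_mkQ] at h2
      convert h2 using 1
      rw [map_sum, LinearMap.sum_apply]
      refine Finset.sum_congr rfl fun γ _ => ?_
      rw [q_monomial, q_monomial, one_smul, map_smul]; rfl
    intro γ
    have := congrArg (coeff (ex γ)) ha
    classical
    rw [coeff_sum, coeff_zero] at this
    simpa [coeff_monomial, hex.eq_iff] using this)
  have hQT : Module.finrank F Q ≤ Module.finrank F T := by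
    have h1 := Submodule.finrank_add_eq_of_isCompl hQ
    have h2 := LinearMap.finrank_range_add_finrank_ker (L.mkQ ∘ₗ P.subtype)
    have h3 : LinearMap.ker (L.mkQ ∘ₗ P.subtype) = K := by
      rw [LinearMap.ker_comp, Submodule.ker_mkQ]
    rw [h3] at h2
    have h4 : LinearMap.range (L.mkQ ∘ₗ P.subtype) ≤ T := by
      rintro _ ⟨v, rfl⟩
      exact Submodule.mem_map_of_mem (w.Vf_mono (by omega) v.2)
    have h5 := Submodule.finrank_mono h4
    omega
  simp only [Fintype.card_fun, Fintype.card_sum, Fintype.card_fin] at hcard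
  have : ((m + 1) ^ n) ^ 2 ≤ (Module.finrank F T) ^ 2 := by
    calc ((m + 1) ^ n) ^ 2 = (m + 1) ^ (n + n) := by ring
      _ ≤ _ := hcard
      _ ≤ _ := by rw [sq]; exact Nat.mul_le_mul_right _ hQT
  exact (Nat.pow_le_pow_iff_left (by norm_num)).1 this

theorem bernstein [CharZero F] (Fil : ℕ → Submodule F V) 
    (hfin : ∀ j, FiniteDimensional F (Fil j)) (hmono : Monotone Fil) (c : ℕ)
    (hdim : ∀ j, Module.finrank F (Fil j) ≤ c * (j + 1) ^ n)
    (hXF : ∀ i j, ∀ v ∈ Fil j, w.X i v ∈ Fil (j + 1))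
    (hYF : ∀ i j, ∀ v ∈ Fil j, w.Y i v ∈ Fil (j + 1))
    (u : ℕ → V) (hu : ∀ k, ∃ j, u k ∈ Fil j) (hch : ∀ k, u (k + 1) ∈ w.Du (u k)) :
    ∃ k, u k ∈ w.Du (u (k + 1)) := by
  by_contra! hcon
  have hDX := fun k i (v : V) => w.Du_X (u := u k) (v := v) i
  have hDY := fun k i (v : V) => w.Du_Y (u := u k) (v := v) i
  have hle : ∀ k, w.Du (u (k + 1)) ≤ w.Du (u k) := by
    rintro k _ ⟨a, rfl⟩
    exact w.q_mem (hDX k) (hDY k) a _ (hch k)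
  have hVF : ∀ k j, u k ∈ Fil j → ∀ l, w.Vf (u k) l ≤ Fil (j + l) := by
    intro k j hk l v hv
    obtain ⟨a, ha, rfl⟩ := (w.mem_Vf).1 hv
    rw [a.as_sum, map_sum, LinearMap.sum_apply]
    apply Submodule.sum_mem
    intro m hm
    rw [q_monomial]
    apply Submodule.smul_mem
    have h2 : m.degree ≤ l := (le_totalDegree hm).trans ha
    refine hmono (Nat.add_le_add_left h2 j) ?_
    clear h2 hm
    induction m using sum_induction with
    | h0 => simpa using hk
    | h1 α i ih =>
      rw [← X_mul_mon, map_add, Finsupp.degree_single, ← add_assoc]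
      exact hXF i _ _ ih
    | h2 α i hα ih =>
      have h0 : α (Sum.inl i) = 0 := DFunLike.congr_fun hα i
      have := w.Y_mul_mon i α
      rw [h0, zero_smul, add_zero] at this
      rw [← mon_mul_Y, ← this, map_add, Finsupp.degree_single, ← add_assoc]
      exact hYF i _ _ ih
  set r := c * (4 * n + 1) ^ n + 1 with hr
  choose J hJ using hu
  set m := ∑ k ∈ Finset.range r, J k with hm
  have hJm : ∀ k < r, u k ∈ Fil m := fun k hk =>
    hmono (Finset.single_le_sum (f := J) (fun _ _ => Nat.zero_le _) (Finset.mem_range.2 hk)) (hJ k)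
  set G : ℕ → Submodule F V := fun k => Fil (m + 4 * n * m) ⊓ w.Du (u k) with hG
  have := hfin
  have hstep : ∀ k < r, Module.finrank F (G (k + 1)) + (m + 1) ^ n ≤ Module.finrank F (G k) := by
    intro k hk
    have hfV : ∀ j, FiniteDimensional F (w.Vf (u k) j) := fun j =>
      Submodule.finiteDimensional_of_le (hVF k m (hJm k hk) j)
    have h1 := w.count (hDX (k + 1)) (hDY (k + 1)) (hcon k) m hfV
    have h2 : (w.Vf (u k) (4 * n * m)).map (w.Du (u (k + 1))).mkQ ≤
        LinearMap.range ((w.Du (u (k + 1))).mkQ ∘ₗ (G k).subtype) := by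
      rintro _ ⟨v, hv, rfl⟩
      exact ⟨⟨v, hVF k m (hJm k hk) _ hv, w.Vf_le_Du _ _ hv⟩, rfl⟩
    have : FiniteDimensional F (G k) := Submodule.finiteDimensional_of_le inf_le_left
    have h3 := LinearMap.finrank_range_add_finrank_ker ((w.Du (u (k + 1))).mkQ ∘ₗ (G k).subtype)
    have h4 := Submodule.finrank_mono h2
    have h5 : Module.finrank F (G (k + 1)) =
        Module.finrank F (LinearMap.ker ((w.Du (u (k + 1))).mkQ ∘ₗ (G k).subtype)) := by
      have hGG : G (k + 1) = G k ⊓ w.Du (u (k + 1)) := by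
        simp only [hG]
        rw [inf_assoc, inf_eq_right.2 (hle k)]
      rw [LinearMap.ker_comp, Submodule.ker_mkQ,
        ← Submodule.finrank_map_subtype_eq, Submodule.map_comap_subtype, hGG]
    omega
  have hsum : ∀ k ≤ r, Module.finrank F (G k) + k * (m + 1) ^ n ≤ Module.finrank F (G 0) := by
    intro k
    induction k with
    | zero => simp
    | succ k ih =>
      intro hk
      have h1 := ih (by omega)
      have h2 := hstep k (by omega)
      rw [add_mul, one_mul]; omega
  have h1 := hsum r le_rfl
  have h2 : Module.finrank F (G 0) ≤ Module.finrank F (Fil (m + 4 * n * m)) :=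
    Submodule.finrank_mono inf_le_left
  have h3 := hdim (m + 4 * n * m)
  have h4 : (m + 4 * n * m + 1) ^ n ≤ (4 * n + 1) ^ n * (m + 1) ^ n := by
    rw [← mul_pow]
    apply Nat.pow_le_pow_left
    nlinarith
  have h5 : r * (m + 1) ^ n ≤ c * ((4 * n + 1) ^ n * (m + 1) ^ n) :=
    calc _ ≤ _ := by omega
      _ ≤ c * (m + 4 * n * m + 1) ^ n := h3
      _ ≤ _ := Nat.mul_le_mul_left _ h4
  have h6 : 0 < (m + 1) ^ n := by positivity
  rw [hr, add_mul, one_mul, mul_assoc] at h5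
  omega
end
end Weyl
end
end RZ


set_option linter.unusedSimpArgs false
set_option linter.unusedVariables false
namespace RZ
noncomputable section

section
variable {n : ℕ} {A : Type} [CommRing A] (f : MvPolynomial (Fin n) A)

/-- multiplication by `x_i` on E -/
def opX (i : Fin n) : Module.End A (ZE f) :=
  LinearMap.mulLeft A (Polynomial.C (toP f (MvPolynomial.X i)))

/-- multiplication by `s` on E -/
def opS : Module.End A (ZE f) := LinearMap.mulLeft A Polynomial.X

/-- the connection -/
def nab (i : Fin n) : Module.End A (ZE f) :=
  (dE f i).toLinearMap + LinearMap.mulLeft A (Polynomial.X * Polynomial.C (gP f i))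

/-- the shift operator -/
def tt : Module.End A (ZE f) where
  toFun p := Polynomial.C (toP f f) * p.comp (Polynomial.X + 1)
  map_add' p q := by rw [Polynomial.add_comp, mul_add]
  map_smul' a p := by
    rw [Polynomial.smul_comp, mul_smul_comm]; rfl

lemma opX_apply (i p) : opX f i p = Polynomial.C (toP f (MvPolynomial.X i)) * p := rfl
lemma opS_apply (p) : opS f p = Polynomial.X * p := rfl
lemma nab_apply (i p) : nab f i p = dE f i p + Polynomial.X * Polynomial.C (gP f i) * p := rfl
lemma tt_apply (p) : tt f p = Polynomial.C (toP f f) * p.comp (Polynomial.X + 1) := rfl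

lemma dE_comm (i j : Fin n) (p : ZE f) : dE f i (dE f j p) = dE f j (dE f i p) := by
  ext k; simp only [dE_coeff]; rw [dP_comm]

lemma dE_comp (i : Fin n) (p : ZE f) : dE f i (p.comp (Polynomial.X + 1)) =
    (dE f i p).comp (Polynomial.X + 1) := by
  induction p using Polynomial.induction_on' with
  | add p q hp hq => simp [Polynomial.add_comp, hp, hq]
  | monomial k a =>
    rw [← Polynomial.C_mul_X_pow_eq_monomial]
    simp [Polynomial.mul_comp]; ring

/-- The Weyl structure on E -/
def wE : Weyl n (Module.End A (ZE f)) where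
  X := opX f
  Y := nab f
  hX i j := by
    ext1 p; simp only [Module.End.mul_apply, opX_apply]; ring
  hY i j := by
    ext1 p
    simp only [Module.End.mul_apply, nab_apply, map_add, Derivation.leibniz, smul_eq_mul, dE_C, dE_X,
      dE_comm f i j, gP_closed f i j]
    ring
  hYX i j := by
    ext1 p
    simp only [Module.End.mul_apply, nab_apply, opX_apply, map_add, Derivation.leibniz, smul_eq_mul,
      dE_C, dE_X, dP_X, LinearMap.add_apply]
    split_ifs
    · simp; ring
    · simp; ring

lemma wE_X : (wE f).X = opX f := rfl
lemma wE_Y : (wE f).Y = nab f := rfl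

lemma _root_.RZ.Weyl.commute_mon {W : Type*} [Ring W] (w : Weyl n W) (c : W)
    (h1 : ∀ i, Commute c (w.X i)) (h2 : ∀ i, Commute c (w.Y i)) (μ) : Commute c (w.mon μ) :=
  (commute_cpow _ _ c h1 _).mul_right (commute_cpow _ _ c h2 _)

lemma opS_X (i) : Commute (opS f) (opX f i) := by
  ext1 p; simp only [Module.End.mul_apply, opX_apply, opS_apply]; ring
lemma opS_Y (i) : Commute (opS f) (nab f i) := by
  ext1 p
  simp only [Module.End.mul_apply, nab_apply, opS_apply, Derivation.leibniz, smul_eq_mul, dE_X]; ring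
lemma tt_X (i) : Commute (tt f) (opX f i) := by
  ext1 p
  simp only [Module.End.mul_apply, opX_apply, tt_apply, Polynomial.mul_comp, Polynomial.C_comp]; ring
lemma tt_Y (i) : Commute (tt f) (nab f i) := by
  ext1 p
  simp only [Module.End.mul_apply, nab_apply, tt_apply, Polynomial.mul_comp, Polynomial.C_comp,
    Polynomial.add_comp, Polynomial.X_comp, Derivation.leibniz, smul_eq_mul, dE_C, dE_comp, dP_toP]
  have h : toP f (MvPolynomial.pderiv i f) = toP f f * gP f i := by
    rw [gP, mul_left_comm, f_mul_finv, mul_one]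
  rw [h, Polynomial.C_mul]; ring
lemma tt_S : tt f * opS f = opS f * tt f + tt f := by
  ext1 p
  simp only [Module.End.mul_apply, opS_apply, tt_apply, Polynomial.mul_comp, Polynomial.C_comp,
    Polynomial.add_comp, Polynomial.X_comp, LinearMap.add_apply]; ring

/-- exponents -/
abbrev SI (n : ℕ) : Type := (Fin n ⊕ Fin n) ⊕ Unit

/-- the generators `x^α ∇^β s^c . 1` -/
def ee (μ : SI n →₀ ℕ) : ZE f := (wE f).mon (lft μ) (Polynomial.X ^ (μ (Sum.inr ())))

lemma ee_zero : ee f 0 = 1 := by simp [ee]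

lemma opX_ee (i μ) : opX f i (ee f μ) = ee f (μ + Finsupp.single (Sum.inl (Sum.inl i)) 1) := by
  have := (wE f).X_mul_mon i (lft μ)
  rw [wE_X] at this
  simp only [ee, lft_add, lft_inl, ← this]
  simp [Module.End.mul_apply]

lemma nab_ee (i μ) : nab f i (ee f μ) = ee f (μ + Finsupp.single (Sum.inl (Sum.inr i)) 1) +
    (μ (Sum.inl (Sum.inl i))) • ee f (μ - Finsupp.single (Sum.inl (Sum.inl i)) 1) := by
  have := (wE f).Y_mul_mon i (lft μ)
  rw [(wE f).mon_mul_Y, wE_Y] at this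
  have h2 := congrArg (fun T : Module.End A (ZE f) => T (Polynomial.X ^ (μ (Sum.inr ())))) this
  simp only [Module.End.mul_apply, LinearMap.add_apply, LinearMap.smul_apply] at h2
  simp only [ee, lft_add, lft_inl, lft_sub]
  rw [h2]
  simp

lemma opS_ee (μ) : opS f (ee f μ) = ee f (μ + Finsupp.single (Sum.inr ()) 1) := by
  have := (wE f).commute_mon (opS f) (opS_X f) (opS_Y f) (lft μ)
  have h2 := congrArg (fun T : Module.End A (ZE f) => T (Polynomial.X ^ (μ (Sum.inr ())))) this.eq
  simp only [Module.End.mul_apply] at h2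
  simp only [ee, lft_add, lft_inr, add_zero]
  rw [h2, opS_apply, ← pow_succ']
  simp

/-- `N` -/
def NN : Submodule A (ZE f) := Submodule.span A (Set.range (ee f))

lemma ee_mem (μ) : ee f μ ∈ NN f := Submodule.subset_span ⟨μ, rfl⟩

lemma one_mem_NN : (1 : ZE f) ∈ NN f := by rw [← ee_zero]; exact ee_mem f 0

lemma NN_stable (T : Module.End A (ZE f)) (h : ∀ μ, T (ee f μ) ∈ NN f) : ∀ v ∈ NN f, T v ∈ NN f := by
  intro v hv
  have : NN f ≤ (NN f).comap T := by
    rw [NN, Submodule.span_le]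
    rintro _ ⟨μ, rfl⟩
    exact h μ
  exact this hv

lemma opX_NN (i) : ∀ v ∈ NN f, opX f i v ∈ NN f :=
  NN_stable f _ fun μ => by rw [opX_ee]; exact ee_mem f _
lemma opS_NN : ∀ v ∈ NN f, opS f v ∈ NN f :=
  NN_stable f _ fun μ => by rw [opS_ee]; exact ee_mem f _
lemma nab_NN (i) : ∀ v ∈ NN f, nab f i v ∈ NN f :=
  NN_stable f _ fun μ => by
    rw [nab_ee]; exact (NN f).add_mem (ee_mem f _) ((NN f).nsmul_mem (ee_mem f _) _)

lemma poly_NN (r : MvPolynomial (Fin n) A) : ∀ v ∈ NN f, Polynomial.C (toP f r) * v ∈ NN f := by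
  intro v hv
  induction r using MvPolynomial.induction_on with
  | C a =>
    have : Polynomial.C (toP f (MvPolynomial.C a)) * v = a • v := by
      rw [Algebra.smul_def]; rfl
    rw [this]; exact (NN f).smul_mem _ hv
  | add p q hp hq => rw [map_add, map_add, add_mul]; exact (NN f).add_mem hp hq
  | mul_X p j hp =>
    rw [map_mul, map_mul, mul_right_comm, mul_comm]
    exact opX_NN f j _ hp

lemma cpow_mem' {L : Submodule A (ZE f)} (Z : Fin n → Module.End A (ZE f)) (hZ)
    (h : ∀ i, ∀ v ∈ L, Z i v ∈ L) (β) : ∀ v ∈ L, cpow Z hZ β v ∈ L := by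
  induction β using expo_induction with
  | h0 => simp
  | h1 β i ih => intro v hv; rw [cpow_succ]; exact h i _ (ih v hv)

lemma mon_NN (μ) : ∀ v ∈ NN f, (wE f).mon μ v ∈ NN f := fun v hv =>
  cpow_mem' f _ _ (opX_NN f) _ _ (cpow_mem' f _ _ (nab_NN f) _ _ hv)

lemma tt_inj : Function.Injective (tt f) := by
  intro p q h
  rw [tt_apply, tt_apply] at h
  have h1 := ((isUnit_f f).map (Polynomial.C)).mul_left_cancel h
  have h2 := congrArg (fun r : ZE f => r.comp (Polynomial.X - 1)) h1
  simpa [Polynomial.comp_assoc] using h2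

lemma spow_NN (g : Polynomial A) : ∀ v ∈ NN f,
    (g.map (algebraMap A (ZP f)) : ZE f) * v ∈ NN f := by
  intro v hv
  induction g using Polynomial.induction_on with
  | C a =>
    rw [Polynomial.map_C]
    have : Polynomial.C (algebraMap A (ZP f) a) * v = a • v := by
      rw [Algebra.smul_def]; rfl
    rw [this]; exact (NN f).smul_mem _ hv
  | add p q hp hq => rw [Polynomial.map_add, add_mul]; exact (NN f).add_mem hp hq
  | monomial k a h =>
    rw [pow_succ', mul_left_comm, Polynomial.map_mul, Polynomial.map_X, mul_assoc]
    exact opS_NN f _ h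

lemma tt_NN : ∀ v ∈ NN f, tt f v ∈ NN f :=
  NN_stable f _ fun μ => by
    have := (wE f).commute_mon (tt f) (tt_X f) (tt_Y f) (lft μ)
    have h2 := congrArg (fun T : Module.End A (ZE f) => T (Polynomial.X ^ (μ (Sum.inr ())))) this.eq
    simp only [Module.End.mul_apply] at h2
    rw [ee, h2]
    apply mon_NN
    rw [tt_apply]
    apply poly_NN
    have := spow_NN f ((Polynomial.X + 1) ^ (μ (Sum.inr ()))) 1 (one_mem_NN f)
    simpa using this

/-- `tN` -/
def tN : Submodule A (ZE f) := (NN f).map (tt f)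

lemma tN_le : tN f ≤ NN f := by
  rintro _ ⟨v, hv, rfl⟩; exact tt_NN f v hv

lemma opX_tN (i) : ∀ v ∈ tN f, opX f i v ∈ tN f := by
  rintro _ ⟨v, hv, rfl⟩
  exact ⟨opX f i v, opX_NN f i v hv, congrArg (fun T : Module.End A (ZE f) => T v) (tt_X f i).eq⟩
lemma nab_tN (i) : ∀ v ∈ tN f, nab f i v ∈ tN f := by
  rintro _ ⟨v, hv, rfl⟩
  exact ⟨nab f i v, nab_NN f i v hv, congrArg (fun T : Module.End A (ZE f) => T v) (tt_Y f i).eq⟩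
lemma opS_tN : ∀ v ∈ tN f, opS f v ∈ tN f := by
  rintro _ ⟨v, hv, rfl⟩
  refine ⟨opS f v - v, (NN f).sub_mem (opS_NN f v hv) hv, ?_⟩
  have := congrArg (fun T : Module.End A (ZE f) => T v) (tt_S f)
  simp only [Module.End.mul_apply, LinearMap.add_apply] at this
  rw [map_sub, this]; simp

lemma spow_tN (g : Polynomial A) : ∀ v ∈ tN f,
    (g.map (algebraMap A (ZP f)) : ZE f) * v ∈ tN f := by
  intro v hv
  induction g using Polynomial.induction_on with
  | C a =>
    rw [Polynomial.map_C]
    have : Polynomial.C (algebraMap A (ZP f) a) * v = a • v := by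
      rw [Algebra.smul_def]; rfl
    rw [this]; exact (tN f).smul_mem _ hv
  | add p q hp hq => rw [Polynomial.map_add, add_mul]; exact (tN f).add_mem hp hq
  | monomial k a h =>
    rw [pow_succ', mul_left_comm, Polynomial.map_mul, Polynomial.map_X, mul_assoc]
    exact opS_tN f _ h

/-- membership in `tN` of a polynomial in `s` -/
def pS (g : Polynomial A) : ZE f := g.map (algebraMap A (ZP f))

end
end
end RZ


set_option linter.unusedSimpArgs false
set_option linter.unusedVariables false
namespace RZ
noncomputable section

section
variable {n : ℕ} {A : Type} [CommRing A] (f : MvPolynomial (Fin n) A)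
  {B : Type} [CommRing B] (π : A →+* B)

/-- base change of `f` -/
abbrev bc : MvPolynomial (Fin n) B := MvPolynomial.map π f

/-- base change on P -/
def mapP : ZP f →+* ZP (bc f π) :=
  IsLocalization.Away.lift (g := (toP (bc f π)).comp (MvPolynomial.map π)) f
    (isUnit_f (bc f π))

lemma mapP_toP (r) : mapP f π (toP f r) = toP (bc f π) (MvPolynomial.map π r) := by
  simp only [mapP]
  exact IsLocalization.Away.lift_eq f _ r

lemma mapP_finv : mapP f π (finv f) = finv (bc f π) := by
  have h1 := congrArg (mapP f π) (f_mul_finv f)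
  rw [map_mul, mapP_toP, map_one] at h1
  have h2 := f_mul_finv (bc f π)
  exact (isUnit_f (bc f π)).mul_left_cancel (h1.trans h2.symm)

lemma pderiv_map' (i : Fin n) (r : MvPolynomial (Fin n) A) :
    MvPolynomial.pderiv i (MvPolynomial.map π r) = MvPolynomial.map π (MvPolynomial.pderiv i r) :=
  MvPolynomial.pderiv_map

lemma dP_pow_finv (i : Fin n) (k : ℕ) : dP f i (finv f ^ k) =
    - (k : ZP f) * gP f i * finv f ^ k := by
  rw [Derivation.leibniz_pow, dP_finv, gP]
  rcases k with _ | k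
  · simp
  · simp only [Nat.add_sub_cancel, smul_eq_mul, nsmul_eq_mul]; ring

lemma mapP_gP (i) : mapP f π (gP f i) = gP (bc f π) i := by
  rw [gP, gP, map_mul, mapP_toP, mapP_finv, pderiv_map']

lemma mapP_dP (i) (p) : mapP f π (dP f i p) = dP (bc f π) i (mapP f π p) := by
  obtain ⟨k, r, rfl⟩ := surjP' f p
  simp only [Derivation.leibniz, dP_pow_finv, map_mul, map_pow, map_add, map_neg, map_natCast, mapP_toP,
    mapP_finv, mapP_gP, dP_toP, smul_eq_mul, pderiv_map']

lemma mapP_inj (hπ : Function.Injective π) : Function.Injective (mapP f π) := by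
  rw [injective_iff_map_eq_zero]
  intro p hp
  obtain ⟨k, r, hr⟩ := surjP f p
  have h1 := congrArg (mapP f π) hr
  rw [map_mul, hp, mul_zero, mapP_toP] at h1
  obtain ⟨⟨_, m, rfl⟩, hc⟩ := (IsLocalization.map_eq_zero_iff (Submonoid.powers (bc f π)) _ _).1 h1.symm
  simp only [← map_pow, ← map_mul] at hc
  have h2 := (map_eq_zero_iff _ (MvPolynomial.map_injective π hπ)).1 hc
  have h3 : toP f (f ^ m * r) = 0 := by rw [h2, map_zero]
  rw [map_mul, ← hr, ← mul_assoc, map_pow, ← pow_add] at h3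
  exact ((isUnit_f f).pow _).mul_left_cancel (h3.trans (mul_zero _).symm)

/-- base change on E -/
def mapE : ZE f →+* ZE (bc f π) := Polynomial.mapRingHom (mapP f π)

@[simp] lemma mapE_C (p) : mapE f π (Polynomial.C p) = Polynomial.C (mapP f π p) := by simp [mapE]
@[simp] lemma mapE_X : mapE f π (Polynomial.X) = Polynomial.X := by simp [mapE]

lemma mapE_inj (hπ : Function.Injective π) : Function.Injective (mapE f π) :=
  Polynomial.map_injective _ (mapP_inj f π hπ)

lemma mapE_dE (i) (p) : mapE f π (dE f i p) = dE (bc f π) i (mapE f π p) := by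
  ext k
  simp only [mapE, Polynomial.coe_mapRingHom, Polynomial.coeff_map, dE_coeff, mapP_dP]

lemma mapE_opX (i) (p) : mapE f π (opX f i p) = opX (bc f π) i (mapE f π p) := by
  simp [opX_apply, mapP_toP]
lemma mapE_opS (p) : mapE f π (opS f p) = opS (bc f π) (mapE f π p) := by
  simp [opS_apply]
lemma mapE_nab (i) (p) : mapE f π (nab f i p) = nab (bc f π) i (mapE f π p) := by
  simp [nab_apply, mapE_dE, mapP_gP]
lemma mapE_tt (p) : mapE f π (tt f p) = tt (bc f π) (mapE f π p) := by
  simp only [tt_apply, map_mul, mapE_C, mapP_toP]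
  congr 1
  simp [mapE, Polynomial.map_comp]

lemma alg_toP (a : A) : algebraMap A (ZP f) a = toP f (MvPolynomial.C a) := by
  rw [IsScalarTower.algebraMap_apply A (MvPolynomial (Fin n) A) (ZP f)]; rfl

lemma mapE_smul (a : A) (p) : mapE f π (a • p) = π a • mapE f π p := by
  rw [Algebra.smul_def, Algebra.smul_def, map_mul]
  congr 1
  change mapE f π (Polynomial.C (algebraMap A (ZP f) a)) = Polynomial.C (algebraMap B (ZP (bc f π)) (π a))
  rw [mapE_C, alg_toP, alg_toP, mapP_toP, MvPolynomial.map_C]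

lemma mapE_cpow (Z : Fin n → Module.End A (ZE f)) (hZ) (Z' : Fin n → Module.End B (ZE (bc f π))) (hZ')
    (h : ∀ i p, mapE f π (Z i p) = Z' i (mapE f π p)) (β) (p) :
    mapE f π (cpow Z hZ β p) = cpow Z' hZ' β (mapE f π p) := by
  induction β using expo_induction generalizing p with
  | h0 => simp
  | h1 β i ih => rw [cpow_succ, cpow_succ, Module.End.mul_apply, h, ih]; rfl

lemma mapE_mon (μ) (p) : mapE f π ((wE f).mon μ p) = (wE (bc f π)).mon μ (mapE f π p) := by
  rw [Weyl.mon, Weyl.mon, Module.End.mul_apply, Module.End.mul_apply,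
    mapE_cpow f π (wE f).X _ (wE (bc f π)).X (wE (bc f π)).hX (mapE_opX f π),
    mapE_cpow f π (wE f).Y _ (wE (bc f π)).Y (wE (bc f π)).hY (mapE_nab f π)]

lemma mapE_ee (μ) : mapE f π (ee f μ) = ee (bc f π) μ := by
  rw [ee, ee, mapE_mon]; simp

lemma mapE_pS (g : Polynomial A) : mapE f π (pS f g) = pS (bc f π) (g.map π) := by
  rw [pS, pS, mapE, Polynomial.coe_mapRingHom, Polynomial.map_map, Polynomial.map_map]
  congr 1
  ext a
  simp only [RingHom.comp_apply]
  rw [alg_toP, alg_toP, mapP_toP, MvPolynomial.map_C]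

lemma clearE (p : ZE f) : ∃ (k : ℕ) (P : Polynomial (MvPolynomial (Fin n) A)),
    Polynomial.C (toP f f ^ k) * p = P.map (toP f) := by
  induction p using Polynomial.induction_on' with
  | add p q hp hq =>
    obtain ⟨k, P, h⟩ := hp
    obtain ⟨l, Q, h'⟩ := hq
    refine ⟨k + l, Polynomial.C (f ^ l) * P + Polynomial.C (f ^ k) * Q, ?_⟩
    simp only [Polynomial.map_add, Polynomial.map_mul, Polynomial.map_C, ← h, ← h', map_pow, Polynomial.map_pow, pow_add,
      map_mul]
    ring
  | monomial k a =>
    obtain ⟨N, r, h⟩ := surjP f a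
    refine ⟨N, Polynomial.monomial k r, ?_⟩
    rw [Polynomial.C_mul_monomial, h, Polynomial.map_monomial]

lemma toP_inj [IsDomain A] (hf : f ≠ 0) : Function.Injective (toP f) := by
  exact IsLocalization.injective _ (powers_le_nonZeroDivisors_of_noZeroDivisors hf)

lemma ZP_domain [IsDomain A] (hf : f ≠ 0) : IsDomain (ZP f) :=
  IsLocalization.isDomain_localization (powers_le_nonZeroDivisors_of_noZeroDivisors hf)

end
end
end RZ


set_option linter.unusedSimpArgs false
set_option linter.unusedVariables false
namespace RZ
noncomputable section

section
variable {n : ℕ} {F : Type} [Field F] (f : MvPolynomial (Fin n) F) (σ : F)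

/-- The Weyl structure on `P` obtained by specialising `s` to `σ`. -/
def wS : Weyl n (Module.End F (ZP f)) where
  X i := LinearMap.mulLeft F (toP f (MvPolynomial.X i))
  Y i := (dP f i).toLinearMap + LinearMap.mulLeft F (σ • gP f i)
  hX i j := by
    ext1 p; simp only [Module.End.mul_apply, LinearMap.mulLeft_apply]; ring
  hY i j := by
    ext1 p
    simp only [Module.End.mul_apply, LinearMap.add_apply, LinearMap.mulLeft_apply, map_add,
      Derivation.leibniz, smul_eq_mul, Derivation.coeFn_coe, Derivation.map_smul, 
      dP_comm f i j, gP_closed f i j, map_smul]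
    ring
  hYX i j := by
    ext1 p
    simp only [Module.End.mul_apply, LinearMap.add_apply, LinearMap.mulLeft_apply, map_add,
      Derivation.leibniz, smul_eq_mul, Derivation.coeFn_coe, Derivation.map_smul, dP_X]
    split_ifs
    · simp; ring_nf
    · simp; ring_nf

lemma wS_X (i p) : (wS f σ).X i p = toP f (MvPolynomial.X i) * p := rfl
lemma wS_Y (i p) : (wS f σ).Y i p = dP f i p + (σ • gP f i) * p := rfl

/-- filtration map -/
def filMap (j : ℕ) : MvPolynomial (Fin n) F →ₗ[F] ZP f :=
  (LinearMap.mulLeft F (finv f ^ j)).comp (Algebra.linearMap (MvPolynomial (Fin n) F) (ZP f) |>.restrictScalars F)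

lemma filMap_apply (j r) : filMap f j r = finv f ^ j * toP f r := rfl

/-- filtration -/
def filF (j : ℕ) : Submodule F (ZP f) :=
  (MvPolynomial.restrictTotalDegree (Fin n) F (j * (f.totalDegree + 1))).map (filMap f j)

lemma mem_filF {j : ℕ} {p : ZP f} : p ∈ filF f j ↔ ∃ r : MvPolynomial (Fin n) F,
    r.totalDegree ≤ j * (f.totalDegree + 1) ∧ finv f ^ j * toP f r = p := by
  simp only [filF, Submodule.mem_map, MvPolynomial.mem_restrictTotalDegree]; rfl

lemma finrank_rtd (m : ℕ) : Module.finrank F (MvPolynomial.restrictTotalDegree (Fin n) F m) ≤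
    (m + 1) ^ n := by
  have b := MvPolynomial.basisRestrictSupport F {d : Fin n →₀ ℕ | d.degree ≤ m}
  have h : MvPolynomial.restrictTotalDegree (Fin n) F m = 
    MvPolynomial.restrictSupport F {d : Fin n →₀ ℕ | d.degree ≤ m} := rfl
  rw [h, Module.finrank_eq_nat_card_basis b]
  let g : {d : Fin n →₀ ℕ | d.degree ≤ m} → (Fin n → Fin (m + 1)) := fun d i =>
    ⟨d.1 i, Nat.lt_succ_of_le ((Finsupp.le_degree i d.1).trans d.2)⟩
  have hg : Function.Injective g := by
    intro d e hde
    apply Subtype.ext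
    ext i
    exact congrArg Fin.val (congrFun hde i)
  have := Nat.card_le_card_of_injective g hg
  simpa using this

lemma filF_mono : Monotone (filF f) := by
  apply monotone_nat_of_le_succ
  intro j p hp
  obtain ⟨r, hr, rfl⟩ := (mem_filF f).1 hp
  refine (mem_filF f).2 ⟨r * f, ?_, ?_⟩
  · refine (MvPolynomial.totalDegree_mul _ _).trans ?_
    linarith
  · rw [map_mul, pow_succ]
    linear_combination (finv f ^ j * toP f r) * f_mul_finv f

lemma filF_X (i j) : ∀ v ∈ filF f j, (wS f σ).X i v ∈ filF f (j + 1) := by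
  intro p hp
  obtain ⟨r, hr, rfl⟩ := (mem_filF f).1 hp
  refine (mem_filF f).2 ⟨MvPolynomial.X i * (r * f), ?_, ?_⟩
  · refine (MvPolynomial.totalDegree_mul _ _).trans ?_
    have h1 := (MvPolynomial.totalDegree_mul r f)
    rw [MvPolynomial.totalDegree_X]
    linarith
  · rw [wS_X, map_mul, map_mul, pow_succ]
    linear_combination (toP f (MvPolynomial.X i) * finv f ^ j * toP f r) * f_mul_finv f

open MvPolynomial in
lemma tdp' (i) (a : MvPolynomial (Fin n) F) (j : ℕ)
    (h : a.totalDegree ≤ j + 1) : (pderiv i a).totalDegree ≤ j := by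
  classical
  rw [totalDegree] at *
  apply Finset.sup_le
  intro m hm
  rw [mem_support_iff, coeff_pderiv] at hm
  have h1 : m + Finsupp.single i 1 ∈ a.support := by
    rw [mem_support_iff]; intro h0; apply hm; rw [h0, zero_mul]
  have h2 := (Finset.le_sup (f := fun s : Fin n →₀ ℕ => s.sum fun _ e => e) h1).trans h
  rw [Finsupp.sum_add_index' (by simp) (by simp), Finsupp.sum_single_index rfl] at h2
  omega

lemma totalDegree_pderiv_le (i) (r : MvPolynomial (Fin n) F) :
    (MvPolynomial.pderiv i r).totalDegree ≤ r.totalDegree := by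
  obtain ⟨j, hj, h⟩ : ∃ j, j ≤ r.totalDegree ∧ r.totalDegree ≤ j + 1 := ⟨r.totalDegree - 1, by omega, by omega⟩
  refine le_trans ?_ hj
  exact tdp' i r j h

lemma filF_Y (i j) : ∀ v ∈ filF f j, (wS f σ).Y i v ∈ filF f (j + 1) := by
  intro p hp
  obtain ⟨r, hr, rfl⟩ := (mem_filF f).1 hp
  refine (mem_filF f).2 ⟨f * MvPolynomial.pderiv i r +
    MvPolynomial.C (σ - j) * (r * MvPolynomial.pderiv i f), ?_, ?_⟩
  · have h1 := (MvPolynomial.totalDegree_mul f (MvPolynomial.pderiv i r))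
    have h2 := (MvPolynomial.totalDegree_mul r (MvPolynomial.pderiv i f))
    have h3 := MvPolynomial.totalDegree_mul (MvPolynomial.C (σ - j)) (r * MvPolynomial.pderiv i f)
    have h4 := totalDegree_pderiv_le i f
    have h5 := totalDegree_pderiv_le i r
    rw [MvPolynomial.totalDegree_C] at h3
    refine (MvPolynomial.totalDegree_add _ _).trans (max_le ?_ ?_)
    · linarith
    · linarith
  · rw [wS_Y, Algebra.smul_def, alg_toP]
    simp only [Derivation.leibniz, dP_pow_finv, map_mul, map_add, map_sub, smul_eq_mul, dP_toP, pow_succ, gP,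
      map_natCast]
    linear_combination (finv f ^ j * toP f (MvPolynomial.pderiv i r)) * f_mul_finv f

lemma Du_poly {u v : ZP f} (h : v ∈ (wS f σ).Du u) (r : MvPolynomial (Fin n) F) :
    toP f r * v ∈ (wS f σ).Du u := by
  induction r using MvPolynomial.induction_on with
  | C a => rw [← alg_toP, ← Algebra.smul_def]; exact Submodule.smul_mem _ _ h
  | add p q hp hq => rw [map_add, add_mul]; exact Submodule.add_mem _ hp hq
  | mul_X p j hp =>
    rw [map_mul, mul_right_comm, mul_comm]
    exact (wS f σ).Du_X j hp

theorem bern1 [CharZero F] : ∃ k : ℕ, toP f f ^ k ∈ (wS f σ).Du (toP f f ^ (k + 1)) := by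
  have hfin : ∀ j, FiniteDimensional F (filF f j) := by
    intro j; rw [filF]; infer_instance
  refine (wS f σ).bernstein (filF f) hfin (filF_mono f) ((f.totalDegree + 1) ^ n) ?_
    (filF_X f σ) (filF_Y f σ) (fun k => toP f f ^ k) ?_ ?_
  · intro j
    have h1 := Submodule.finrank_map_le (filMap f j)
      (MvPolynomial.restrictTotalDegree (Fin n) F (j * (f.totalDegree + 1)))
    refine h1.trans ((finrank_rtd _).trans ?_)
    rw [← mul_pow]
    apply Nat.pow_le_pow_left
    nlinarith
  · intro k
    refine ⟨k * f.totalDegree, (mem_filF f).2 ⟨f ^ (k * f.totalDegree) * f ^ k, ?_, ?_⟩⟩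
    · rw [← pow_add]
      refine (MvPolynomial.totalDegree_pow _ _).trans (le_of_eq ?_)
      ring
    · rw [map_mul, map_pow, ← mul_assoc, ← mul_pow, mul_comm (finv f), f_mul_finv, one_pow, one_mul,
        map_pow]
  · intro k
    rw [pow_succ']
    apply Du_poly
    exact ((wS f σ).mem_Du).2 ⟨1, by rw [Weyl.q_one]; rfl⟩
end
end
end RZ


set_option linter.unusedSimpArgs false
set_option linter.unusedVariables false
namespace RZ
noncomputable section

section
variable {n : ℕ}

lemma Weyl.map_mon {A B M M' : Type} [CommRing A] [CommRing B] [AddCommGroup M] [AddCommGroup M'] [Module A M]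
    [Module B M'] (w : Weyl n (Module.End A M)) (w' : Weyl n (Module.End B M')) (ψ : M → M')
    (hX : ∀ i p, ψ (w.X i p) = w'.X i (ψ p)) (hY : ∀ i p, ψ (w.Y i p) = w'.Y i (ψ p)) (μ) (p) :
    ψ (w.mon μ p) = w'.mon μ (ψ p) := by
  have key : ∀ (Z : Fin n → Module.End A M) (hZ) (Z' : Fin n → Module.End B M') (hZ')
    (h : ∀ i p, ψ (Z i p) = Z' i (ψ p)) (β) (p), ψ (cpow Z hZ β p) = cpow Z' hZ' β (ψ p) := by
    intro Z hZ Z' hZ' h β p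
    induction β using expo_induction generalizing p with
    | h0 => simp
    | h1 β i ih => rw [cpow_succ, cpow_succ, Module.End.mul_apply, h, ih]; rfl
  rw [Weyl.mon, Weyl.mon, Module.End.mul_apply, Module.End.mul_apply,
    key w.X _ w'.X w'.hX hX, key w.Y _ w'.Y w'.hY hY]

variable {K : Type} [Field K] (f : MvPolynomial (Fin n) K)

/-- rational functions in `s` -/
abbrev FS (K : Type) [Field K] : Type := FractionRing (Polynomial K)

/-- embedding of constants -/
abbrev iK (K : Type) [Field K] : K →+* FS K := (algebraMap (Polynomial K) (FS K)).comp Polynomial.C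

/-- the generic point -/
def sig (K : Type) [Field K] : FS K := algebraMap (Polynomial K) (FS K) Polynomial.X

/-- specialisation at the generic point -/
def psi : ZE f →+* ZP (bc f (iK K)) :=
  Polynomial.eval₂RingHom (mapP f (iK K)) (algebraMap (FS K) _ (sig K))

lemma psi_C (p) : psi f (Polynomial.C p) = mapP f (iK K) p := by simp [psi]
lemma psi_X : psi f Polynomial.X = algebraMap (FS K) _ (sig K) := by simp [psi]

lemma psi_dE (i p) : psi f (dE f i p) = dP (bc f (iK K)) i (psi f p) := by
  induction p using Polynomial.induction_on' with
  | add p q hp hq => simp [hp, hq]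
  | monomial k a =>
    rw [← Polynomial.C_mul_X_pow_eq_monomial]
    simp only [Derivation.leibniz, Derivation.leibniz_pow, dE_X, dE_C, map_add, map_mul, map_pow, psi_C, psi_X,
      smul_zero, smul_eq_mul, mul_zero, map_zero, mapP_dP, zero_add, Derivation.map_algebraMap]

lemma psi_X' (i p) : psi f ((wE f).X i p) = (wS (bc f (iK K)) (sig K)).X i (psi f p) := by
  rw [wE_X, opX_apply, wS_X, map_mul, psi_C, mapP_toP, MvPolynomial.map_X]

lemma psi_Y' (i p) : psi f ((wE f).Y i p) = (wS (bc f (iK K)) (sig K)).Y i (psi f p) := by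
  rw [wE_Y, nab_apply, wS_Y, map_add, psi_dE, map_mul, map_mul, psi_X, psi_C, mapP_gP, Algebra.smul_def]

lemma psi_pS (g : Polynomial K) : psi f (pS f g) = algebraMap (FS K) _ (algebraMap (Polynomial K) (FS K) g) := by
  have : (psi f).comp (Polynomial.mapRingHom (algebraMap K (ZP f))) =
     (algebraMap (FS K) (ZP (bc f (iK K)))).comp (algebraMap (Polynomial K) (FS K)) := by
    apply Polynomial.ringHom_ext
    · intro a
      simp only [RingHom.comp_apply, Polynomial.coe_mapRingHom, Polynomial.map_C, psi_C]
      rw [alg_toP, mapP_toP, alg_toP, MvPolynomial.map_C]; rfl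
    · simp only [RingHom.comp_apply, Polynomial.coe_mapRingHom, Polynomial.map_X, psi_X]; rfl
  exact DFunLike.congr_fun this g

/-- swap -/
def swp (n : ℕ) (K : Type) [Field K] : Polynomial (MvPolynomial (Fin n) K) →+* MvPolynomial (Fin n) (Polynomial K) :=
  Polynomial.eval₂RingHom (MvPolynomial.map Polynomial.C) (MvPolynomial.C Polynomial.X)

lemma swp_coeff (P : Polynomial (MvPolynomial (Fin n) K)) (α : Fin n →₀ ℕ) (k : ℕ) :
    ((swp n K P).coeff α).coeff k = (P.coeff k).coeff α := by
  induction P using Polynomial.induction_on' with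
  | add p q hp hq => simp [hp, hq]
  | monomial l a =>
    simp only [swp, Polynomial.coe_eval₂RingHom, Polynomial.eval₂_monomial, ← map_pow]
    rw [mul_comm, MvPolynomial.coeff_C_mul, MvPolynomial.coeff_map, mul_comm, Polynomial.coeff_C_mul_X_pow,
      Polynomial.coeff_monomial]
    split_ifs <;> simp_all

lemma psi_inj (hf : f ≠ 0) : Function.Injective (psi f) := by
  rw [injective_iff_map_eq_zero]
  intro p hp
  have hi : Function.Injective (iK K) := (iK K).injective
  have hf' : bc f (iK K) ≠ 0 := by
    rw [Ne, map_eq_zero_iff _ (MvPolynomial.map_injective _ hi)]; exact hf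
  obtain ⟨k, P, hP⟩ := clearE f p
  have h1 := congrArg (psi f) hP
  rw [map_mul, hp, mul_zero] at h1
  have h2 : psi f (P.map (toP f)) = toP (bc f (iK K))
     (MvPolynomial.map (algebraMap (Polynomial K) (FS K)) (swp n K P)) := by
    have : (psi f).comp (Polynomial.mapRingHom (toP f)) = ((toP (bc f (iK K))).comp
        (MvPolynomial.map (algebraMap (Polynomial K) (FS K)))).comp (swp n K) := by
      apply Polynomial.ringHom_ext
      · intro a
        simp only [RingHom.comp_apply, Polynomial.coe_mapRingHom, Polynomial.map_C, psi_C, mapP_toP, swp,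
          Polynomial.coe_eval₂RingHom, Polynomial.eval₂_C, MvPolynomial.map_map]
      · simp only [RingHom.comp_apply, Polynomial.coe_mapRingHom, Polynomial.map_X, psi_X, swp,
          Polynomial.coe_eval₂RingHom, Polynomial.eval₂_X, MvPolynomial.map_C, alg_toP, sig]
    exact DFunLike.congr_fun this P
  rw [h2] at h1
  have h3 := (map_eq_zero_iff _ (toP_inj _ hf')).1 h1.symm
  have h4 := (map_eq_zero_iff _ (MvPolynomial.map_injective _ (IsFractionRing.injective (Polynomial K) (FS K)))).1 h3
  have h5 : P = 0 := by
    ext k α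
    rw [← swp_coeff, h4]; simp
  rw [h5, Polynomial.map_zero] at hP
  exact (((isUnit_f f).pow k).map Polynomial.C).mul_left_cancel (hP.trans (mul_zero _).symm)

lemma pS_tt {A : Type} [CommRing A] (f : MvPolynomial (Fin n) A) (g : Polynomial A) (v) :
    pS f g * tt f v = tt f (pS f (g.comp (Polynomial.X - 1)) * v) := by
  rw [tt_apply, tt_apply, Polynomial.mul_comp, pS, pS, Polynomial.map_comp, Polynomial.comp_assoc]
  simp
  ring

lemma pS_ttk {A : Type} [CommRing A] (f : MvPolynomial (Fin n) A) (k : ℕ) (g : Polynomial A) (v) :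
    pS f g * (tt f ^ k) v = (tt f ^ k) (pS f ((fun h : Polynomial A => h.comp (Polynomial.X - 1))^[k] g) * v) := by
  induction k generalizing g with
  | zero => simp
  | succ k ih => 
    rw [pow_succ', Module.End.mul_apply, pS_tt, ih]; simp

lemma shift_ne (k : ℕ) (g : Polynomial K) (hg : g ≠ 0) : 
    (fun h : Polynomial K => h.comp (Polynomial.X - 1))^[k] g ≠ 0 := by
  induction k generalizing g with
  | zero => simpa
  | succ k ih =>
    rw [Function.iterate_succ_apply]
    apply ih
    intro h
    apply hg
    have := congrArg (fun h : Polynomial K => h.comp (Polynomial.X + 1)) h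
    simpa [Polynomial.comp_assoc] using this

lemma ttk_one {A : Type} [CommRing A] (f : MvPolynomial (Fin n) A) (k : ℕ) :
   (tt f ^ k) 1 = Polynomial.C (toP f f ^ k) := by
  induction k with
  | zero => simp
  | succ k ih => rw [pow_succ', Module.End.mul_apply, ih, tt_apply]; simp [pow_succ']

lemma mon_tN {A : Type} [CommRing A] (f : MvPolynomial (Fin n) A) (μ) : ∀ v ∈ tN f, (wE f).mon μ v ∈ tN f := fun v hv =>
  cpow_mem' f _ _ (opX_tN f) _ _ (cpow_mem' f _ _ (nab_tN f) _ _ hv)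

theorem bern2 [CharZero K] (hf : f ≠ 0) : ∃ b : Polynomial K, b ≠ 0 ∧ pS f b ∈ tN f := by
  classical
  have : CharZero (FS K) := charZero_of_injective_ringHom (iK K).injective
  obtain ⟨k, a, hk⟩ := bern1 (bc f (iK K)) (sig K)
  obtain ⟨c, hc⟩ := IsLocalization.exist_integer_multiples_of_finset (nonZeroDivisors (Polynomial K))
    (a.support.image a.coeff)
  have hc' : ∀ μ : Fin n ⊕ Fin n →₀ ℕ, ∃ α : Polynomial K, algebraMap _ (FS K) α = 
      algebraMap _ (FS K) (c : Polynomial K) * a.coeff μ := by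
    intro μ
    by_cases h : μ ∈ a.support
    · obtain ⟨α, hα⟩ := hc _ (Finset.mem_image_of_mem _ h)
      exact ⟨α, by rw [hα, Algebra.smul_def]⟩
    · rw [MvPolynomial.notMem_support_iff] at h
      exact ⟨0, by rw [h]; simp⟩
  choose α hα using hc'
  have hrel : pS f (c : Polynomial K) * (tt f ^ k) 1 =
      ∑ μ ∈ a.support, pS f (α μ) * (wE f).mon μ ((tt f ^ (k + 1)) 1) := by
    apply psi_inj f hf
    rw [map_sum, map_mul, ttk_one, ttk_one, psi_C, map_pow, mapP_toP]
    change psi f (pS f ↑c) * (toP (bc f (iK K)) (bc f (iK K))) ^ k = _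
    rw [← hk]
    simp only [map_mul, (wE f).map_mon (wS _ (sig K)) (psi f) (psi_X' f) (psi_Y' f), psi_C, psi_pS, map_pow, mapP_toP, hα]
    conv_lhs => rw [MvPolynomial.as_sum a]
    simp only [LinearMap.flip_apply, map_sum, LinearMap.sum_apply, Weyl.q_monomial, LinearMap.smul_apply,
      Finset.mul_sum]
    apply Finset.sum_congr rfl
    intro μ _
    rw [Algebra.smul_def, ← mul_assoc]
  have hmon : ∀ μ, (wE f).mon μ ((tt f ^ (k + 1)) 1) = (tt f ^ k) ((wE f).mon μ (tt f 1)) := by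
    intro μ
    have := ((wE f).commute_mon (tt f) (tt_X f) (tt_Y f) μ).pow_left k
    have h2 := congrArg (fun T : Module.End K (ZE f) => T (tt f 1)) this.eq
    simp only [Module.End.mul_apply] at h2
    rw [h2, pow_succ, Module.End.mul_apply]
  have hinj : Function.Injective (tt f ^ k) := by
    rw [Module.End.coe_pow]; exact (tt_inj f).iterate k
  refine ⟨_, shift_ne k (c : Polynomial K) (nonZeroDivisors.coe_ne_zero c), ?_⟩
  simp only [hmon, pS_ttk] at hrel
  rw [← map_sum, mul_one] at hrel
  rw [hinj hrel]
  apply Submodule.sum_mem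
  intro μ _
  apply spow_tN
  apply mon_tN
  exact ⟨1, one_mem_NN f, rfl⟩
end
end
end RZ


set_option linter.unusedSimpArgs false
set_option linter.unusedVariables false
set_option linter.unusedSectionVars false
namespace RZ
noncomputable section

section
lemma charP_end (R : Type) [Ring R] (p : ℕ) [CharP R p] : CharP (Module.End ℤ R) p := by
  constructor
  intro x
  rw [← CharP.cast_eq_zero_iff R p x]
  constructor
  · intro h
    have := congrArg (fun T : Module.End ℤ R => T 1) h
    simpa [Module.End.natCast_apply] using this
  · intro h
    ext v
    have : (x : R) * v = 0 := by rw [h, zero_mul]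
    simpa [Module.End.natCast_apply, nsmul_eq_mul] using this

/-- In characteristic `p`, `(ad a)^p = ad (a^p)`. -/
lemma ad_pow_p {R : Type} [Ring R] (p : ℕ) [Fact p.Prime] [CharP R p] (a : R) (h : R) :
    a ^ p * h = h * a ^ p + (fun x => a * x - x * a)^[p] h := by
  have := charP_end R p
  have h1 := sub_pow_char_of_commute p (LinearMap.commute_mulLeft_right (R := ℤ) a a)
  rw [LinearMap.pow_mulLeft, LinearMap.pow_mulRight] at h1
  have h2 := congrArg (fun T : Module.End ℤ R => T h) h1
  simp only [LinearMap.sub_apply, LinearMap.mulLeft_apply, LinearMap.mulRight_apply, Module.End.pow_apply] at h2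
  have h3 : (fun x => a * x - x * a)^[p] h = (LinearMap.mulLeft ℤ a - LinearMap.mulRight ℤ a)^[p] h := by
    congr 1
  rw [h3, h2]; abel

variable {k : Type} [Field k] (p : ℕ) [Fact p.Prime] [CharP k p] {E : Type} [CommRing E] [Nontrivial E] [Algebra k E]

lemma charP_endk : CharP (Module.End k E) p := 
  charP_of_injective_algebraMap (algebraMap k (Module.End k E)).injective p

/-- connection `D + g` -/
def conn (D : Derivation k E E) (g : E) : Module.End k E := D.toLinearMap + LinearMap.mulLeft k g

lemma conn_apply (D : Derivation k E E) (g v : E) : conn D g v = D v + g * v := rfl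

lemma conn_pow (D : Derivation k E E) (g h v : E) :
    (conn D g ^ p) (h * v) = h * (conn D g ^ p) v + (D^[p] h) * v := by
  have := charP_endk (k := k) p (E := E)
  have h1 := ad_pow_p p (conn D g) (LinearMap.mulLeft k h)
  have h2 : ∀ m : ℕ, (fun x => conn D g * x - x * conn D g)^[m] (LinearMap.mulLeft k h) = LinearMap.mulLeft k (D^[m] h) := by
    intro m
    induction m with
    | zero => rfl
    | succ m ih =>
      rw [Function.iterate_succ_apply', ih, Function.iterate_succ_apply']
      ext1 v
      simp only [LinearMap.sub_apply, Module.End.mul_apply, conn_apply, LinearMap.mulLeft_apply, Derivation.leibniz,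
        smul_eq_mul]
      ring
  rw [h2] at h1
  have h3 := congrArg (fun T : Module.End k E => T v) h1
  simpa [Module.End.mul_apply] using h3

/-- `D^p` is a derivation. -/
def derP (D : Derivation k E E) : Derivation k E E where
  toLinearMap := D.toLinearMap ^ p
  map_one_eq_zero' := by
    rw [Module.End.pow_apply]
    obtain ⟨m, hm⟩ := Nat.exists_eq_succ_of_ne_zero (Fact.out : p.Prime).ne_zero
    rw [hm, Function.iterate_succ_apply]
    have : D.toLinearMap (1 : E) = 0 := D.map_one_eq_zero
    rw [this, ← Module.End.pow_apply, map_zero]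
  leibniz' a b := by
    have h := conn_pow p D 0 a b
    have h0 : conn D 0 = D.toLinearMap := by ext v; simp [conn_apply]
    rw [h0] at h
    rw [h, smul_eq_mul, smul_eq_mul, mul_comm b, Module.End.pow_apply, Module.End.pow_apply]; rfl

lemma derP_apply (D : Derivation k E E) (v : E) : derP p D v = D^[p] v := by
  change (D.toLinearMap ^ p) v = _
  rw [Module.End.pow_apply]; rfl

end

section
variable {n : ℕ} {k : Type} [Field k] (p : ℕ) [Fact p.Prime] [CharP k p] (f : MvPolynomial (Fin n) k)
  (hf : f ≠ 0)
include hf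

lemma dP_p (i : Fin n) (v : ZP f) : (dP f i)^[p] v = 0 := by
  have := ZP_domain f hf
  have h : derP p (dP f i) = 0 := by
    apply der_ext_X
    intro j
    rw [derP_apply]
    obtain ⟨m, hm⟩ := Nat.exists_eq_add_of_le (Fact.out : p.Prime).two_le
    rw [hm, add_comm, Function.iterate_add_apply]
    have : (dP f i)^[2] (toP f (MvPolynomial.X j)) = 0 := by
      rw [Function.iterate_succ_apply, Function.iterate_succ_apply, dP_X]
      split_ifs <;> simp
    rw [this]
    simp [iterate_map_zero]
  rw [← derP_apply, h]; rfl

lemma dE_p (i : Fin n) (v : ZE f) : (dE f i)^[p] v = 0 := by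
  have : ∀ (m : ℕ) (v : ZE f) (l : ℕ), ((dE f i)^[m] v).coeff l = (dP f i)^[m] (v.coeff l) := by
    intro m
    induction m with
    | zero => intros; rfl
    | succ m ih => intro v l; rw [Function.iterate_succ_apply, ih, dE_coeff, Function.iterate_succ_apply]
  ext l
  rw [this, dP_p p f hf]; rfl

/-- `∇^p` is multiplication. -/
lemma nab_p (i : Fin n) (h v : ZE f) : (nab f i ^ p) (h * v) = h * (nab f i ^ p) v := by
  have := ZP_domain f hf
  have := conn_pow p (dE f i) (Polynomial.X * Polynomial.C (gP f i)) h v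
  rw [dE_p p f hf, zero_mul, add_zero] at this
  exact this

omit hf in
lemma nab_pow_deg (i : Fin n) (m : ℕ) : ((nab f i ^ m) 1).natDegree ≤ m ∧ ((nab f i ^ m) 1).coeff m = gP f i ^ m := by
  induction m with
  | zero => simp
  | succ m ih =>
    rw [pow_succ', Module.End.mul_apply, nab_apply]
    set v := (nab f i ^ m) 1 with hv
    have h1 : (dE f i v).natDegree ≤ m := by
      rw [Polynomial.natDegree_le_iff_coeff_eq_zero]
      intro N hN
      rw [dE_coeff, Polynomial.coeff_eq_zero_of_natDegree_lt (lt_of_le_of_lt ih.1 hN), map_zero]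
    constructor
    · refine (Polynomial.natDegree_add_le _ _).trans (max_le (h1.trans (Nat.le_succ _)) ?_)
      rw [mul_assoc]
      refine Polynomial.natDegree_mul_le.trans ?_
      have h2 := Polynomial.natDegree_C_mul_le (gP f i) v
      have h3 := Polynomial.natDegree_X_le (R := ZP f)
      have := ih.1
      omega
    · rw [Polynomial.coeff_add, dE_coeff, Polynomial.coeff_eq_zero_of_natDegree_lt (lt_of_le_of_lt ih.1 (Nat.lt_succ_self m)),
        map_zero, zero_add, mul_assoc, Polynomial.coeff_X_mul, Polynomial.coeff_C_mul, ih.2, pow_succ']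

omit hf in
lemma nab_eval (i : Fin n) (m : ℕ) (v : ZE f) : toP f f ^ m * (nab f i v).eval (m : ZP f) = 
    dP f i (toP f f ^ m * v.eval (m : ZP f)) := by
  have hD : (dE f i v).eval (m : ZP f) = dP f i (v.eval (m : ZP f)) := by
    induction v using Polynomial.induction_on' with
    | add p q hp hq => simp [hp, hq]
    | monomial l a =>
      rw [← Polynomial.C_mul_X_pow_eq_monomial]
      have h1 : dP f i ((m : ZP f) ^ l) = 0 := by rw [← Nat.cast_pow, Derivation.map_natCast]
      simp only [Derivation.leibniz, Derivation.leibniz_pow, dE_X, dE_C, smul_zero, zero_add, Polynomial.eval_mul,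
        Polynomial.eval_pow, Polynomial.eval_X, Polynomial.eval_C, smul_eq_mul, h1, mul_zero]
  have h : toP f (MvPolynomial.pderiv i f) = toP f f * gP f i := by
    rw [gP, mul_left_comm, f_mul_finv, mul_one]
  rw [nab_apply, Derivation.leibniz, Derivation.leibniz_pow, dP_toP, h]
  simp only [Polynomial.eval_add, hD, Polynomial.eval_mul, Polynomial.eval_X, Polynomial.eval_C, smul_eq_mul,
    nsmul_eq_mul]
  rcases m with _ | m
  · simp
  · rw [Nat.add_sub_cancel, pow_succ]; ring

lemma nab_p_one (i : Fin n) : (nab f i ^ p) 1 = Polynomial.C (gP f i ^ p) * (Polynomial.X ^ p - Polynomial.X) := by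
  have := ZP_domain f hf
  have hchar : CharP (ZP f) p := charP_of_injective_algebraMap (algebraMap k (ZP f)).injective p
  have hp := (Fact.out : p.Prime)
  obtain ⟨h1, h2⟩ := nab_pow_deg f i p
  rw [← sub_eq_zero]
  set w := (nab f i ^ p) 1 - Polynomial.C (gP f i ^ p) * (Polynomial.X ^ p - Polynomial.X) with hw
  have hdeg : w.degree < (Finset.range p).card := by
    rw [Finset.card_range, Polynomial.degree_lt_iff_coeff_zero]
    intro m hm
    rcases hm.eq_or_lt with rfl | hm
    · rw [hw, Polynomial.coeff_sub, h2, Polynomial.coeff_C_mul, Polynomial.coeff_sub, Polynomial.coeff_X_pow, if_pos rfl,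
        Polynomial.coeff_X_of_ne_one hp.one_lt.ne']
      ring
    · rw [hw, Polynomial.coeff_sub, Polynomial.coeff_eq_zero_of_natDegree_lt (lt_of_le_of_lt h1 hm),
        Polynomial.coeff_C_mul, Polynomial.coeff_sub, Polynomial.coeff_X_pow, if_neg hm.ne',
        Polynomial.coeff_X_of_ne_one (hp.one_lt.trans hm).ne']
      ring
  have hinj : Set.InjOn (fun m : ℕ => (m : ZP f)) (Finset.range p : Set ℕ) := by
    intro a ha b hb hab
    simp only [Finset.coe_range, Set.mem_Iio] at ha hb
    exact (CharP.natCast_injOn_Iio (ZP f) p) ha hb hab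
  refine Polynomial.eq_zero_of_degree_lt_of_eval_index_eq_zero _ hinj hdeg ?_
  intro m hm
  have h3 : ∀ l, toP f f ^ m * ((nab f i ^ l) 1).eval (m : ZP f) = (dP f i)^[l] (toP f f ^ m) := by
    intro l
    induction l with
    | zero => simp
    | succ l ih => rw [pow_succ', Module.End.mul_apply, nab_eval, ih, Function.iterate_succ_apply']
  have h4 := h3 p
  rw [dP_p p f hf] at h4
  have h5 := (((isUnit_f f).pow m).mul_right_eq_zero).1 h4
  have h6 : (m : ZP f) ^ p = m := by
    have := map_natCast (frobenius (ZP f) p) m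
    rwa [frobenius_def] at this
  simp [hw, h5, h6]

lemma nab_p_mul (i : Fin n) (v : ZE f) : (nab f i ^ p) v = 
    Polynomial.C (gP f i ^ p) * (Polynomial.X ^ p - Polynomial.X) * v := by
  have := nab_p p f hf i v 1
  rw [mul_one, nab_p_one p f hf] at this
  rw [this]; ring
end
end
end RZ


set_option linter.unusedSimpArgs false
set_option linter.unusedVariables false
set_option linter.unusedSectionVars false
namespace RZ
noncomputable section

lemma det_trick {T E : Type} [CommRing T] [CommRing E] [Algebra T E] (hinj : Function.Injective (algebraMap T E))
    (M : Submodule T E) (hfg : M.FG) (h1 : (1 : E) ∈ M) (B c : T)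
    (h : ∀ v ∈ M, ∃ w ∈ M, B • v = c • w) : ∃ (r : ℕ) (τ : T), B ^ r = c * τ := by
  have : Module.Finite T M := Module.Finite.iff_fg.2 hfg
  have hr : LinearMap.range (Algebra.lsmul T T M B) ≤ Ideal.span {c} • (⊤ : Submodule T M) := by
    rintro _ ⟨⟨v, hv⟩, rfl⟩
    obtain ⟨w, hw, hvw⟩ := h v hv
    have : Algebra.lsmul T T M B ⟨v, hv⟩ = c • (⟨w, hw⟩ : M) := Subtype.ext hvw
    rw [this]
    exact Submodule.smul_mem_smul (Ideal.mem_span_singleton_self c) trivial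
  obtain ⟨P, hP, -, hc, h0⟩ :=
    LinearMap.exists_monic_and_natDegree_eq_and_coeff_mem_pow_and_aeval_eq_zero _ (Algebra.lsmul T T M B) _ hr
  rw [Polynomial.aeval_algHom_apply] at h0
  have h2 := congrArg (fun S : Module.End T M => (S ⟨1, h1⟩ : E)) h0
  have h3 : (Polynomial.aeval B P) • (1 : E) = 0 := h2
  rw [Algebra.smul_def, mul_one, map_eq_zero_iff _ hinj, Polynomial.aeval_eq_sum_range, Finset.sum_range_succ] at h3
  refine ⟨P.natDegree, ?_⟩
  change c ∣ _
  rw [← Ideal.mem_span_singleton]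
  rw [Polynomial.coeff_natDegree, hP.leadingCoeff, one_smul] at h3
  rw [eq_neg_of_add_eq_zero_right h3]
  apply Submodule.neg_mem
  apply Ideal.sum_mem
  intro j hj
  rw [smul_eq_mul]
  apply Ideal.mul_mem_right
  have := hc j
  exact Ideal.pow_le_self (by have := Finset.mem_range.1 hj; omega) this

section
variable {n : ℕ} {k : Type} [Field k]  (f : MvPolynomial (Fin n) k)

lemma pS_mul (a b : Polynomial k) : pS f (a * b) = pS f a * pS f b := Polynomial.map_mul _
lemma pS_pow (a : Polynomial k) (m : ℕ) : pS f (a ^ m) = pS f a ^ m := Polynomial.map_pow _ _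

lemma dE_pS (i) (g : Polynomial k) : dE f i (pS f g) = 0 := by
  ext l; rw [dE_coeff, pS, Polynomial.coeff_map]; simp

lemma mulL_mon (c : ZE f) (hc : ∀ i v, nab f i (c * v) = c * nab f i v) (μ v) :
    (wE f).mon μ (c * v) = c * (wE f).mon μ v := by
  have h := (wE f).commute_mon (LinearMap.mulLeft k c) (fun i => by
    ext1 v; simp only [Module.End.mul_apply, wE_X, opX_apply, LinearMap.mulLeft_apply]; ring)
    (fun i => by ext1 v; simp only [Module.End.mul_apply, wE_Y, LinearMap.mulLeft_apply]; rw [hc]) μ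
  exact (congrArg (fun T : Module.End k (ZE f) => T v) h.eq).symm

lemma pS_mon (g : Polynomial k) (μ v) : (wE f).mon μ (pS f g * v) = pS f g * (wE f).mon μ v := by
  apply mulL_mon
  intro i v
  simp only [nab_apply, Derivation.leibniz, dE_pS, smul_eq_mul]; ring

lemma pS_Xpow (m : ℕ) : pS f (Polynomial.X ^ m) = Polynomial.X ^ m := by simp [pS]

lemma bN {b : Polynomial k} (hb : pS f b ∈ tN f) : ∀ v ∈ NN f, pS f b * v ∈ tN f := by
  intro v hv
  have : NN f ≤ (tN f).comap (LinearMap.mulLeft k (pS f b)) := by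
    rw [NN, Submodule.span_le]
    rintro _ ⟨μ, rfl⟩
    change pS f b * ee f μ ∈ tN f
    rw [ee, ← pS_mon]
    apply mon_tN
    rw [mul_comm, ← pS_Xpow]
    exact spow_tN f _ _ hb
  exact this hv

lemma ttk_apply (m : ℕ) (v : ZE f) : (tt f ^ m) v = Polynomial.C (toP f f ^ m) * v.comp (Polynomial.X + (m : ZE f)) := by
  induction m with
  | zero => simp
  | succ m ih =>
    rw [pow_succ', Module.End.mul_apply, ih, tt_apply, Polynomial.mul_comp, Polynomial.comp_assoc]
    simp [pow_succ']
    rw [add_assoc, add_comm (1 : ZE f)]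
    ring

variable (p : ℕ) [Fact p.Prime] [CharP k p] (hf : f ≠ 0)

/-- `s^p - s` -/
def sS (k : Type) [Field k] (p : ℕ) : Polynomial k := Polynomial.X ^ p - Polynomial.X

lemma pS_sS : pS f (sS k p) = Polynomial.X ^ p - Polynomial.X := by simp [pS, sS]

include hf in
lemma ttp (v : ZE f) : (tt f ^ p) v = Polynomial.C (toP f f ^ p) * v := by
  have := ZP_domain f hf
  have hchar : CharP (ZP f) p := charP_of_injective_algebraMap (algebraMap k (ZP f)).injective p
  rw [ttk_apply, CharP.cast_eq_zero]; simp

lemma sS_shift (g : Polynomial k) : (g.comp (sS k p)).comp (Polynomial.X - 1) = g.comp (sS k p) := by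
  rw [Polynomial.comp_assoc]
  congr 1
  simp only [sS, Polynomial.sub_comp, Polynomial.pow_comp, Polynomial.X_comp, sub_pow_char, one_pow]
  ring

lemma cN {c : Polynomial k} (hc : ∀ v ∈ NN f, pS f (c.comp (sS k p)) * v ∈ tN f) (j : ℕ) :
    ∀ v ∈ NN f, ∃ w ∈ NN f, pS f (c.comp (sS k p)) ^ j * v = (tt f ^ j) w := by
  induction j with
  | zero => intro v hv; exact ⟨v, hv, by simp⟩
  | succ j ih =>
    intro v hv
    obtain ⟨w, hw, h⟩ := hc v hv
    obtain ⟨w', hw', h'⟩ := ih w hw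
    refine ⟨w', hw', ?_⟩
    rw [pow_succ, mul_assoc, ← h, ← pS_pow]
    have := pS_tt f (c.comp (sS k p) ^ j) w
    rw [Polynomial.pow_comp, sS_shift] at this
    rw [this, pS_pow, h', pow_succ', Module.End.mul_apply]

/-- the p-centre elements -/
def psiG (i : Fin n) : ZE f := Polynomial.C (gP f i ^ p) * (Polynomial.X ^ p - Polynomial.X)

/-- the ring `T'` -/
def TT : Subalgebra k (ZE f) := Algebra.adjoin k
  ((Set.range fun i : Fin n => Polynomial.C (toP f (MvPolynomial.X i) ^ p)) ∪ {Polynomial.X ^ p - Polynomial.X} ∪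
    Set.range (psiG f p))

lemma x_TT (i) : Polynomial.C (toP f (MvPolynomial.X i) ^ p) ∈ TT f p :=
  Algebra.subset_adjoin (Or.inl (Or.inl ⟨i, rfl⟩))
lemma S_TT : (Polynomial.X ^ p - Polynomial.X : ZE f) ∈ TT f p :=
  Algebra.subset_adjoin (Or.inl (Or.inr rfl))
lemma psi_TT (i) : psiG f p i ∈ TT f p :=
  Algebra.subset_adjoin (Or.inr ⟨i, rfl⟩)

include hf in
lemma TT_NN (τ) (hτ : τ ∈ TT f p) : ∀ v ∈ NN f, τ * v ∈ NN f := by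
  induction hτ using Algebra.adjoin_induction with
  | mem x hx =>
    intro v hv
    rcases hx with (⟨i, rfl⟩ | hx) | ⟨i, rfl⟩
    · simp only; rw [← map_pow]; exact poly_NN f _ v hv
    · rw [Set.mem_singleton_iff.1 hx, ← pS_sS]; exact spow_NN f _ v hv
    · rw [psiG, ← nab_p_mul p f hf]
      have : ∀ m : ℕ, (nab f i ^ m) v ∈ NN f := by
        intro m
        induction m with
        | zero => simpa
        | succ m ih => rw [pow_succ', Module.End.mul_apply]; exact nab_NN f i _ ih
      exact this p
  | algebraMap r => intro v hv; rw [← Algebra.smul_def]; exact (NN f).smul_mem _ hv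
  | add x y _ _ hx hy => intro v hv; rw [add_mul]; exact (NN f).add_mem (hx v hv) (hy v hv)
  | mul x y _ _ hx hy => intro v hv; rw [mul_assoc]; exact hx _ (hy v hv)

/-- N as a T'-module -/
def NT : Submodule (TT f p) (ZE f) where
  carrier := NN f
  add_mem' := (NN f).add_mem
  zero_mem' := (NN f).zero_mem
  smul_mem' τ v hv := TT_NN f p hf τ τ.2 v hv

lemma opX_pow_ee (i m μ) : (Polynomial.C (toP f (MvPolynomial.X i) ^ m)) * ee f μ =
    ee f (μ + Finsupp.single (Sum.inl (Sum.inl i)) m) := by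
  induction m with
  | zero => simp
  | succ m ih =>
    rw [pow_succ', map_mul, mul_assoc, ih, ← opX_apply, opX_ee, add_assoc, ← Finsupp.single_add]

lemma opS_pow_ee (m μ) : Polynomial.X ^ m * ee f μ =
    ee f (μ + Finsupp.single (Sum.inr ()) m) := by
  induction m with
  | zero => simp
  | succ m ih =>
    rw [pow_succ', mul_assoc, ih, ← opS_apply, opS_ee, add_assoc, ← Finsupp.single_add]

include hf in
lemma psiG_ee (i μ) : psiG f p i * ee f μ = ee f (μ + Finsupp.single (Sum.inl (Sum.inr i)) p) := by
  have hm : ∀ m (ν : Fin n ⊕ Fin n →₀ ℕ), (wE f).mon (ν + Finsupp.single (Sum.inr i) m) = (wE f).mon ν * (nab f i) ^ m := by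
    intro m ν
    induction m with
    | zero => simp
    | succ m ih =>
      rw [pow_succ, ← mul_assoc, ← ih, ← wE_Y, Weyl.mon_mul_Y, add_assoc, ← Finsupp.single_add]
  simp only [ee, lft_add, lft_inl, hm, Module.End.mul_apply, nab_p_mul p f hf]
  rw [← psiG, mulL_mon]
  · simp
  · intro j v
    have h := ((wE f).hY j i).pow_right p
    have h2 := congrArg (fun T : Module.End k (ZE f) => T v) h.eq
    simp only [Module.End.mul_apply, wE_Y, nab_p_mul p f hf] at h2
    exact h2

lemma NT_fg : (NT f p hf).FG := by
  have hp := (Fact.out : p.Prime)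
  set s : Set (SI n →₀ ℕ) := {μ | ∀ a, μ a < p} with hs
  have hfin : s.Finite := by
    apply (Set.Finite.pi' (t := fun _ : SI n => Set.Iio p) fun _ ↦ Set.finite_Iio p).preimage DFunLike.coe_injective.injOn |>.subset
    intro μ hμ
    exact hμ
  have key : ∀ (m : ℕ) (μ : SI n →₀ ℕ), μ.degree = m → ee f μ ∈ Submodule.span (TT f p) (ee f '' s) := by
    intro m
    induction m using Nat.strong_induction_on with
    | _ m ih =>
    intro μ hμ
    by_cases h : ∀ a, μ a < p
    · exact Submodule.subset_span ⟨μ, h, rfl⟩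
    · push Not at h
      obtain ⟨a, ha⟩ := h
      obtain ⟨ν, hν⟩ : ∃ ν, μ = ν + Finsupp.single a p := by
        classical
        refine ⟨μ - Finsupp.single a p, (tsub_add_cancel_of_le ?_).symm⟩
        rw [Finsupp.single_le_iff]; exact ha
      have hdeg : ν.degree + p = m := by
        rw [← hμ, hν, map_add, Finsupp.degree_single]
      have h1 := ih ν.degree (by have := hp.pos; omega) ν rfl
      rw [hν]
      rcases a with (i | i) | ⟨⟩
      · rw [← opX_pow_ee]
        exact Submodule.smul_mem _ (⟨_, x_TT f p i⟩ : TT f p) h1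
      · rw [← psiG_ee f p hf]
        exact Submodule.smul_mem _ (⟨_, psi_TT f p i⟩ : TT f p) h1
      · have h2 : ee f (ν + Finsupp.single (Sum.inr ()) p) = (⟨_, S_TT f p⟩ : TT f p) • ee f ν +
            ee f (ν + Finsupp.single (Sum.inr ()) 1) := by
          rw [← opS_pow_ee, ← opS_pow_ee, Subalgebra.smul_def, smul_eq_mul]; ring
        rw [h2]
        refine Submodule.add_mem _ (Submodule.smul_mem _ _ h1) (ih (ν.degree + 1) ?_ _ ?_)
        · have := hp.one_lt; omega
        · rw [map_add, Finsupp.degree_single]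
  refine Submodule.fg_def.2 ⟨ee f '' s, hfin.image _, le_antisymm ?_ ?_⟩
  · rw [Submodule.span_le]
    rintro _ ⟨μ, _, rfl⟩
    exact ee_mem f μ
  · intro v hv
    have : NN f ≤ (Submodule.span (TT f p) (ee f '' s)).restrictScalars k := by
      rw [NN, Submodule.span_le]
      rintro _ ⟨μ, rfl⟩
      exact key _ μ rfl
    exact this hv

include hf in
lemma rp_TT (r : MvPolynomial (Fin n) k) : Polynomial.C (toP f r ^ p) ∈ TT f p := by
  have := ZP_domain f hf
  have hchar : CharP (ZP f) p := charP_of_injective_algebraMap (algebraMap k (ZP f)).injective p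
  induction r using MvPolynomial.induction_on with
  | C a => 
    have : Polynomial.C (toP f (MvPolynomial.C a) ^ p) = algebraMap k (ZE f) (a ^ p) := by
      rw [← alg_toP, ← map_pow]; rfl
    rw [this]; exact Subalgebra.algebraMap_mem _ _
  | add a b ha hb => rw [map_add, add_pow_char, map_add]; exact add_mem ha hb
  | mul_X a j ha => rw [map_mul, mul_pow, map_mul]; exact mul_mem ha (x_TT f p j)

lemma TT_graded (τ) (hτ : τ ∈ TT f p) : ∃ h : ZE f, τ = h.comp (Polynomial.X ^ p - Polynomial.X) ∧
    ∀ j, Polynomial.C (h.coeff j) * (Polynomial.X ^ p - Polynomial.X) ^ j ∈ TT f p := by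
  classical
  induction hτ using Algebra.adjoin_induction with
  | mem x hx =>
    rcases hx with (⟨i, rfl⟩ | hx) | ⟨i, rfl⟩
    · refine ⟨Polynomial.C (toP f (MvPolynomial.X i) ^ p), by simp, fun j => ?_⟩
      rw [Polynomial.coeff_C]
      split_ifs with h
      · rw [h, pow_zero, mul_one]; exact x_TT f p i
      · simp
    · refine ⟨Polynomial.X, by rw [Set.mem_singleton_iff.1 hx]; simp, fun j => ?_⟩
      rw [Polynomial.coeff_X]
      split_ifs with h
      · rw [← h, map_one, one_mul, pow_one]; exact S_TT f p
      · simp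
    · refine ⟨Polynomial.C (gP f i ^ p) * Polynomial.X, by rw [Polynomial.mul_comp]; simp [psiG], fun j => ?_⟩
      rw [Polynomial.coeff_C_mul, Polynomial.coeff_X]
      split_ifs with h
      · rw [← h, mul_one, pow_one]; exact psi_TT f p i
      · simp
  | algebraMap r =>
    refine ⟨Polynomial.C (algebraMap k (ZP f) r), by simp, fun j => ?_⟩
    rw [Polynomial.coeff_C]
    split_ifs with h
    · rw [h, pow_zero, mul_one]; exact Subalgebra.algebraMap_mem (TT f p) r
    · simp
  | add x y _ _ hx hy =>
    obtain ⟨a, ha, ha'⟩ := hx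
    obtain ⟨b, hb, hb'⟩ := hy
    refine ⟨a + b, by rw [ha, hb, Polynomial.add_comp], fun j => ?_⟩
    rw [Polynomial.coeff_add, map_add, add_mul]; exact add_mem (ha' j) (hb' j)
  | mul x y _ _ hx hy =>
    obtain ⟨a, ha, ha'⟩ := hx
    obtain ⟨b, hb, hb'⟩ := hy
    refine ⟨a * b, by rw [ha, hb, Polynomial.mul_comp], fun j => ?_⟩
    rw [Polynomial.coeff_mul, map_sum, Finset.sum_mul]
    apply sum_mem
    rintro ⟨u, v⟩ huv
    rw [Finset.HasAntidiagonal.mem_antidiagonal] at huv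
    have := mul_mem (ha' u) (hb' v)
    convert this using 1
    rw [← huv, pow_add, map_mul]; ring

include hf in
theorem charp_main (b : Polynomial k) (hb : b.Monic) (hbN : pS f b ∈ tN f) :
    ∃ q : ℕ, pS f (sS k p ^ q) ∈ tN f := by
  have hdom := ZP_domain f hf
  have hp := (Fact.out : p.Prime)
  -- C
  obtain ⟨c, hc, hbc⟩ : ∃ c : Polynomial k, c.Monic ∧ b ∣ c.comp (sS k p) := by
    have : Module.Finite k (AdjoinRoot b) := hb.finite_adjoinRoot
    obtain ⟨c, hc, h⟩ := Algebra.IsIntegral.isIntegral (R := k) (AdjoinRoot.mk b (sS k p))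
    refine ⟨c, hc, ?_⟩
    rw [← AdjoinRoot.mk_eq_zero, ← h, Polynomial.comp, Polynomial.hom_eval₂]
    rfl
  set C0 := c.comp (sS k p) with hC0
  have hcN : ∀ v ∈ NN f, pS f (c.comp (sS k p)) * v ∈ tN f := by
    intro v hv
    obtain ⟨d, hd⟩ := hbc
    rw [← hC0, hd, pS_mul, mul_assoc]
    exact bN f hbN _ (spow_NN f d v hv)
  have hB := cN f p hcN p
  have hBmem : pS f C0 ^ p ∈ TT f p := by
    apply pow_mem
    have : pS f C0 = Polynomial.aeval (Polynomial.X ^ p - Polynomial.X : ZE f) c := by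
      rw [hC0, pS, Polynomial.map_comp, ← pS, ← pS, pS_sS, Polynomial.comp, Polynomial.aeval_def, pS,
        Polynomial.eval₂_map]
      rfl
    rw [this]
    exact Polynomial.aeval_mem_adjoin_singleton _ _ |> fun h => Algebra.adjoin_mono (by
      intro y hy; exact Or.inl (Or.inr hy)) h
  obtain ⟨r, τ, hr⟩ := det_trick (T := TT f p) (E := ZE f) Subtype.val_injective (NT f p hf) (NT_fg f p hf)
    (one_mem_NN f) ⟨_, hBmem⟩ ⟨_, rp_TT f p hf f⟩ (by
      intro v hv
      obtain ⟨w, hw, h⟩ := hB v hv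
      refine ⟨w, hw, ?_⟩
      rw [Subalgebra.smul_def, Subalgebra.smul_def, smul_eq_mul, smul_eq_mul]
      simp only
      rw [h, ttp f p hf])
  have hr' := congrArg (Subtype.val) hr
  simp only [Subalgebra.coe_pow, Subalgebra.coe_mul] at hr'
  obtain ⟨h, hτ, hh⟩ := TT_graded f p τ τ.2
  set Q := (c ^ p) ^ r with hQ
  have hQm : Q.Monic := (hc.pow p).pow r
  have e1 : ((Q.map (algebraMap k (ZP f))).comp (Polynomial.X ^ p - Polynomial.X) : ZE f) =
      (Polynomial.C (toP f f ^ p) * h).comp (Polynomial.X ^ p - Polynomial.X) := by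
    rw [Polynomial.mul_comp, ← hτ, Polynomial.C_comp, ← hr', ← pS_pow, ← pS_pow, hC0, ← Polynomial.pow_comp,
      ← Polynomial.pow_comp, pS, Polynomial.map_comp, ← pS, ← pS, pS_sS]
  have e2 : Q.map (algebraMap k (ZP f)) = Polynomial.C (toP f f ^ p) * h := by
    rw [← sub_eq_zero]
    rw [← sub_eq_zero, ← Polynomial.sub_comp, Polynomial.comp_eq_zero_iff] at e1
    rcases e1 with e1 | ⟨_, e1⟩
    · exact e1
    · exfalso
      have h2 := congrArg (fun P : ZE f => P.coeff p) e1
      simp only [Polynomial.coeff_sub, Polynomial.coeff_X_pow, if_pos, Polynomial.coeff_X_of_ne_one hp.one_lt.ne',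
        Polynomial.coeff_C, if_neg hp.ne_zero] at h2
      simp at h2
  have e3 := congrArg (fun P : ZE f => P.coeff Q.natDegree) e2
  simp only [Polynomial.coeff_map, Polynomial.coeff_C_mul, hQm.coeff_natDegree, map_one] at e3
  refine ⟨Q.natDegree, ?_⟩
  have e4 : pS f (sS k p ^ Q.natDegree) = (tt f ^ p)
      (Polynomial.C (h.coeff Q.natDegree) * (Polynomial.X ^ p - Polynomial.X) ^ Q.natDegree) := by
    rw [ttp f p hf, ← mul_assoc, ← map_mul, ← e3, pS_pow, pS_sS, map_one, one_mul]
  rw [e4]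
  have e5 := TT_NN f p hf _ (hh Q.natDegree) 1 (one_mem_NN f)
  rw [mul_one] at e5
  obtain ⟨m, hm⟩ := Nat.exists_eq_succ_of_ne_zero hp.ne_zero
  have e6 : ∀ m : ℕ, ∀ v ∈ NN f, (tt f ^ m) v ∈ NN f := by
    intro m v hv
    induction m with
    | zero => simpa
    | succ m ih => rw [pow_succ', Module.End.mul_apply]; exact tt_NN f _ ih
  rw [show (tt f ^ p) = tt f * tt f ^ m by rw [← pow_succ', hm], Module.End.mul_apply]
  exact ⟨_, e6 m _ e5, rfl⟩
end
end
end RZ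


set_option linter.unusedSimpArgs false
set_option linter.unusedVariables false
set_option linter.unusedSectionVars false
namespace RZ
noncomputable section

section
variable {n : ℕ} {A : Type} [CommRing A] (f : MvPolynomial (Fin n) A)

/-- all the operators -/
def opA : SI n → Module.End A (ZE f)
  | Sum.inl (Sum.inl i) => opX f i
  | Sum.inl (Sum.inr i) => nab f i
  | Sum.inr _ => opS f

/-- a monomial order -/
def mo (n : ℕ) : MonomialOrder (SI n) :=
  let lo : LinearOrder (SI n) := LinearOrder.lift' (Fintype.equivFin (SI n)) (Fintype.equivFin (SI n)).injective
  @MonomialOrder.lex (SI n) lo (@Finite.to_wellFoundedGT (SI n) _ lo.toPartialOrder.toPreorder)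

/-- span of the smaller generators -/
def Lt (μ : SI n →₀ ℕ) : Submodule A (ZE f) :=
  Submodule.span A (ee f '' {ν | (mo n).toSyn ν < (mo n).toSyn μ})

lemma Lt_mono {μ ν : SI n →₀ ℕ} (h : (mo n).toSyn μ ≤ (mo n).toSyn ν) : Lt f μ ≤ Lt f ν :=
  Submodule.span_mono (Set.image_mono fun _ hx => lt_of_lt_of_le hx h)

lemma ee_Lt {μ ν : SI n →₀ ℕ} (h : (mo n).toSyn μ < (mo n).toSyn ν) : ee f μ ∈ Lt f ν :=
  Submodule.subset_span ⟨μ, h, rfl⟩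

lemma opA_tN (a) : ∀ v ∈ tN f, opA f a v ∈ tN f := by
  rcases a with (i | i) | i
  · exact opX_tN f i
  · exact nab_tN f i
  · exact opS_tN f

lemma syn_single_pos (a : SI n) : 0 < (mo n).toSyn (Finsupp.single a 1) := by
  have : (mo n).toSyn 0 < (mo n).toSyn (Finsupp.single a 1) := (mo n).toSyn_strictMono (by
    rw [pos_iff_ne_zero]; simp)
  simpa using this

lemma opA_ee (a μ) : ∃ r ∈ Lt f (μ + Finsupp.single a 1), opA f a (ee f μ) = ee f (μ + Finsupp.single a 1) + r := by
  rcases a with (i | i) | i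
  · exact ⟨0, zero_mem _, by rw [add_zero]; exact opX_ee f i μ⟩
  · refine ⟨_, ?_, nab_ee f i μ⟩
    apply Submodule.smul_of_tower_mem
    apply ee_Lt
    refine lt_of_le_of_lt ((mo n).toSyn_monotone (tsub_le_self : _ ≤ μ)) ?_
    rw [map_add]
    exact lt_add_of_pos_right _ (syn_single_pos _)
  · exact ⟨0, zero_mem _, by rw [add_zero]; exact opS_ee f μ⟩

lemma opA_Lt (a μ) : ∀ v ∈ Lt f μ, opA f a v ∈ Lt f (μ + Finsupp.single a 1) := by
  intro v hv
  have : Lt f μ ≤ (Lt f (μ + Finsupp.single a 1)).comap (opA f a) := by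
    refine Submodule.span_le.2 ?_
    rintro _ ⟨ν, hν, rfl⟩
    obtain ⟨r, hr, h⟩ := opA_ee f a ν
    have hlt : (mo n).toSyn (ν + Finsupp.single a 1) < (mo n).toSyn (μ + Finsupp.single a 1) := by
      rw [map_add, map_add]; exact add_lt_add_left hν _
    change opA f a (ee f ν) ∈ Lt f (μ + Finsupp.single a 1)
    rw [h]
    exact add_mem (ee_Lt f hlt) (Lt_mono f hlt.le hr)
  exact this hv

lemma up1 (a μ) (h : ee f μ ∈ Lt f μ ⊔ tN f) :
    ee f (μ + Finsupp.single a 1) ∈ Lt f (μ + Finsupp.single a 1) ⊔ tN f := by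
  obtain ⟨l, hl, t, ht, hh⟩ := Submodule.mem_sup.1 h
  obtain ⟨r, hr, h2⟩ := opA_ee f a μ
  rw [← hh, map_add] at h2
  rw [eq_sub_of_add_eq h2.symm]
  exact sub_mem (add_mem (Submodule.mem_sup_left (opA_Lt f a μ l hl)) (Submodule.mem_sup_right (opA_tN f a t ht)))
    (Submodule.mem_sup_left hr)

lemma up (μ δ) (h : ee f μ ∈ Lt f μ ⊔ tN f) : ee f (μ + δ) ∈ Lt f (μ + δ) ⊔ tN f := by
  induction δ using Finsupp.induction_linear generalizing μ with
  | zero => simpa using h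
  | add δ ε h1 h2 => rw [← add_assoc]; exact h2 _ (h1 _ h)
  | single a m =>
    induction m with
    | zero => simpa using h
    | succ m ih => rw [Finsupp.single_add, ← add_assoc]; exact up1 f a _ ih

/-- linear combinations of the generators -/
abbrev lc : ((SI n →₀ ℕ) →₀ A) →ₗ[A] ZE f := Finsupp.linearCombination A (ee f)

/-- exponents which are not reducible -/
def Std : Set (SI n →₀ ℕ) := {μ | ee f μ ∉ Lt f μ ⊔ tN f}

lemma F1 (St : Set (SI n →₀ ℕ)) (h : ∀ μ ∉ St, ee f μ ∈ Lt f μ ⊔ tN f) :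
    NN f ≤ tN f ⊔ Submodule.span A (ee f '' St) := by
  refine Submodule.span_le.2 ?_
  rintro _ ⟨μ, rfl⟩
  induction hm : (mo n).toSyn μ using WellFoundedLT.induction generalizing μ with
  | ind x ih =>
  subst hm
  by_cases hμ : μ ∈ St
  · exact Submodule.mem_sup_right (Submodule.subset_span ⟨μ, hμ, rfl⟩)
  · have h1 := h μ hμ
    refine (sup_le ?_ le_sup_left : Lt f μ ⊔ tN f ≤ _) h1
    refine Submodule.span_le.2 ?_
    rintro _ ⟨ν, hν, rfl⟩
    exact ih _ hν ν rfl

section purity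
variable (St : Set (SI n →₀ ℕ)) (F1 : NN f ≤ tN f ⊔ Submodule.span A (ee f '' St))
  (F2 : ∀ p ∈ Finsupp.supported A A St, lc f p ∈ tN f → p = 0) (I : Ideal A)
include F1 
lemma pur1 : ∀ v ∈ I • NN f, ∃ m ∈ I • NN f, ∃ p ∈ Finsupp.supported A A St, (∀ β, p β ∈ I) ∧ v = tt f m + lc f p := by
  intro v hv
  induction hv using Submodule.smul_induction_on' with
  | smul a ha v hv =>
    obtain ⟨_, ⟨m, hm, rfl⟩, l, hl, hh⟩ := Submodule.mem_sup.1 (F1 hv)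
    obtain ⟨p, hp, rfl⟩ := (Finsupp.mem_span_image_iff_linearCombination A).1 hl
    refine ⟨a • m, Submodule.smul_mem_smul ha hm, a • p, Submodule.smul_mem _ _ hp, ?_, ?_⟩
    · intro β; exact I.mul_mem_right _ ha
    · rw [← hh, map_smul, map_smul, smul_add]
  | add v hv w hw h1 h2 =>
    obtain ⟨m, hm, p, hp, hpI, rfl⟩ := h1
    obtain ⟨m', hm', p', hp', hpI', rfl⟩ := h2
    refine ⟨m + m', add_mem hm hm', p + p', add_mem hp hp', fun β => add_mem (hpI β) (hpI' β), ?_⟩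
    rw [map_add, map_add]; abel

include F2
lemma pur2 (v) (hv : v ∈ NN f) (h : tt f v ∈ I • NN f) : v ∈ I • NN f := by
  obtain ⟨m, hm, p, hp, hpI, hh⟩ := pur1 f St F1 I _ h
  have hmN : m ∈ NN f := Submodule.smul_le_right hm
  have := F2 p hp ⟨v - m, sub_mem hv hmN, by rw [map_sub, hh]; abel⟩
  rw [this, map_zero, add_zero] at hh
  rw [tt_inj f hh]; exact hm

lemma pur3 (j : ℕ) (v) (hv : v ∈ NN f) (h : (tt f ^ j) v ∈ I • NN f) : v ∈ I • NN f := by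
  induction j generalizing v with
  | zero => simpa using h
  | succ j ih =>
    apply pur2 f St F1 F2 I v hv
    apply ih _ (tt_NN f v hv)
    rw [pow_succ] at h
    exact h

lemma pur4 (m m' : ZE f) (hm : m ∈ NN f) (hm' : m' ∈ NN f) (a) (ha : a ∈ Finsupp.supported A A St)
    (h : tt f m + lc f a - tt f m' ∈ I • NN f) : ∀ β, a β ∈ I := by
  obtain ⟨l, hl, p, hp, hpI, hh⟩ := pur1 f St F1 I _ h
  have hl' : l ∈ NN f := Submodule.smul_le_right hl
  have := F2 (a - p) (sub_mem ha hp) ⟨l + m' - m, sub_mem (add_mem hl' hm') hm, by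
    rw [map_sub, map_sub, map_add]
    rw [sub_eq_iff_eq_add, add_assoc] at hh
    rw [eq_sub_of_add_eq' hh]; abel⟩
  rw [sub_eq_zero] at this
  rw [this]; exact hpI
end purity

variable {k : Type} [Field k] (π : A →+* k)

lemma Qmem (Q : Polynomial (MvPolynomial (Fin n) A)) (hQ : ∀ i α, (Q.coeff i).coeff α ∈ RingHom.ker π) :
    (Q.map (toP f) : ZE f) ∈ RingHom.ker π • NN f := by
  rw [Polynomial.as_sum_range Q, Polynomial.map_sum]
  refine sum_mem fun i _ => ?_
  rw [Polynomial.map_monomial]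
  rw [(Q.coeff i).as_sum, map_sum, map_sum]
  refine sum_mem fun α _ => ?_
  have : Polynomial.monomial i (toP f (MvPolynomial.monomial α ((Q.coeff i).coeff α))) =
    (Q.coeff i).coeff α • (Polynomial.C (toP f (MvPolynomial.monomial α 1)) * ((Polynomial.X ^ i : Polynomial A).map (algebraMap A (ZP f)) * 1 : ZE f)) := by
    rw [Algebra.smul_def, Polynomial.map_pow, Polynomial.map_X, mul_one, ← Polynomial.C_mul_X_pow_eq_monomial, ← mul_assoc,
      IsScalarTower.algebraMap_apply A (ZP f) (ZE f), Polynomial.algebraMap_apply, Algebra.algebraMap_self_apply, alg_toP, ← Polynomial.C_mul, ← map_mul,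
      MvPolynomial.C_mul_monomial, mul_one]
  rw [this]
  exact Submodule.smul_mem_smul (hQ i α) (poly_NN f _ _ (spow_NN f _ _ (one_mem_NN f)))

lemma ttk_apply' (m : ℕ) (v : ZE f) : (tt f ^ m) v = Polynomial.C (toP f f ^ m) * v.comp (Polynomial.X + (m : ZE f)) := by
  induction m with
  | zero => simp
  | succ m ih =>
    rw [pow_succ', Module.End.mul_apply, ih, tt_apply, Polynomial.mul_comp, Polynomial.C_comp, Polynomial.comp_assoc, ← mul_assoc,
      ← Polynomial.C_mul, ← pow_succ']
    congr 2
    simp; ring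

lemma lift0 (hf : bc f π ≠ 0) (w : ZE f) (hw : mapE f π w = 0) : ∃ j, (tt f ^ j) w ∈ RingHom.ker π • NN f := by
  obtain ⟨j, P, hP⟩ := clearE f w
  refine ⟨j, ?_⟩
  have h1 : (tt f ^ j) w = ((P.comp (Polynomial.X + (j : Polynomial (MvPolynomial (Fin n) A)))).map (toP f)) := by
    rw [ttk_apply', Polynomial.map_comp, ← hP, Polynomial.mul_comp, Polynomial.C_comp]
    simp
  rw [h1]
  have h2 : P.map (MvPolynomial.map π) = 0 := by
    have : Function.Injective (Polynomial.map (toP (bc f π))) := Polynomial.map_injective _ (toP_inj _ hf)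
    apply this
    rw [Polynomial.map_zero, Polynomial.map_map]
    have h3 := congrArg (mapE f π) hP
    rw [map_mul, hw, mul_zero, mapE, Polynomial.coe_mapRingHom, Polynomial.map_map] at h3
    rw [h3]
    congr 1
    apply RingHom.ext; intro r; exact (mapP_toP f π r).symm
  apply Qmem
  intro i α
  rw [RingHom.mem_ker, ← MvPolynomial.coeff_map, ← Polynomial.coeff_map, Polynomial.map_comp, h2]
  simp
end
end
end RZ


set_option linter.unusedSimpArgs false
set_option linter.unusedVariables false
set_option linter.unusedSectionVars false
namespace RZ
noncomputable section

section
variable {n : ℕ} {A : Type} [CommRing A] (f : MvPolynomial (Fin n) A)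
  {B : Type} [CommRing B] (π : A →+* B)

/-- base change of coefficients -/
def mr (p : (SI n →₀ ℕ) →₀ A) : (SI n →₀ ℕ) →₀ B := p.mapRange π (map_zero π)

lemma mapE_lc (p) : mapE f π (lc f p) = lc (bc f π) (mr π p) := by
  rw [mr]
  induction p using Finsupp.induction_linear with
  | zero => simp
  | add p q hp hq => rw [map_add, map_add, hp, hq, Finsupp.mapRange_add' , map_add]
  | single μ a => simp [mapE_smul, mapE_ee]

lemma lc_NN (p) : lc f p ∈ NN f := by
  rw [NN, ← Finsupp.range_linearCombination]; exact ⟨p, rfl⟩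

lemma NN_lc {v} (hv : v ∈ NN f) : ∃ p, lc f p = v := by
  rw [NN, ← Finsupp.range_linearCombination] at hv; exact hv

lemma mapE_NN {v} (hv : v ∈ NN f) : mapE f π v ∈ NN (bc f π) := by
  obtain ⟨p, rfl⟩ := NN_lc f hv
  rw [mapE_lc]; exact lc_NN _ _

lemma mapE_tN {v} (hv : v ∈ tN f) : mapE f π v ∈ tN (bc f π) := by
  obtain ⟨w, hw, rfl⟩ := hv
  exact ⟨_, mapE_NN f π hw, (mapE_tt f π w).symm⟩

lemma NN_surj (hπ : Function.Surjective π) {v} (hv : v ∈ NN (bc f π)) : ∃ w ∈ NN f, mapE f π w = v := by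
  obtain ⟨p, rfl⟩ := NN_lc _ hv
  obtain ⟨q, rfl⟩ := Finsupp.mapRange_surjective π (map_zero π) hπ p
  exact ⟨lc f q, lc_NN _ _, mapE_lc f π q⟩
end

section
variable {n : ℕ} {K : Type} [Field K] (f : MvPolynomial (Fin n) K)

lemma F2K (p) (hp : p ∈ Finsupp.supported K K (Std f)) (h : lc f p ∈ tN f) : p = 0 := by
  classical
  by_contra hne
  have hs : p.support.Nonempty := Finsupp.support_nonempty_iff.2 hne
  obtain ⟨μ, hμ, hmax⟩ := p.support.exists_max_image (mo n).toSyn hs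
  have hst : μ ∈ Std f := hp hμ
  apply hst
  have h0 : p μ ≠ 0 := Finsupp.mem_support_iff.1 hμ
  have h1 : lc f p = p μ • ee f μ + ∑ ν ∈ p.support.erase μ, p ν • ee f ν := by
    rw [Finset.add_sum_erase _ (fun ν => p ν • ee f ν) hμ]; rfl
  have h2 : ∑ ν ∈ p.support.erase μ, p ν • ee f ν ∈ Lt f μ := by
    refine sum_mem fun ν hν => Submodule.smul_mem _ _ (ee_Lt f ?_)
    refine lt_of_le_of_ne (hmax ν (Finset.mem_of_mem_erase hν)) ?_
    intro h; exact (Finset.ne_of_mem_erase hν) ((mo n).toSyn.injective h)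
  have h3 : p μ • ee f μ ∈ Lt f μ ⊔ tN f := by
    rw [eq_sub_of_add_eq h1.symm]
    exact sub_mem (Submodule.mem_sup_right h) (Submodule.mem_sup_left h2)
  have := Submodule.smul_mem _ (p μ)⁻¹ h3
  rwa [smul_smul, inv_mul_cancel₀ h0, one_smul] at this

lemma lowerA (A : Subring K) (p : (SI n →₀ ℕ) →₀ K) (hp : Set.range p ⊆ A) :
    ∃ q : (SI n →₀ ℕ) →₀ A, mr A.subtype q = p := by
  refine ⟨Finsupp.onFinset p.support (fun μ => ⟨p μ, hp ⟨μ, rfl⟩⟩) ?_, ?_⟩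
  · intro μ h
    rw [Finsupp.mem_support_iff]
    intro h0; apply h; exact Subtype.ext h0
  · ext μ; simp [mr]

lemma mr_supp (A : Subring K) (q : (SI n →₀ ℕ) →₀ A) (St : Set (SI n →₀ ℕ)) :
    mr A.subtype q ∈ Finsupp.supported K K St ↔ q ∈ Finsupp.supported A A St := by
  rw [Finsupp.mem_supported', Finsupp.mem_supported']
  simp [mr]

lemma descLt (μ : SI n →₀ ℕ) (h : ee f μ ∈ Lt f μ ⊔ tN f) : ∃ F : Set K, F.Finite ∧
    ∀ A : Subring K, F ⊆ A → ∀ g : MvPolynomial (Fin n) A, bc g A.subtype = f → ee g μ ∈ Lt g μ ⊔ tN g := by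
  obtain ⟨l, hl, _, ⟨m, hm, rfl⟩, hh⟩ := Submodule.mem_sup.1 h
  obtain ⟨p, hp, rfl⟩ := (Finsupp.mem_span_image_iff_linearCombination K).1 hl
  obtain ⟨d, rfl⟩ := NN_lc f hm
  refine ⟨Set.range p ∪ Set.range d, (Finsupp.finite_range p).union (Finsupp.finite_range d), ?_⟩
  intro A hA g hg
  subst hg
  obtain ⟨p, rfl⟩ := lowerA A p (Set.subset_union_left.trans hA)
  obtain ⟨d, rfl⟩ := lowerA A d (Set.subset_union_right.trans hA)
  have : ee g μ = lc g p + tt g (lc g d) := by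
    apply mapE_inj g A.subtype Subtype.val_injective
    rw [map_add, mapE_tt, mapE_lc, mapE_lc, mapE_ee]
    exact hh.symm
  rw [this]
  refine add_mem (Submodule.mem_sup_left ?_) (Submodule.mem_sup_right ⟨_, lc_NN _ _, rfl⟩)
  exact (Finsupp.mem_span_image_iff_linearCombination A).2 ⟨p, (mr_supp A p _).1 hp, rfl⟩

lemma dickson : ∃ F : Set K, F.Finite ∧
    ∀ A : Subring K, F ⊆ A → ∀ g : MvPolynomial (Fin n) A, bc g A.subtype = f → 
      ∀ μ ∉ Std f, ee g μ ∈ Lt g μ ⊔ tN g := by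
  classical
  set U : Set (SI n →₀ ℕ) := {μ | ee f μ ∈ Lt f μ ⊔ tN f} with hU
  have hpwo := Set.isPWO_of_wellQuasiOrderedLE U
  have hfin : {μ | Minimal (· ∈ U) μ}.Finite := (setOfPred_minimal_antichain _).finite_of_partiallyWellOrderedOn
    (hpwo.mono (setOfPred_minimal_subset _))
  have hch : ∀ μ, ∃ F : Set K, F.Finite ∧ (μ ∈ U → ∀ A : Subring K, F ⊆ A → ∀ g : MvPolynomial (Fin n) A,
      bc g A.subtype = f → ee g μ ∈ Lt g μ ⊔ tN g) := by
    intro μ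
    by_cases h : μ ∈ U
    · obtain ⟨F, hF, h1⟩ := descLt f μ h
      exact ⟨F, hF, fun _ => h1⟩
    · exact ⟨∅, Set.finite_empty, fun h' => absurd h' h⟩
  choose F hF h using hch
  refine ⟨⋃ μ ∈ {μ | Minimal (· ∈ U) μ}, F μ, hfin.biUnion fun μ _ => hF μ, ?_⟩
  intro A hA g hg μ hμ
  have hμU : μ ∈ U := not_not.1 hμ
  obtain ⟨z, hz, hz'⟩ := hpwo.exists_le_minimal hμU
  obtain ⟨δ, rfl⟩ := exists_add_of_le hz
  apply up
  exact h z hz'.prop A ((Set.subset_biUnion_of_mem (u := F) hz').trans hA) g hg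
end

/-- The arithmetic input. -/
def S4prop (lam : ℂ) : Prop := ∀ F : Set ℂ, F.Finite → ∃ (A : Subring ℂ) (k : Type) (_ : Field k) (p : ℕ)
  (_ : Fact p.Prime) (_ : CharP k p) (π : A →+* k) (hl : lam ∈ A), F ⊆ A ∧ Function.Surjective π ∧
    π ⟨lam, hl⟩ ^ p ≠ π ⟨lam, hl⟩

theorem S3core {n : ℕ} (f : MvPolynomial (Fin n) ℂ) (hf : f ≠ 0) (lam : ℂ) (hS : S4prop lam)
    (c : Polynomial ℂ) (hc : c.Monic) (hb : pS f ((Polynomial.X - Polynomial.C lam) * c) ∈ tN f) : pS f c ∈ tN f := by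
  classical
  by_contra hcN
  have hcNN : pS f c ∈ NN f := by
    have := spow_NN f c 1 (one_mem_NN f)
    rwa [mul_one] at this
  obtain ⟨_, ⟨m, hm, rfl⟩, l, hl, hh⟩ := Submodule.mem_sup.1 (F1 f (Std f) (fun μ hμ => not_not.1 hμ) hcNN)
  obtain ⟨a, ha, rfl⟩ := (Finsupp.mem_span_image_iff_linearCombination ℂ).1 hl
  obtain ⟨d, rfl⟩ := NN_lc f hm
  have ha0 : a ≠ 0 := by
    rintro rfl
    apply hcN
    rw [← hh, map_zero, add_zero]; exact ⟨_, hm, rfl⟩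
  obtain ⟨β, hβ⟩ : ∃ β, a β ≠ 0 := by
    by_contra! h; exact ha0 (Finsupp.ext h)
  obtain ⟨_, hm', hh'⟩ := hb
  obtain ⟨d', rfl⟩ := NN_lc f hm'
  obtain ⟨α, hα⟩ := MvPolynomial.exists_coeff_ne_zero hf
  obtain ⟨F, hF, hdick⟩ := dickson f
  obtain ⟨A, k, _, p, _, _, π, hlA, hA, hπ, hne⟩ := hS
    (F ∪ Set.range a ∪ Set.range d ∪ Set.range d' ∪ f.coeffs ∪ c.coeffs ∪ {(f.coeff α)⁻¹, (a β)⁻¹})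
    (by refine Set.Finite.union (Set.Finite.union (Set.Finite.union (Set.Finite.union (Set.Finite.union (Set.Finite.union hF ?_) ?_) ?_) ?_) ?_) ?_ 
        · exact Finsupp.finite_range _
        · exact Finsupp.finite_range _
        · exact Finsupp.finite_range _
        · exact Finset.finite_toSet _
        · exact Finset.finite_toSet _
        · simp)
  simp only [Set.union_subset_iff] at hA
  obtain ⟨⟨⟨⟨⟨⟨hA1, hA2⟩, hA3⟩, hA4⟩, hA5⟩, hA6⟩, hA7⟩ := hA
  obtain ⟨g, rfl⟩ : f ∈ Set.range (MvPolynomial.map A.subtype) := by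
    rw [MvPolynomial.mem_range_map_iff_coeffs_subset]; simpa using hA5
  obtain ⟨a, rfl⟩ := lowerA A a hA2
  obtain ⟨d, rfl⟩ := lowerA A d hA3
  obtain ⟨d', rfl⟩ := lowerA A d' hA4
  set cA := c.toSubring A hA6 with hcA
  have hcA' : cA.map A.subtype = c := Polynomial.map_toSubring c A hA6
  have hcm : cA.Monic := (Polynomial.monic_toSubring c A hA6).2 hc
  have hinj := mapE_inj g A.subtype Subtype.val_injective
  set lA : A := ⟨lam, hlA⟩ with hlA'
  have e1 : pS g cA = tt g (lc g d) + lc g a := by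
    apply hinj
    rw [map_add, mapE_tt, mapE_lc, mapE_lc, mapE_pS, hcA']
    exact hh.symm
  have e2 : pS g ((Polynomial.X - Polynomial.C lA) * cA) = tt g (lc g d') := by
    apply hinj
    rw [mapE_tt, mapE_lc, mapE_pS, Polynomial.map_mul, hcA', Polynomial.map_sub, Polynomial.map_X, Polynomial.map_C]
    exact hh'.symm
  set St := Std (bc g A.subtype) with hSt
  have G1 : NN g ≤ tN g ⊔ Submodule.span A (ee g '' St) := F1 g St (hdick A hA1 g rfl)
  have G2 : ∀ p ∈ Finsupp.supported A A St, lc g p ∈ tN g → p = 0 := by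
    intro p hp hpt
    have h1 := mapE_tN g A.subtype hpt
    rw [mapE_lc] at h1
    have h2 := F2K _ _ ((mr_supp A p _).2 hp) h1
    ext μ
    have := DFunLike.congr_fun h2 μ
    simpa [mr] using this
  have hgk : bc g π ≠ 0 := by
    intro h0
    have h1 := congrArg (MvPolynomial.coeff α) h0
    rw [MvPolynomial.coeff_map, MvPolynomial.coeff_zero] at h1
    have h2 : (MvPolynomial.coeff α (bc g A.subtype))⁻¹ ∈ A := hA7 (Or.inl rfl)
    have h3 : g.coeff α * ⟨_, h2⟩ = 1 := by
      apply Subtype.ext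
      change (A.subtype (g.coeff α)) * (MvPolynomial.coeff α (bc g A.subtype))⁻¹ = 1
      rw [← MvPolynomial.coeff_map]
      exact mul_inv_cancel₀ hα
    have h4 := congrArg π h3
    rw [map_mul, h1, zero_mul, map_one] at h4
    exact zero_ne_one h4
  have hbk : pS (bc g π) ((Polynomial.X - Polynomial.C (π lA)) * cA.map π) ∈ tN (bc g π) := by
    have := mapE_tN g π (v := pS g ((Polynomial.X - Polynomial.C lA) * cA)) (by rw [e2]; exact ⟨_, lc_NN _ _, rfl⟩)
    rw [mapE_pS] at this
    simpa using this
  obtain ⟨q, hq⟩ := charp_main (bc g π) p hgk _ ((Polynomial.monic_X_sub_C (π lA)).mul (hcm.map π)) hbk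
  have hcop : IsCoprime (Polynomial.X - Polynomial.C (π lA)) (sS k p ^ q) := by
    apply IsCoprime.pow_right
    rw [(Polynomial.irreducible_X_sub_C _).coprime_iff_not_dvd, Polynomial.dvd_iff_isRoot]
    intro h
    apply hne
    have : π lA ^ p - π lA = 0 := by simpa [sS] using h
    exact sub_eq_zero.1 this
  obtain ⟨u, v, huv⟩ := hcop
  have hck : pS (bc g π) (cA.map π) ∈ tN (bc g π) := by
    have : cA.map π = u * ((Polynomial.X - Polynomial.C (π lA)) * cA.map π) + (v * cA.map π) * sS k p ^ q := by
      linear_combination (- (cA.map π)) * huv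
    have h2 : pS (bc g π) (cA.map π) = pS (bc g π) u * pS (bc g π) ((Polynomial.X - Polynomial.C (π lA)) * cA.map π)
        + pS (bc g π) (v * cA.map π) * pS (bc g π) (sS k p ^ q) := by
      rw [← pS_mul, ← pS_mul]
      conv_lhs => rw [this]
      exact Polynomial.map_add _
    rw [h2]
    exact add_mem (spow_tN _ _ _ hbk) (spow_tN _ _ _ hq)
  obtain ⟨w, hw, hwk⟩ := hck
  obtain ⟨w, hwN, rfl⟩ := NN_surj g π hπ hw
  have hcNN' : pS g cA ∈ NN g := by
    have := spow_NN g cA 1 (one_mem_NN g)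
    rwa [mul_one] at this
  obtain ⟨j, hj⟩ := lift0 g π hgk (pS g cA - tt g w) (by rw [map_sub, mapE_tt, mapE_pS, hwk, sub_self])
  have h1 := pur3 g St G1 G2 (RingHom.ker π) j _ (sub_mem hcNN' (tt_NN g w hwN)) hj
  rw [e1] at h1
  have h2 := pur4 g St G1 G2 (RingHom.ker π) _ _ (lc_NN _ _) hwN a ((mr_supp A a _).1 ha) h1 β
  have h3 : (mr A.subtype a β)⁻¹ ∈ A := hA7 (Or.inr rfl)
  have h4 : a β * ⟨_, h3⟩ = 1 := by
    apply Subtype.ext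
    exact mul_inv_cancel₀ hβ
  have h5 := congrArg π h4
  rw [map_mul, (RingHom.mem_ker).1 h2, zero_mul, map_one] at h5
  exact zero_ne_one h5

theorem S3 {n : ℕ} (hS : ∀ lam : ℂ, (∀ q : ℚ, lam ≠ q) → S4prop lam) (f : MvPolynomial (Fin n) ℂ) (hf : f ≠ 0) :
    ∃ b : Polynomial ℂ, b.Monic ∧ pS f b ∈ tN f ∧ ∀ lam, b.IsRoot lam → ∃ q : ℚ, lam = q := by
  classical
  have hex : ∃ N : ℕ, ∃ b : Polynomial ℂ, b.Monic ∧ pS f b ∈ tN f ∧ b.natDegree = N := by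
    obtain ⟨b, hb0, hb⟩ := bern2 f hf
    refine ⟨_, b * Polynomial.C b.leadingCoeff⁻¹, Polynomial.monic_mul_leadingCoeff_inv hb0, ?_, rfl⟩
    rw [mul_comm, pS_mul]
    exact spow_tN f _ _ hb
  obtain ⟨b, hbm, hb, hbd⟩ := Nat.find_spec hex
  refine ⟨b, hbm, hb, ?_⟩
  intro lam hlam
  by_contra! hq
  obtain ⟨c, rfl⟩ := Polynomial.dvd_iff_isRoot.2 hlam
  have hcm : c.Monic := Polynomial.Monic.of_mul_monic_left (Polynomial.monic_X_sub_C lam) hbm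
  have hc := S3core f hf lam (hS lam hq) c hcm hb
  refine Nat.find_min hex (m := c.natDegree) ?_ ⟨c, hcm, hc, rfl⟩
  rw [← hbd, Polynomial.Monic.natDegree_mul (Polynomial.monic_X_sub_C lam) hcm]
  simp
end
end RZ

set_option linter.unusedSimpArgs false
set_option linter.unusedVariables false
set_option linter.unusedSectionVars false
namespace RZ
noncomputable section
open NumberField UniqueFactorizationMonoid

def PM {K : Type} [Field K] [NumberField K] (P : ℕ → Ideal (𝓞 K)) (m : ℕ) : Ideal (𝓞 K) :=
  ((m.primeFactorsList : Multiset ℕ).map P).prod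

theorem PM_norm {K : Type} [Field K] [NumberField K] (P : ℕ → Ideal (𝓞 K)) (m : ℕ) (hm : m ≠ 0)
    (h : ∀ p, p.Prime → p ∣ m → Ideal.absNorm (P p) = p) : Ideal.absNorm (PM P m) = m := by
  unfold PM
  rw [map_multiset_prod, Multiset.map_map]
  have : Multiset.map (Ideal.absNorm ∘ P) (m.primeFactorsList : Multiset ℕ) = (m.primeFactorsList : Multiset ℕ) := by
    conv_rhs => rw [← Multiset.map_id (m.primeFactorsList : Multiset ℕ)]
    apply Multiset.map_congr rfl
    intro p hp
    rw [Multiset.mem_coe] at hp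
    exact h p (Nat.prime_of_mem_primeFactorsList hp) (Nat.dvd_of_mem_primeFactorsList hp)
  rw [this, Multiset.prod_coe, Nat.prod_primeFactorsList hm]

theorem PM_inj {K : Type} [Field K] [NumberField K] (P Q : ℕ → Ideal (𝓞 K)) (D : ℕ)
    (hP : ∀ p, p.Prime → ¬ p ∣ D → Prime (P p) ∧ Ideal.absNorm (P p) = p)
    (hQ : ∀ p, p.Prime → ¬ p ∣ D → Prime (Q p) ∧ Ideal.absNorm (Q p) = p ∧ P p ≠ Q p)
    (m1 m2 : ℕ) (h1 : m1 ≠ 0) (h1' : ∀ p, p.Prime → p ∣ m1 → ¬ p ∣ D) (h2' : ∀ p, p.Prime → p ∣ m2 → ¬ p ∣ D) :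
    open Classical in
    m1 = (((normalizedFactors (PM P m1 * PM Q m2)).filter (fun J => J = P (Ideal.absNorm J))).map Ideal.absNorm).prod := by
  classical
  have e : normalizedFactors (PM P m1 * PM Q m2) = (m1.primeFactorsList : Multiset ℕ).map P + (m2.primeFactorsList : Multiset ℕ).map Q := by
    unfold PM
    rw [← Multiset.prod_add]
    apply normalizedFactors_prod_of_prime
    intro I hI
    rw [Multiset.mem_add, Multiset.mem_map, Multiset.mem_map] at hI
    rcases hI with ⟨p, hp, rfl⟩ | ⟨p, hp, rfl⟩
    · rw [Multiset.mem_coe] at hp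
      exact (hP p (Nat.prime_of_mem_primeFactorsList hp) (h1' p (Nat.prime_of_mem_primeFactorsList hp) (Nat.dvd_of_mem_primeFactorsList hp))).1
    · rw [Multiset.mem_coe] at hp
      exact (hQ p (Nat.prime_of_mem_primeFactorsList hp) (h2' p (Nat.prime_of_mem_primeFactorsList hp) (Nat.dvd_of_mem_primeFactorsList hp))).1
  rw [e, Multiset.filter_add, Multiset.filter_eq_self.2, Multiset.filter_eq_nil.2, add_zero, Multiset.map_map]
  · have := PM_norm P m1 h1 (fun p hp hd => (hP p hp (h1' p hp hd)).2)
    unfold PM at this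
    rw [map_multiset_prod, Multiset.map_map] at this
    exact this.symm
  · intro I hI
    obtain ⟨p, hp, rfl⟩ := Multiset.mem_map.1 hI
    rw [Multiset.mem_coe] at hp
    have := hQ p (Nat.prime_of_mem_primeFactorsList hp) (h2' p (Nat.prime_of_mem_primeFactorsList hp) (Nat.dvd_of_mem_primeFactorsList hp))
    rw [this.2.1]
    exact fun h => this.2.2 h.symm
  · intro I hI
    obtain ⟨p, hp, rfl⟩ := Multiset.mem_map.1 hI
    rw [Multiset.mem_coe] at hp
    have := hP p (Nat.prime_of_mem_primeFactorsList hp) (h1' p (Nat.prime_of_mem_primeFactorsList hp) (Nat.dvd_of_mem_primeFactorsList hp))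
    rw [this.2]

theorem NFcount1 {K : Type} [Field K] [NumberField K] (P Q : ℕ → Ideal (𝓞 K)) (D : ℕ) (hD : 0 < D)
    (hP : ∀ p, p.Prime → ¬ p ∣ D → Prime (P p) ∧ Ideal.absNorm (P p) = p)
    (hQ : ∀ p, p.Prime → ¬ p ∣ D → Prime (Q p) ∧ Ideal.absNorm (Q p) = p ∧ P p ≠ Q p) (T s : ℕ) :
    ∑ i ∈ Finset.range T, s / (D * (1 + D * i)) ≤ Nat.card {I : Ideal (𝓞 K) // Ideal.absNorm I ≤ s} := by
  classical
  have hfin := Ideal.finite_setOfPred_absNorm_le (S := 𝓞 K) s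
  have hcop : ∀ i p, p.Prime → p ∣ 1 + D * i → ¬ p ∣ D := by
    intro i p hp h1 h2
    have := (Nat.dvd_add_left (h2.mul_right i)).1 h1
    exact hp.one_lt.ne' (Nat.dvd_one.1 this)
  have hc : Nat.card {I : Ideal (𝓞 K) // Ideal.absNorm I ≤ s} = hfin.toFinset.card := by
    rw [← Nat.card_eq_card_finite_toFinset hfin]; rfl
  have hcard : ∑ i ∈ Finset.range T, s / (D * (1 + D * i)) = ((Finset.range T).sigma (fun i => Finset.range (s / (D * (1 + D * i))))).card := by
    simp [Finset.card_sigma]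
  rw [hc, hcard]
  have hn : ∀ i j, Ideal.absNorm (PM P (1 + D * i) * PM Q (1 + D * j)) = (1 + D * i) * (1 + D * j) := by
    intro i j
    rw [map_mul, PM_norm P _ (by omega) (fun p hp hd => (hP p hp (hcop _ _ hp hd)).2),
      PM_norm Q _ (by omega) (fun p hp hd => (hQ p hp (hcop _ _ hp hd)).2.1)]
  apply Finset.card_le_card_of_injOn (fun x => PM P (1 + D * x.1) * PM Q (1 + D * x.2))
  · rintro ⟨i, j⟩ hx
    simp only [Finset.coe_sigma, Finset.coe_range, Set.mem_sigma_iff, Set.mem_Iio] at hx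
    simp only [Set.Finite.coe_toFinset]
    show Ideal.absNorm _ ≤ s
    rw [hn]
    have h2 := hx.2
    rw [Nat.lt_iff_add_one_le, Nat.le_div_iff_mul_le (by positivity)] at h2
    refine le_trans ?_ h2
    nlinarith [Nat.zero_le (D * i)]
  · rintro ⟨i, j⟩ hx ⟨i', j'⟩ hx' h
    dsimp only at h
    have e1 := PM_inj P Q D hP hQ (1 + D * i) (1 + D * j) (by omega) (hcop i) (hcop j)
    have e2 := PM_inj P Q D hP hQ (1 + D * i') (1 + D * j') (by omega) (hcop i') (hcop j')
    rw [h, ← e2] at e1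
    have hi : i = i' := by
      have := Nat.add_left_cancel e1
      exact Nat.eq_of_mul_eq_mul_left hD this
    subst hi
    have e3 := hn i j
    rw [h, hn] at e3
    have := Nat.eq_of_mul_eq_mul_left (by omega) e3
    have := Nat.eq_of_mul_eq_mul_left hD (Nat.add_left_cancel this)
    rw [this]

theorem NFcount {K : Type} [Field K] [NumberField K] (P Q : ℕ → Ideal (𝓞 K)) (D : ℕ) (hD : 0 < D)
    (hP : ∀ p, p.Prime → ¬ p ∣ D → Prime (P p) ∧ Ideal.absNorm (P p) = p)
    (hQ : ∀ p, p.Prime → ¬ p ∣ D → Prime (Q p) ∧ Ideal.absNorm (Q p) = p ∧ P p ≠ Q p) : False := by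
  have ht := (Ideal.tendsto_norm_le_div_atTop K).comp tendsto_natCast_atTop_atTop
  set c := _root_.nhds (X := ℝ) _ with hc
  obtain ⟨c, ht⟩ : ∃ c : ℝ, Tendsto (fun s : ℕ => (Nat.card {I : Ideal (𝓞 K) // Ideal.absNorm I ≤ s} : ℝ) / s) atTop (nhds c) := by
    refine ⟨_, ht.congr ?_⟩
    intro s
    simp
  have key : ∀ T : ℕ, ∑ i ∈ Finset.range T, (1 / (i + 1) : ℝ) ≤ c * D ^ 2 := by
    intro T
    have h1 : ∀ᶠ s : ℕ in atTop, (∑ i ∈ Finset.range T, (1 / (D ^ 2 * (i + 1)) : ℝ)) - T * (s : ℝ)⁻¹ ≤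
        (Nat.card {I : Ideal (𝓞 K) // Ideal.absNorm I ≤ s} : ℝ) / s := by
      filter_upwards [eventually_gt_atTop 0] with s hs
      have hs' : (0 : ℝ) < s := by exact_mod_cast hs
      rw [le_div_iff₀ hs', sub_mul, mul_assoc, inv_mul_cancel₀ hs'.ne', mul_one, Finset.sum_mul]
      have h2 : ((∑ i ∈ Finset.range T, s / (D * (1 + D * i)) : ℕ) : ℝ) ≤ (Nat.card {I : Ideal (𝓞 K) // Ideal.absNorm I ≤ s} : ℝ) := by
        exact_mod_cast NFcount1 P Q D hD hP hQ T s
      refine le_trans ?_ h2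
      push_cast
      have h3 : (T : ℝ) = ∑ i ∈ Finset.range T, (1 : ℝ) := by simp
      rw [h3, ← Finset.sum_sub_distrib]
      apply Finset.sum_le_sum
      intro i hi
      have h4 : (s : ℝ) / ((D * (1 + D * i) : ℕ) : ℝ) < ((s / (D * (1 + D * i)) : ℕ) : ℝ) + 1 := by
        rw [div_lt_iff₀ (by positivity)]
        exact_mod_cast Nat.lt_mul_of_div_lt (Nat.lt_succ_self _) (by positivity)
      have h5 : 1 / ((D : ℝ) ^ 2 * (i + 1)) * s ≤ (s : ℝ) / ((D * (1 + D * i) : ℕ) : ℝ) := by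
        rw [div_mul_eq_mul_div, one_mul]
        apply div_le_div_of_nonneg_left hs'.le (by positivity)
        have : (D * (1 + D * i)) ≤ D ^ 2 * (i + 1) := by nlinarith
        exact_mod_cast this
      linarith
    have h2 : Tendsto (fun s : ℕ => (∑ i ∈ Finset.range T, (1 / (D ^ 2 * (i + 1)) : ℝ)) - T * (s : ℝ)⁻¹) atTop
        (nhds ((∑ i ∈ Finset.range T, (1 / (D ^ 2 * (i + 1)) : ℝ)) - T * 0)) :=
      tendsto_const_nhds.sub (tendsto_inv_atTop_nhds_zero_nat.const_mul _)
    have h3 := le_of_tendsto_of_tendsto h2 ht h1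
    rw [mul_zero, sub_zero] at h3
    have hD' : (0 : ℝ) < D ^ 2 := by positivity
    rw [← div_le_iff₀ hD', Finset.sum_div]
    refine le_trans (le_of_eq ?_) h3
    apply Finset.sum_congr rfl
    intro i _
    rw [div_div, mul_comm]
  obtain ⟨T, hT⟩ := (Real.tendsto_sum_range_one_div_nat_succ_atTop.eventually_gt_atTop (c * D ^ 2)).exists
  exact absurd (key T) (not_le.2 hT)
end
end RZ

set_option linter.unusedSimpArgs false
set_option linter.unusedVariables false
set_option linter.unusedSectionVars false
namespace RZ
noncomputable section
open NumberField

section val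
variable {K : Type} [Field K] {Γ : Type} [LinearOrderedCommGroupWithZero Γ] (v : Valuation K Γ)
    (p : ℕ) (hp : p.Prime) (hv : v p < 1)

def frobS : Subring K where
  carrier := {x | v x ≤ 1 ∧ v (x ^ p - x) < 1}
  zero_mem' := by simp [hp.ne_zero]
  one_mem' := by simp
  mul_mem' := by
    rintro x y ⟨hx, hx'⟩ ⟨hy, hy'⟩
    refine ⟨?_, ?_⟩
    · rw [map_mul]; exact mul_le_one' hx hy
    · have e : (x * y) ^ p - x * y = x ^ p * (y ^ p - y) + y * (x ^ p - x) := by ring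
      rw [e]
      refine lt_of_le_of_lt (v.map_add _ _) (max_lt ?_ ?_)
      · rw [map_mul, map_pow]
        exact lt_of_le_of_lt (mul_le_of_le_one_left' (pow_le_one' hx _)) hy'
      · rw [map_mul]
        exact lt_of_le_of_lt (mul_le_of_le_one_left' hy) hx'
  add_mem' := by
    rintro x y ⟨hx, hx'⟩ ⟨hy, hy'⟩
    refine ⟨le_trans (v.map_add _ _) (max_le hx hy), ?_⟩
    obtain ⟨r, hr⟩ := exists_add_pow_prime_eq hp (⟨x, hx⟩ : v.integer) ⟨y, hy⟩
    have hr' := congrArg (Subtype.val) hr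
    push_cast at hr'
    rw [hr']
    have e : x ^ p + y ^ p + (p : K) * x * y * r - (x + y) = (x ^ p - x) + (y ^ p - y) + (p : K) * (x * y * r) := by ring
    rw [e]
    refine lt_of_le_of_lt (v.map_add _ _) (max_lt (lt_of_le_of_lt (v.map_add _ _) (max_lt hx' hy')) ?_)
    rw [map_mul]
    refine mul_lt_one_of_lt_of_le hv ?_
    rw [map_mul, map_mul]
    exact mul_le_one' (mul_le_one' hx hy) r.2
  neg_mem' := by
    rintro x ⟨hx, hx'⟩
    refine ⟨by rwa [Valuation.map_neg], ?_⟩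
    rcases hp.eq_two_or_odd' with rfl | ho
    · have e : (-x) ^ 2 - (-x) = (x ^ 2 - x) + ((2 : ℕ) : K) * x := by push_cast; ring
      rw [e]
      refine lt_of_le_of_lt (v.map_add _ _) (max_lt hx' ?_)
      rw [map_mul]
      exact mul_lt_one_of_lt_of_le hv hx
    · have e : (-x) ^ p - (-x) = -(x ^ p - x) := by rw [ho.neg_pow]; ring
      rw [e, Valuation.map_neg]
      exact hx'

theorem integral_le (lam : K) (hl : v lam ≤ 1) (x : K) (hx : IsIntegral (Algebra.adjoin ℤ {lam}) x) : v x ≤ 1 := by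
  have hle : ∀ y ∈ Algebra.adjoin ℤ {lam}, y ∈ v.integer := by
    intro y hy
    induction hy using Algebra.adjoin_induction with
    | mem y hy => rw [Set.mem_singleton_iff.1 hy]; exact hl
    | algebraMap r => simp
    | add a b _ _ ha hb => exact add_mem ha hb
    | mul a b _ _ ha hb => exact mul_mem ha hb
  obtain ⟨q, hq, hq'⟩ := hx
  let ι : (Algebra.adjoin ℤ {lam}) →+* v.integer :=
    { toFun := fun y => ⟨y.1, hle _ y.2⟩, map_one' := rfl, map_mul' := fun _ _ => rfl, map_zero' := rfl, map_add' := fun _ _ => rfl }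
  have : IsIntegral v.integer x := by
    refine ⟨q.map ι, hq.map _, ?_⟩
    rw [Polynomial.eval₂_map]
    exact hq'
  exact (Valuation.integer.integers v).mem_of_integral this

include hv in
theorem frob_lam (lam u : K) (hl : v lam ≤ 1) (hu : v u = 1) (hp0 : (p : K) ≠ 0) (j N : ℕ)
    (h : IsIntegral (Algebra.adjoin ℤ {lam}) (u ^ j * (lam ^ p - lam) ^ N / p)) : v (lam ^ p - lam) < 1 := by
  have h1 := integral_le v lam hl _ h
  rw [map_div₀, map_mul, map_pow, map_pow, hu, one_pow, one_mul] at h1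
  have h0 : 0 < v (p : K) := by rwa [zero_lt_iff, Valuation.ne_zero_iff]
  rw [div_le_one₀ h0] at h1
  by_contra! h2
  exact absurd (lt_of_le_of_lt h1 hv) (not_lt.2 (one_le_pow₀ h2))
end val

theorem card_field {F : Type} [Field F] [Finite F] (p : ℕ) (hp : p.Prime) (hc : (p : F) = 0) (h : ∀ x : F, x ^ p = x) : Nat.card F = p := by
  classical
  have := Fintype.ofFinite F
  have : Fact p.Prime := ⟨hp⟩
  have : CharP F p := (CharP.charP_iff_prime_eq_zero hp).2 hc
  obtain ⟨n, hn, hc⟩ := FiniteField.card F p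
  have h1 : Fintype.card F ≤ p := by
    have h0 := FiniteField.X_pow_card_sub_X_ne_zero F hp.one_lt
    have := Polynomial.card_le_degree_of_subset_roots (p := (Polynomial.X ^ p - Polynomial.X : Polynomial F)) (Z := Finset.univ) (by
      intro x _
      rw [Polynomial.mem_roots h0]
      simp [h x])
    rwa [FiniteField.X_pow_card_sub_X_natDegree_eq F hp.one_lt] at this
  rw [Nat.card_eq_fintype_card]
  rw [hc] at h1 ⊢
  have h2 : (n : ℕ) ≤ 1 := by
    by_contra! h3
    exact absurd h1 (not_le.2 (by
      calc p = p ^ 1 := (pow_one p).symm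
        _ < p ^ (n : ℕ) := Nat.pow_lt_pow_right hp.one_lt h3))
  have : (n : ℕ) = 1 := le_antisymm h2 n.2
  rw [this, pow_one]

section nf
variable {K : Type} [Field K] [NumberField K]

theorem two_primes (p : ℕ) (hp : p.Prime) (hd : 2 ≤ Module.finrank ℚ K) (hdisc : ¬ (p : ℤ) ∣ discr K)
    (h : ∀ P : Ideal (𝓞 K), P.IsPrime → (p : 𝓞 K) ∈ P → Ideal.absNorm P = p) :
    ∃ P Q : Ideal (𝓞 K), Prime P ∧ Ideal.absNorm P = p ∧ Prime Q ∧ Ideal.absNorm Q = p ∧ P ≠ Q := by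
  have hp0 : (p : 𝓞 K) ≠ 0 := by exact_mod_cast hp.ne_zero
  have hnorm : Ideal.absNorm (Ideal.span {(p : 𝓞 K)}) = p ^ Module.finrank ℚ K := by
    rw [Ideal.absNorm_span_natCast, RingOfIntegers.rank]
  have hne : Ideal.span {(p : 𝓞 K)} ≠ ⊤ := by
    intro h1
    rw [h1, Ideal.absNorm_top] at hnorm
    exact absurd hnorm.symm (Nat.one_lt_pow (by omega) hp.one_lt).ne'
  have hprime : ∀ P : Ideal (𝓞 K), P.IsPrime → (p : 𝓞 K) ∈ P → Prime P := by
    intro P hP hpP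
    apply Ideal.prime_of_isPrime _ hP
    rintro rfl
    exact hp0 hpP
  obtain ⟨P, hPm, hP⟩ := Ideal.exists_le_maximal _ hne
  have hpP : (p : 𝓞 K) ∈ P := hP (Ideal.mem_span_singleton_self _)
  obtain ⟨J, hJ⟩ := Ideal.dvd_iff_le.2 hP
  have hJt : J ≠ ⊤ := by
    rintro rfl
    rw [Ideal.mul_top] at hJ
    rw [hJ, h P hPm.isPrime hpP] at hnorm
    have : p ^ 1 < p ^ Module.finrank ℚ K := Nat.pow_lt_pow_right hp.one_lt (by omega)
    rw [pow_one] at this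
    omega
  obtain ⟨Q, hQm, hQ⟩ := Ideal.exists_le_maximal _ hJt
  have hpQ : (p : 𝓞 K) ∈ Q := by
    apply hQ
    have := Ideal.mem_span_singleton_self (p : 𝓞 K)
    have h1 : Ideal.span {(p : 𝓞 K)} ≤ J := by
      rw [hJ]
      exact Ideal.dvd_iff_le.1 (dvd_mul_left J P)
    exact h1 this
  refine ⟨P, Q, hprime P hPm.isPrime hpP, h P hPm.isPrime hpP, hprime Q hQm.isPrime hpQ, h Q hQm.isPrime hpQ, ?_⟩
  rintro rfl
  have h2 : P ^ 2 ∣ (Ideal.span {(p : ℤ)}).map (algebraMap ℤ (𝓞 K)) := by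
    rw [Ideal.map_span, Set.image_singleton]
    simp only [algebraMap_int_eq, eq_intCast, Int.cast_natCast]
    rw [hJ, pow_two]
    exact mul_dvd_mul_left _ (Ideal.dvd_iff_le.2 hQ)
  have : (Ideal.span {(p : ℤ)}).IsMaximal := PrincipalIdealRing.isMaximal_of_irreducible (Nat.prime_iff_prime_int.1 hp).irreducible
  have h3 := pow_sub_one_dvd_differentIdeal ℤ P 2 (p := Ideal.span {(p : ℤ)}) (by
    rw [Ne, Ideal.span_singleton_eq_bot]; exact_mod_cast hp.ne_zero) h2
  have h4 : ((discr K : ℤ) : 𝓞 K) ∈ P := by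
    have := Ideal.dvd_iff_le.1 h3 (NumberField.discr_mem_differentIdeal K (𝓞 K))
    simpa using this
  have hcop : IsCoprime (p : ℤ) (discr K) := (Int.prime_iff_natAbs_prime.2 (by simpa using hp)).coprime_iff_not_dvd.2 hdisc
  obtain ⟨a, b, hab⟩ := hcop
  apply hPm.ne_top
  rw [Ideal.eq_top_iff_one]
  have h5 : (1 : 𝓞 K) = a * p + b * (discr K : ℤ) := by exact_mod_cast hab.symm
  rw [h5]
  exact add_mem (Ideal.mul_mem_left _ _ hpP) (Ideal.mul_mem_left _ _ h4)

theorem exists_den (x : K) : ∃ d : ℕ, 0 < d ∧ ∃ y : 𝓞 K, (d : K) * x = y := by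
  have hz : IsAlgebraic ℤ x := (IsFractionRing.isAlgebraic_iff ℤ ℚ K).2 (Algebra.IsAlgebraic.isAlgebraic x)
  obtain ⟨d, hd, h⟩ := hz.exists_integral_multiple
  refine ⟨d.natAbs, Int.natAbs_pos.2 hd, ?_⟩
  have h2 : IsIntegral ℤ ((d.natAbs : K) * x) := by
    rcases Int.natAbs_eq d with h3 | h3
    · rw [h3] at h
      simpa [zsmul_eq_mul] using h
    · rw [h3] at h
      simpa [zsmul_eq_mul] using h.neg
  exact ⟨⟨_, h2⟩, rfl⟩

theorem exists_den2 (lam : K) (hgen : Algebra.adjoin ℚ {lam} = ⊤) (x : K) :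
    ∃ d : ℕ, 0 < d ∧ (d : K) * x ∈ Algebra.adjoin ℤ {lam} := by
  have hx : x ∈ Algebra.adjoin ℚ {lam} := by rw [hgen]; trivial
  induction hx using Algebra.adjoin_induction with
  | mem y hy => exact ⟨1, one_pos, by rw [Nat.cast_one, one_mul]; exact Algebra.subset_adjoin hy⟩
  | algebraMap r =>
    refine ⟨r.den, r.den_pos, ?_⟩
    have : (r.den : K) * algebraMap ℚ K r = algebraMap ℤ K r.num := by
      rw [eq_ratCast, eq_intCast]
      have := Rat.den_mul_eq_num r
      exact_mod_cast congrArg (fun q : ℚ => (q : K)) this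
    rw [this]
    exact Subalgebra.algebraMap_mem _ _
  | add a b _ _ ha hb =>
    obtain ⟨d, hd, ha⟩ := ha
    obtain ⟨e, he, hb⟩ := hb
    refine ⟨d * e, by positivity, ?_⟩
    have : ((d * e : ℕ) : K) * (a + b) = (e : K) * (d * a) + (d : K) * (e * b) := by push_cast; ring
    rw [this]
    exact add_mem (mul_mem (natCast_mem _ _) ha) (mul_mem (natCast_mem _ _) hb)
  | mul a b _ _ ha hb =>
    obtain ⟨d, hd, ha⟩ := ha
    obtain ⟨e, he, hb⟩ := hb
    refine ⟨d * e, by positivity, ?_⟩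
    have : ((d * e : ℕ) : K) * (a * b) = (d * a) * (e * b) := by push_cast; ring
    rw [this]
    exact mul_mem ha hb

theorem exists_den3 (lam : K) (hgen : Algebra.adjoin ℚ {lam} = ⊤) :
    ∃ d : ℕ, 0 < d ∧ ∀ x : 𝓞 K, (d : K) * (x : K) ∈ Algebra.adjoin ℤ {lam} := by
  classical
  choose d hd h using exists_den2 lam hgen
  let b := RingOfIntegers.basis K
  refine ⟨∏ i, d (b i : K), Finset.prod_pos (fun i _ => hd _), ?_⟩
  intro x
  have e : (x : K) = ∑ i, ((b.repr x i : ℤ) : K) * (b i : K) := by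
    conv_lhs => rw [← b.sum_repr x]
    simp only [map_sum, zsmul_eq_mul, map_mul, map_intCast]
  rw [e, Finset.mul_sum]
  apply sum_mem
  intro i _
  rw [← Finset.mul_prod_erase Finset.univ (fun i => d (b i : K)) (Finset.mem_univ i)]
  have : ((d (b i : K) * ∏ j ∈ Finset.univ.erase i, d (b j : K) : ℕ) : K) * (((b.repr x i : ℤ) : K) * (b i : K)) =
     ((∏ j ∈ Finset.univ.erase i, d (b j : K) : ℕ) : K) * ((b.repr x i : ℤ) : K) * (d (b i : K) * (b i : K)) := by
    push_cast; ring
  rw [this]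
  exact mul_mem (mul_mem (natCast_mem _ _) (intCast_mem _ _)) (h _)

theorem NFcase (lam : K) (hgen : Algebra.adjoin ℚ {lam} = ⊤) (hd : 2 ≤ Module.finrank ℚ K) (u : K) (hu : u ≠ 0)
    (h : ∀ p : ℕ, p.Prime → ∃ j N : ℕ, IsIntegral (Algebra.adjoin ℤ {lam}) (u ^ j * (lam ^ p - lam) ^ N / p)) : False := by
  classical
  obtain ⟨d1, hd1, y1, h1⟩ := exists_den lam
  obtain ⟨d2, hd2, y2, h2⟩ := exists_den u
  obtain ⟨d3, hd3, y3, h3⟩ := exists_den u⁻¹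
  obtain ⟨d4, hd4, h4⟩ := exists_den3 lam hgen
  set D := d1 * d2 * d3 * d4 * (discr K).natAbs with hD
  have hD0 : 0 < D := by
    have := Int.natAbs_pos.2 (discr_ne_zero K)
    positivity
  have key : ∀ p : ℕ, p.Prime → ¬ p ∣ D → ∃ P Q : Ideal (𝓞 K), Prime P ∧ Ideal.absNorm P = p ∧ Prime Q ∧ Ideal.absNorm Q = p ∧ P ≠ Q := by
    intro p hp hpD
    have hp0 : (p : 𝓞 K) ≠ 0 := by exact_mod_cast hp.ne_zero
    have hp0' : (p : K) ≠ 0 := by exact_mod_cast hp.ne_zero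
    apply two_primes p hp hd
    · intro h'
      exact hpD (Dvd.dvd.mul_left (Int.natCast_dvd.1 h') _)
    intro P hP hpP
    let w : IsDedekindDomain.HeightOneSpectrum (𝓞 K) := ⟨P, hP, by rintro rfl; exact hp0 hpP⟩
    let v := w.valuation K
    have hv : v p < 1 := by
      have := (w.valuation_lt_one_iff_mem (K := K) (p : 𝓞 K)).2 hpP
      simpa using this
    have hle : ∀ y : 𝓞 K, v (y : K) ≤ 1 := fun y => w.valuation_le_one y
    have hone : ∀ d : ℕ, d ∣ D → v (d : K) = 1 := by
      intro d hdD
      have hc : Nat.Coprime p d := (hp.coprime_iff_not_dvd).2 (fun h' => hpD (h'.trans hdD))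
      have hc' := Nat.isCoprime_iff_coprime.2 hc
      obtain ⟨a, b, hab⟩ := hc'
      refine le_antisymm (by simpa using hle (d : 𝓞 K)) ?_
      by_contra! hlt
      have e : (1 : K) = (a : K) * p + (b : K) * d := by exact_mod_cast hab.symm
      have : v (1 : K) < 1 := by
        rw [e]
        refine lt_of_le_of_lt (v.map_add _ _) (max_lt ?_ ?_)
        · rw [map_mul]
          exact lt_of_le_of_lt (mul_le_of_le_one_left' (by simpa using hle (a : 𝓞 K))) hv
        · rw [map_mul]
          exact lt_of_le_of_lt (mul_le_of_le_one_left' (by simpa using hle (b : 𝓞 K))) hlt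
      simp at this
    have hle2 : ∀ (d : ℕ) (x : K) (y : 𝓞 K), d ∣ D → (d : K) * x = y → v x ≤ 1 := by
      intro d x y hdD e
      have := hle y
      rw [← e, map_mul, hone d hdD, one_mul] at this
      exact this
    have hl : v lam ≤ 1 := hle2 d1 lam y1 ⟨d2 * d3 * d4 * (discr K).natAbs, by rw [hD]; ring⟩ h1
    have hu1 : v u ≤ 1 := hle2 d2 u y2 ⟨d1 * d3 * d4 * (discr K).natAbs, by rw [hD]; ring⟩ h2
    have hu2 : v u⁻¹ ≤ 1 := hle2 d3 _ y3 ⟨d1 * d2 * d4 * (discr K).natAbs, by rw [hD]; ring⟩ h3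
    have hu' : v u = 1 := by
      refine le_antisymm hu1 ?_
      rw [map_inv₀] at hu2
      exact (inv_le_one₀ (by rwa [zero_lt_iff, Valuation.ne_zero_iff])).1 hu2
    obtain ⟨j, N, hjN⟩ := h p hp
    have hfl := frob_lam v p hv lam u hl hu' hp0' j N hjN
    have hS : ∀ y ∈ Algebra.adjoin ℤ {lam}, y ∈ frobS v p hp hv := by
      intro y hy
      induction hy using Algebra.adjoin_induction with
      | mem y hy => rw [Set.mem_singleton_iff.1 hy]; exact ⟨hl, hfl⟩
      | algebraMap r => simp
      | add a b _ _ ha hb => exact add_mem ha hb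
      | mul a b _ _ ha hb => exact mul_mem ha hb
    have hall : ∀ x : 𝓞 K, x ^ p - x ∈ P := by
      intro x
      have h5 := (hS _ (h4 x)).2
      have h6 : v ((d4 : K) ^ p - d4) < 1 := (natCast_mem (frobS v p hp hv) d4).2
      have hd4' : v (d4 : K) = 1 := hone d4 ⟨d1 * d2 * d3 * (discr K).natAbs, by rw [hD]; ring⟩
      have e : (d4 : K) * ((x : K) ^ p - x) = (((d4 : K) * x) ^ p - d4 * x) - ((d4 : K) ^ p - d4) * (x : K) ^ p := by ring
      have h7 : v ((d4 : K) * ((x : K) ^ p - x)) < 1 := by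
        rw [e]
        refine lt_of_le_of_lt (v.map_sub _ _) (max_lt h5 ?_)
        rw [map_mul, map_pow]
        exact mul_lt_one_of_lt_of_le h6 (pow_le_one' (hle x) _)
      rw [map_mul, hd4', one_mul] at h7
      apply (w.valuation_lt_one_iff_mem (K := K) (x ^ p - x)).1
      simpa using h7
    have hPm : P.IsMaximal := hP.isMaximal (by rintro rfl; exact hp0 hpP)
    let _ := Ideal.Quotient.field P
    have hfin : Finite (𝓞 K ⧸ P) := Ideal.finiteQuotientOfFreeOfNeBot P (by rintro rfl; exact hp0 hpP)
    rw [Ideal.absNorm_apply, Submodule.cardQuot_apply]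
    apply card_field p hp
    · have := Ideal.Quotient.eq_zero_iff_mem.2 hpP
      simpa using this
    · intro x
      obtain ⟨x, rfl⟩ := Ideal.Quotient.mk_surjective x
      rw [← map_pow]
      exact Ideal.Quotient.eq.2 (hall x)
  choose! P Q h1 h2 h3 h4 h5 using key
  exact NFcount P Q D hD0 (fun p hp hd => ⟨h1 p hp hd, h2 p hp hd⟩) (fun p hp hd => ⟨h3 p hp hd, h4 p hp hd, h5 p hp hd⟩)
end nf
end
end RZ

set_option linter.unusedSimpArgs false
set_option linter.unusedVariables false
set_option linter.unusedSectionVars false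
namespace RZ
noncomputable section
open NumberField

abbrev OL (lam : ℂ) := Algebra.adjoin ℤ ({lam} : Set ℂ)
def oL (lam : ℂ) : OL lam := ⟨lam, Algebra.subset_adjoin rfl⟩
abbrev KL (lam : ℂ) := FractionRing (OL lam)
def kL (lam : ℂ) : KL lam := algebraMap (OL lam) (KL lam) (oL lam)

theorem trans_case (lam : ℂ) (ht : Transcendental ℤ lam) (u : OL lam) (hu : u ≠ 0)
    (h : ∀ p : ℕ, p.Prime → ∃ j N : ℕ, IsIntegral (OL lam) (algebraMap (OL lam) (KL lam) u ^ j * (kL lam ^ p - kL lam) ^ N / p)) : False := by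
  let e0 : Polynomial ℤ ≃ₐ[ℤ] OL lam :=
    (AlgEquiv.ofInjective (Polynomial.aeval lam) (transcendental_iff_injective.1 ht)).trans
      (Subalgebra.equivOfEq _ _ (Algebra.adjoin_singleton_eq_range_aeval ℤ lam).symm)
  have e0X : e0 Polynomial.X = oL lam := by
    apply Subtype.ext
    simp [e0, oL]
  have : IsIntegrallyClosed (OL lam) := IsIntegrallyClosed.of_equiv e0.toRingEquiv
  have hdvd : ∀ p : ℕ, p.Prime → (p : Polynomial ℤ) ∣ e0.symm u := by
    intro p hp
    obtain ⟨j, N, hjN⟩ := h p hp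
    obtain ⟨c, hc⟩ := IsIntegrallyClosed.isIntegral_iff.1 hjN
    have hp0 : (p : KL lam) ≠ 0 := by
      have : algebraMap (OL lam) (KL lam) (p : OL lam) ≠ 0 := by
        rw [Ne, IsFractionRing.to_map_eq_zero_iff]
        exact_mod_cast hp.ne_zero
      simpa using this
    rw [eq_div_iff hp0] at hc
    have hc' : c * p = u ^ j * (oL lam ^ p - oL lam) ^ N := by
      apply IsFractionRing.injective (OL lam) (KL lam)
      simpa [kL] using hc
    have h2 := congrArg e0.symm hc'
    simp only [map_mul, map_pow, map_sub, map_natCast] at h2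
    rw [← e0X, AlgEquiv.symm_apply_apply] at h2
    have hpp : Prime (p : Polynomial ℤ) := by
      have := Polynomial.prime_C_iff.2 (Nat.prime_iff_prime_int.1 hp)
      simpa using this
    have h3 : (p : Polynomial ℤ) ∣ e0.symm u ^ j * (Polynomial.X ^ p - Polynomial.X) ^ N := ⟨_, by rw [← h2, mul_comm]⟩
    rcases hpp.dvd_or_dvd h3 with h4 | h4
    · exact hpp.dvd_of_dvd_pow h4
    · have h5 := hpp.dvd_of_dvd_pow h4
      have h6 : (Polynomial.C (p : ℤ)) ∣ (Polynomial.X ^ p - Polynomial.X : Polynomial ℤ) := by simpa using h5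
      rw [Polynomial.C_dvd_iff_dvd_coeff] at h6
      have := h6 p
      rw [Polynomial.coeff_sub, Polynomial.coeff_X_pow_self, Polynomial.coeff_X_of_ne_one hp.one_lt.ne', sub_zero] at this
      have h7 : ((p : ℤ)) ∣ ((1 : ℕ) : ℤ) := this
      exact absurd (Nat.dvd_one.1 (Int.natCast_dvd_natCast.1 h7)) hp.one_lt.ne'
  have hu' : e0.symm u ≠ 0 := by simpa using hu
  obtain ⟨p, hp1, hp2⟩ := Nat.exists_infinite_primes ((e0.symm u).leadingCoeff.natAbs + 1)
  have h1 := hdvd p hp2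
  have h2 : (Polynomial.C (p : ℤ)) ∣ e0.symm u := by simpa using h1
  rw [Polynomial.C_dvd_iff_dvd_coeff] at h2
  have h3 := Int.natCast_dvd.1 (h2 (e0.symm u).natDegree)
  have h4 := Nat.le_of_dvd (Int.natAbs_pos.2 (Polynomial.leadingCoeff_ne_zero.2 hu')) h3
  omega

theorem alg_case' (lam : ℂ) (K : Type) [Field K] [CharZero K] [Algebra (OL lam) K] [IsFractionRing (OL lam) K]
    (hq : ∀ q : ℚ, lam ≠ q) (ha : IsAlgebraic ℤ lam) (u : OL lam) (hu : u ≠ 0)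
    (h : ∀ p : ℕ, p.Prime → ∃ j N : ℕ, IsIntegral (OL lam) (algebraMap (OL lam) K u ^ j *
      (algebraMap (OL lam) K (oL lam) ^ p - algebraMap (OL lam) K (oL lam)) ^ N / p)) : False := by
  set l := algebraMap (OL lam) K (oL lam) with hl
  have hka : IsAlgebraic ℚ l := by
    obtain ⟨q, hq0, hq1⟩ := ha
    have h1 : IsAlgebraic ℤ l := by
      refine ⟨q, hq0, ?_⟩
      have h2 : q.eval₂ (Int.castRingHom (OL lam)) (oL lam) = 0 := by
        apply Subtype.ext
        have h3 := Polynomial.hom_eval₂ q (Int.castRingHom (OL lam)) (OL lam).val.toRingHom (oL lam)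
        have h4 : (OL lam).val.toRingHom.comp (Int.castRingHom (OL lam)) = algebraMap ℤ ℂ := Subsingleton.elim _ _
        rw [h4] at h3
        exact h3.trans hq1
      have h3 := Polynomial.hom_eval₂ q (Int.castRingHom (OL lam)) (algebraMap (OL lam) K) (oL lam)
      have h4 : (algebraMap (OL lam) K).comp (Int.castRingHom (OL lam)) = algebraMap ℤ K := Subsingleton.elim _ _
      rw [h4, h2, map_zero] at h3
      exact h3.symm
    exact (IsFractionRing.isAlgebraic_iff ℤ ℚ K).1 h1
  have hO : ∀ x : OL lam, algebraMap (OL lam) K x ∈ Algebra.adjoin ℤ {l} := by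
    rintro ⟨x, hx⟩
    induction hx using Algebra.adjoin_induction with
    | mem y hy =>
      have hy' := Set.mem_singleton_iff.1 hy
      subst hy'
      exact Algebra.subset_adjoin rfl
    | algebraMap r =>
      have : algebraMap (OL lam) K (r : OL lam) ∈ Algebra.adjoin ℤ {l} := by
        rw [map_intCast]; exact intCast_mem _ _
      have e : (r : OL lam) = ⟨algebraMap ℤ ℂ r, Subalgebra.algebraMap_mem _ r⟩ := by
        apply Subtype.ext
        simp
      rw [e] at this
      exact this
    | add a b ha' hb' ha hb => 
      have := add_mem ha hb
      rwa [← map_add] at this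
    | mul a b ha' hb' ha hb =>
      have := mul_mem ha hb
      rwa [← map_mul] at this
  have hO2 : ∀ x : OL lam, algebraMap (OL lam) K x ∈ Algebra.adjoin ℚ {l} := by
    intro x
    have : (Algebra.adjoin ℤ {l}) ≤ (Algebra.adjoin ℚ {l}).restrictScalars ℤ := Algebra.adjoin_le Algebra.subset_adjoin
    exact this (hO x)
  have hkint : IsIntegral ℚ l := hka.isIntegral
  have hfd : FiniteDimensional ℚ (Algebra.adjoin ℚ {l}) := by
    exact Module.Finite.iff_fg.2 (hkint.fg_adjoin_singleton)
  have hgen : Algebra.adjoin ℚ {l} = ⊤ := by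
    rw [eq_top_iff]
    intro x _
    obtain ⟨a, b, hb, rfl⟩ := IsFractionRing.div_surjective (A := OL lam) x
    rw [div_eq_mul_inv]
    refine mul_mem (hO2 a) ?_
    have hb2 : IsAlgebraic ℚ (algebraMap (OL lam) K b) := by
      have : IsIntegral ℚ (⟨_, hO2 b⟩ : Algebra.adjoin ℚ {l}) := IsIntegral.of_finite ℚ _
      exact (this.map (Algebra.adjoin ℚ {l}).val).isAlgebraic
    exact Subalgebra.inv_mem_of_algebraic _ (x := (⟨_, hO2 b⟩ : Algebra.adjoin ℚ {l})) hb2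
  have hfd2 : FiniteDimensional ℚ K := by
    rw [hgen] at hfd
    exact Module.Finite.equiv (Subalgebra.topEquiv (R := ℚ) (A := K)).toLinearEquiv
  have hnf : NumberField K := { to_charZero := inferInstance, to_finiteDimensional := hfd2 }
  have hd : 2 ≤ Module.finrank ℚ K := by
    by_contra! hlt
    have h1 : Module.finrank ℚ K = 1 := by
      have := Module.finrank_pos (R := ℚ) (M := K)
      omega
    obtain ⟨q, hqq⟩ : ∃ q : ℚ, (q : K) = l := by
      have h2 := Subalgebra.bot_eq_top_of_finrank_eq_one h1
      have h3 : l ∈ (⊥ : Subalgebra ℚ K) := by rw [h2]; trivial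
      obtain ⟨q, hq⟩ := Algebra.mem_bot.1 h3
      exact ⟨q, by simpa using hq⟩
    apply hq q
    have h4 : (q.den : K) * l = q.num := by
      rw [← hqq]
      exact_mod_cast congrArg (fun q : ℚ => (q : K)) (Rat.den_mul_eq_num q)
    have h5 : (q.den : OL lam) * oL lam = q.num := by
      apply IsFractionRing.injective (OL lam) K
      rw [map_mul, map_natCast, map_intCast]
      exact h4
    have h6 : (q.den : ℂ) * lam = q.num := by
      have := congrArg Subtype.val h5
      simpa [oL] using this
    have h7 : (q.den : ℂ) ≠ 0 := by exact_mod_cast q.den_ne_zero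
    apply mul_left_cancel₀ h7
    rw [h6]
    exact_mod_cast (congrArg (fun q : ℚ => (q : ℂ)) (Rat.den_mul_eq_num q)).symm
  have hu' : algebraMap (OL lam) K u ≠ 0 := by rwa [Ne, IsFractionRing.to_map_eq_zero_iff]
  refine NFcase l hgen hd _ hu' ?_
  intro p hp
  obtain ⟨j, N, q, hq1, hq2⟩ := h p hp
  refine ⟨j, N, ?_⟩
  let ι : (OL lam) →+* Algebra.adjoin ℤ {l} := (algebraMap (OL lam) K).codRestrict _ hO
  refine ⟨q.map ι, hq1.map _, ?_⟩
  rw [Polynomial.eval₂_map]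
  exact hq2

theorem no_case (lam : ℂ) (hq : ∀ q : ℚ, lam ≠ q) (u : OL lam) (hu : u ≠ 0)
    (h : ∀ p : ℕ, p.Prime → ∃ j N : ℕ, IsIntegral (OL lam) (algebraMap (OL lam) (KL lam) u ^ j * (kL lam ^ p - kL lam) ^ N / p)) : False := by
  by_cases ht : Transcendental ℤ lam
  · exact trans_case lam ht u hu h
  · rw [Transcendental, not_not] at ht
    exact alg_case' lam (KL lam) hq ht u hu h
end
end RZ

set_option linter.unusedSimpArgs false
set_option linter.unusedVariables false
set_option linter.unusedSectionVars false
namespace RZ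
noncomputable section

theorem exists_fin (K : Type) [Field K] [Algebra K ℂ] (F : Set ℂ) (hF : F.Finite) :
    ∃ (L : Type) (_ : Field L) (_ : Algebra K L) (ψ : Algebra.adjoin K F →ₐ[K] L), Module.Finite K L := by
  let R := Algebra.adjoin K F
  obtain ⟨m, hm⟩ := Ideal.exists_maximal R
  let fl := Ideal.Quotient.field m
  let L := R ⧸ m
  have hFT : Algebra.FiniteType K R := (Subalgebra.fg_iff_finiteType _).1 ⟨hF.toFinset, by simp [R]⟩
  have hFT2 : Algebra.FiniteType K L := Algebra.FiniteType.of_surjective (Ideal.Quotient.mkₐ K m) (Ideal.Quotient.mkₐ_surjective K m)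
  have hfin : Module.Finite K L := finite_of_finite_type_of_isJacobsonRing K L
  exact ⟨L, fl, inferInstance, Ideal.Quotient.mkₐ K m, hfin⟩

theorem jacZ : IsJacobsonRing ℤ := by
  rw [isJacobsonRing_iff_prime_eq]
  intro P hP
  by_cases h : P = ⊥
  · subst h
    refine le_antisymm ?_ Ideal.le_jacobson
    intro x hx
    rw [Ideal.mem_bot]
    by_contra hx0
    obtain ⟨p, hp1, hp2⟩ := Nat.exists_infinite_primes (x.natAbs + 1)
    have hm : (Ideal.span {(p : ℤ)}).IsMaximal := PrincipalIdealRing.isMaximal_of_irreducible (Nat.prime_iff_prime_int.1 hp2).irreducible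
    have h1 : x ∈ Ideal.span {(p : ℤ)} := by
      rw [Ideal.jacobson, Ideal.mem_sInf] at hx
      exact hx ⟨bot_le, hm⟩
    have h2 := Int.natCast_dvd.1 (Ideal.mem_span_singleton.1 h1)
    have := Nat.le_of_dvd (Int.natAbs_pos.2 hx0) h2
    omega
  · have := hP.isMaximal h
    exact Ideal.jacobson_eq_self_of_isMaximal

theorem S4red (lam : ℂ) (F : Set ℂ) (hF : F.Finite) (K : Type) [Field K] [Algebra (OL lam) K] [IsFractionRing (OL lam) K]
    [Algebra K ℂ] [IsScalarTower (OL lam) K ℂ] :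
    ∃ u : OL lam, u ≠ 0 ∧ ∀ a ∈ Algebra.adjoin ℤ (F ∪ {lam}), ∀ y : K, ∀ p : ℕ, p ≠ 0 → algebraMap K ℂ y = p * a →
      ∃ j : ℕ, IsIntegral (OL lam) (algebraMap (OL lam) K u ^ j * y / p) := by
  classical
  let R := Algebra.adjoin K F
  obtain ⟨L, _, _, ψ, hfin⟩ := exists_fin K F hF
  let algL : Algebra (OL lam) L := ((algebraMap K L).comp (algebraMap (OL lam) K)).toAlgebra
  have tow : IsScalarTower (OL lam) K L := IsScalarTower.of_algebraMap_eq' rfl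
  have hal : Algebra.IsAlgebraic (OL lam) L := by
    have h1 : Algebra.IsAlgebraic (OL lam) K := IsLocalization.isAlgebraic K (nonZeroDivisors (OL lam))
    have h2 : Algebra.IsAlgebraic K L := Algebra.IsAlgebraic.of_finite K L
    exact Algebra.IsAlgebraic.trans (OL lam) K L
  have hFR : ∀ x ∈ F, x ∈ R := fun x hx => Algebra.subset_adjoin hx
  obtain ⟨u, hu, hu2⟩ := Algebra.IsAlgebraic.exists_integral_multiples (R := OL lam) (A := L)
    (hF.toFinset.attach.image (fun x : {x // x ∈ hF.toFinset} => ψ ⟨x.1, hFR x.1 (hF.mem_toFinset.1 x.2)⟩))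
  have hu3 : ∀ x (hx : x ∈ F), IsIntegral (OL lam) (u • ψ ⟨x, hFR x hx⟩) := by
    intro x hx
    apply hu2
    rw [Finset.mem_image]
    exact ⟨⟨x, hF.mem_toFinset.2 hx⟩, Finset.mem_attach _ _, rfl⟩
  have key : ∀ a ∈ Algebra.adjoin ℤ (F ∪ {lam}), ∃ (ha : a ∈ R) (j : ℕ), IsIntegral (OL lam) (u ^ j • ψ ⟨a, ha⟩) := by
    have hup : ∀ k : ℕ, IsIntegral (OL lam) (algebraMap (OL lam) L (u ^ k)) := fun k => isIntegral_algebraMap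
    intro a ha
    induction ha using Algebra.adjoin_induction with
    | mem x hx =>
      rcases hx with hx | hx
      · exact ⟨hFR x hx, 1, by simpa using hu3 x hx⟩
      · have hx' := Set.mem_singleton_iff.1 hx
        subst hx'
        have e : x = algebraMap K ℂ (algebraMap (OL x) K (oL x)) := by
          rw [← IsScalarTower.algebraMap_apply]; rfl
        have hxR : x ∈ R := by rw [e]; exact Subalgebra.algebraMap_mem _ _
        refine ⟨hxR, 0, ?_⟩
        rw [pow_zero, one_smul]
        have e2 : (⟨x, hxR⟩ : R) = algebraMap K R (algebraMap (OL x) K (oL x)) := Subtype.ext e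
        rw [e2, AlgHom.commutes, ← IsScalarTower.algebraMap_apply (OL x) K L]
        exact isIntegral_algebraMap
    | algebraMap r =>
      have e : algebraMap ℤ ℂ r = ((r : R) : ℂ) := by simp
      have hxR : algebraMap ℤ ℂ r ∈ R := by rw [e]; exact Subtype.mem _
      refine ⟨hxR, 0, ?_⟩
      rw [pow_zero, one_smul]
      have e2 : (⟨algebraMap ℤ ℂ r, hxR⟩ : R) = (r : R) := Subtype.ext e
      rw [e2, map_intCast]
      have : ((r : ℤ) : L) = algebraMap (OL lam) L (r : OL lam) := by rw [map_intCast]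
      rw [this]
      exact isIntegral_algebraMap
    | add a b _ _ ha hb =>
      obtain ⟨ha, j, h1⟩ := ha
      obtain ⟨hb, k, h2⟩ := hb
      refine ⟨add_mem ha hb, j + k, ?_⟩
      have e : u ^ (j + k) • ψ ⟨a + b, add_mem ha hb⟩ = algebraMap (OL lam) L (u ^ k) * (u ^ j • ψ ⟨a, ha⟩) + algebraMap (OL lam) L (u ^ j) * (u ^ k • ψ ⟨b, hb⟩) := by
        have : (⟨a + b, add_mem ha hb⟩ : R) = ⟨a, ha⟩ + ⟨b, hb⟩ := rfl
        rw [this, map_add]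
        simp only [Algebra.smul_def, map_pow]
        ring
      rw [e]
      exact ((hup k).mul h1).add ((hup j).mul h2)
    | mul a b _ _ ha hb =>
      obtain ⟨ha, j, h1⟩ := ha
      obtain ⟨hb, k, h2⟩ := hb
      refine ⟨mul_mem ha hb, j + k, ?_⟩
      have e : u ^ (j + k) • ψ ⟨a * b, mul_mem ha hb⟩ = (u ^ j • ψ ⟨a, ha⟩) * (u ^ k • ψ ⟨b, hb⟩) := by
        have : (⟨a * b, mul_mem ha hb⟩ : R) = ⟨a, ha⟩ * ⟨b, hb⟩ := rfl
        rw [this, map_mul]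
        simp only [Algebra.smul_def, map_pow]
        ring
      rw [e]
      exact h1.mul h2
  refine ⟨u, hu, ?_⟩
  intro a ha y p hp hy
  obtain ⟨haR, j, hj⟩ := key a ha
  refine ⟨j, ?_⟩
  rw [← isIntegral_algebraMap_iff (algebraMap K L).injective]
  have hpL : (p : K) ≠ 0 := by
    intro h0
    have := congrArg (algebraMap K ℂ) h0
    rw [map_natCast, map_zero] at this
    exact hp (by exact_mod_cast this)
  have e1 : algebraMap K R y = (p : R) * ⟨a, haR⟩ := by
    apply Subtype.ext
    push_cast
    exact hy
  have e2 : algebraMap K L y = p * ψ ⟨a, haR⟩ := by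
    have := congrArg ψ e1
    rwa [AlgHom.commutes, map_mul, map_natCast] at this
  have e3 : algebraMap K L (algebraMap (OL lam) K u ^ j * y / p) = u ^ j • ψ ⟨a, haR⟩ := by
    rw [map_div₀, map_mul, e2, map_natCast, Algebra.smul_def, map_pow, map_pow, IsScalarTower.algebraMap_apply (OL lam) K L]
    have : (p : L) ≠ 0 := by
      have := (map_ne_zero (algebraMap K L)).2 hpL
      rwa [map_natCast] at this
    field_simp
  rw [e3]
  exact hj

theorem S4 (lam : ℂ) (hq : ∀ q : ℚ, lam ≠ q) : S4prop lam := by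
  intro F hF
  by_contra hcon
  let A0 := Algebra.adjoin ℤ (F ∪ {lam})
  let A : Subring ℂ := A0.toSubring
  have hl : lam ∈ A := Algebra.subset_adjoin (Or.inr rfl)
  have hFT : Algebra.FiniteType ℤ A0 := (Subalgebra.fg_iff_finiteType _).1 ⟨(hF.union (Set.finite_singleton lam)).toFinset, by simp [A0]⟩
  have := jacZ
  have hJ0 : IsJacobsonRing A0 := isJacobsonRing_of_finiteType (A := ℤ)
  have hJ : IsJacobsonRing A := hJ0
  have h1 : ∀ p : ℕ, p.Prime → ∃ N : ℕ, ∃ a ∈ A0, (lam ^ p - lam) ^ N = p * a := by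
    intro p hp
    have h2 : (⟨lam, hl⟩ : A) ^ p - ⟨lam, hl⟩ ∈ (Ideal.span {(p : A)}).radical := by
      rw [Ideal.radical_eq_jacobson, Ideal.jacobson, Ideal.mem_sInf]
      rintro m ⟨hpm, hm⟩
      by_contra hlm
      apply hcon
      let fld := Ideal.Quotient.field m
      have hpk : (p : A ⧸ m) = 0 := by
        have := Ideal.Quotient.eq_zero_iff_mem.2 (hpm (Ideal.mem_span_singleton_self _))
        simpa using this
      refine ⟨A, A ⧸ m, fld, p, ⟨hp⟩, (CharP.charP_iff_prime_eq_zero hp).2 hpk, Ideal.Quotient.mk m, hl, ?_, Ideal.Quotient.mk_surjective, ?_⟩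
      · exact fun x hx => Algebra.subset_adjoin (Or.inl hx)
      · intro h
        apply hlm
        rw [← map_pow] at h
        exact Ideal.Quotient.eq.1 h
    obtain ⟨N, hN⟩ := h2
    obtain ⟨a, ha⟩ := Ideal.mem_span_singleton'.1 hN
    refine ⟨N, a.1, a.2, ?_⟩
    have := congrArg Subtype.val ha
    push_cast at this
    rw [← this, mul_comm]
  let _ : Algebra (KL lam) ℂ := FractionRing.liftAlgebra (OL lam) ℂ
  have tow : IsScalarTower (OL lam) (KL lam) ℂ := FractionRing.isScalarTower_liftAlgebra (OL lam) ℂ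
  obtain ⟨u, hu, hu2⟩ := S4red lam F hF (KL lam)
  apply no_case lam hq u hu
  intro p hp
  obtain ⟨N, a, ha, e⟩ := h1 p hp
  obtain ⟨j, hj⟩ := hu2 a ha ((kL lam ^ p - kL lam) ^ N) p hp.ne_zero (by
    rw [← e, map_pow, map_sub, map_pow]
    have : algebraMap (KL lam) ℂ (kL lam) = lam := by
      rw [kL, ← IsScalarTower.algebraMap_apply]; rfl
    rw [this])
  exact ⟨j, N, hj⟩

theorem bernsteinRational {n : ℕ} (f : MvPolynomial (Fin n) ℂ) (hf : f ≠ 0) :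
    ∃ b : Polynomial ℂ, b.Monic ∧ pS f b ∈ tN f ∧ ∀ lam, b.IsRoot lam → ∃ q : ℚ, lam = q :=
  S3 S4 f hf
end
end RZ


set_option linter.unusedSimpArgs false
set_option linter.unusedVariables false
set_option linter.unusedSectionVars false
namespace RZ
noncomputable section

section
variable {n : ℕ} (h : MvPolynomial (Fin n) ℂ) (z : Fin n → ℂ) (hz : MvPolynomial.eval z h ≠ 0)

/-- evaluation of `ZP h` at a point where `h` does not vanish -/
def evP : ZP h →+* ℂ :=
  IsLocalization.Away.lift (g := MvPolynomial.eval z) h (isUnit_iff_ne_zero.2 hz)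

lemma evP_toP (r) : evP h z hz (toP h r) = MvPolynomial.eval z r := by
  simp only [evP]
  exact IsLocalization.Away.lift_eq h _ r

lemma evP_algebraMap (a : ℂ) : evP h z hz (algebraMap ℂ (ZP h) a) = a := by
  have : algebraMap ℂ (ZP h) a = toP h (MvPolynomial.C a) := by
    rw [IsScalarTower.algebraMap_apply ℂ (MvPolynomial (Fin n) ℂ) (ZP h)]; rfl
  rw [this, evP_toP]; simp

lemma evP_gP (i) : MvPolynomial.eval z h * evP h z hz (gP h i) =
    MvPolynomial.eval z (MvPolynomial.pderiv i h) := by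
  have h1 := congrArg (evP h z hz) (f_mul_finv h)
  rw [map_mul, evP_toP, map_one] at h1
  rw [gP, map_mul, evP_toP]
  linear_combination (MvPolynomial.eval z (MvPolynomial.pderiv i h)) * h1

/-- evaluation of `ZE h` -/
def evE (s : ℂ) : ZE h →+* ℂ := Polynomial.eval₂RingHom (evP h z hz) s

lemma evE_C (s p) : evE h z hz s (Polynomial.C p) = evP h z hz p := by simp [evE]
lemma evE_X (s) : evE h z hz s Polynomial.X = s := by simp [evE]

lemma evE_smul (s a p) : evE h z hz s (a • p) = a * evE h z hz s p := by
  rw [Algebra.smul_def, map_mul]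
  congr 1
  rw [Polynomial.algebraMap_apply, evE_C, evP_algebraMap]

lemma evE_opX (s i p) : evE h z hz s (opX h i p) = z i * evE h z hz s p := by
  rw [opX_apply, map_mul, evE_C, evP_toP]; simp

lemma evE_opS (s p) : evE h z hz s (opS h p) = s * evE h z hz s p := by
  rw [opS_apply, map_mul, evE_X]

lemma evE_tt (s p) : evE h z hz s (tt h p) = MvPolynomial.eval z h * evE h z hz (s+1) p := by
  rw [tt_apply, map_mul, evE_C, evP_toP]
  congr 1
  simp only [evE, Polynomial.coe_eval₂RingHom]
  rw [Polynomial.eval₂_comp]; simp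

lemma evE_pS (s b) : evE h z hz s (pS h b) = b.eval s := by
  simp only [evE, pS, Polynomial.coe_eval₂RingHom, Polynomial.eval₂_map]
  have : (evP h z hz).comp (algebraMap ℂ (ZP h)) = RingHom.id ℂ := by
    ext a; exact evP_algebraMap h z hz a
  rw [this]; rfl

lemma evE_map (s) (P : Polynomial (MvPolynomial (Fin n) ℂ)) :
    evE h z hz s (P.map (toP h)) = MvPolynomial.eval z (P.eval (MvPolynomial.C s)) := by
  induction P using Polynomial.induction_on' with
  | add p q hp hq => simp [hp, hq]
  | monomial k a =>
    rw [← Polynomial.C_mul_X_pow_eq_monomial]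
    simp only [Polynomial.map_mul, Polynomial.map_C, Polynomial.map_pow, Polynomial.map_X, map_mul, map_pow,
      evE_C, evE_X, evP_toP, Polynomial.eval_mul, Polynomial.eval_C, Polynomial.eval_pow, Polynomial.eval_X,
      MvPolynomial.eval_C]

lemma evE_dE_map (s i) (P : Polynomial (MvPolynomial (Fin n) ℂ)) :
    evE h z hz s (dE h i (P.map (toP h))) =
      MvPolynomial.eval z (MvPolynomial.pderiv i (P.eval (MvPolynomial.C s))) := by
  induction P using Polynomial.induction_on' with
  | add p q hp hq => simp [hp, hq]
  | monomial k a =>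
    rw [← Polynomial.C_mul_X_pow_eq_monomial]
    simp only [Polynomial.map_mul, Polynomial.map_C, Polynomial.map_pow, Polynomial.map_X, map_mul, map_pow,
      Polynomial.eval_mul, Polynomial.eval_C, Polynomial.eval_pow, Polynomial.eval_X, Derivation.leibniz,
      Derivation.leibniz_pow, dE_C, dE_X, smul_zero, mul_zero, zero_add, smul_eq_mul, evE_X, evE_C, dP_toP, evP_toP,
      MvPolynomial.eval_C, MvPolynomial.pderiv_C, nsmul_zero, map_zero, add_zero, map_add]

lemma evE_clear (s : ℂ) (e : ZE h) (k : ℕ) (P : Polynomial (MvPolynomial (Fin n) ℂ))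
    (hP : Polynomial.C (toP h h ^ k) * e = P.map (toP h)) :
    MvPolynomial.eval z (P.eval (MvPolynomial.C s)) = MvPolynomial.eval z h ^ k * evE h z hz s e := by
  rw [← evE_map h z hz, ← hP, map_mul, evE_C, map_pow, evP_toP]

lemma evE_nab (s : ℂ) (e : ZE h) (k : ℕ) (P : Polynomial (MvPolynomial (Fin n) ℂ)) (i : Fin n)
    (hP : Polynomial.C (toP h h ^ k) * e = P.map (toP h)) :
    MvPolynomial.eval z h ^ (k+1) * evE h z hz s (nab h i e) =
     MvPolynomial.eval z h * MvPolynomial.eval z (MvPolynomial.pderiv i (P.eval (MvPolynomial.C s))) +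
     (s - k) * MvPolynomial.eval z (MvPolynomial.pderiv i h) * MvPolynomial.eval z (P.eval (MvPolynomial.C s)) := by
  have h1 := evE_dE_map h z hz s i P
  have h2 := evE_clear h z hz s e k P hP
  have h3 := evP_gP h z hz i
  rw [← hP] at h1
  simp only [Derivation.leibniz, dE_C, Derivation.leibniz_pow, dP_toP, smul_eq_mul, nsmul_eq_mul, map_add, map_mul,
    map_pow, evE_C, evP_toP, map_natCast] at h1
  rw [← h1, h2, nab_apply]
  simp only [map_add, map_mul, evE_X, evE_C]
  rcases k with _ | k
  · simp; linear_combination s * (evE h z hz s e) * h3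
  · simp only [Nat.add_sub_cancel]; push_cast
    linear_combination s * (evE h z hz s e) * (MvPolynomial.eval z h ^ (k+1)) * h3
end

section
/-- real power with complex exponent -/
def ps (w : ℂ) (t : ℝ) : ℂ := if t ≤ 0 then 0 else Complex.exp (w * (Real.log t : ℂ))

lemma ps_pos (w : ℂ) {t : ℝ} (ht : 0 < t) : ps w t = Complex.exp (w * (Real.log t : ℂ)) := by
  simp [ps, ht]
lemma ps_np (w : ℂ) {t : ℝ} (ht : t ≤ 0) : ps w t = 0 := by simp [ps, ht]

lemma ps_add_nat (w : ℂ) (k : ℕ) {t : ℝ} (ht : 0 < t) : ps (w + k) t = (t : ℂ) ^ k * ps w t := by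
  rw [ps_pos _ ht, ps_pos _ ht, add_mul, Complex.exp_add, mul_comm, Complex.exp_nat_mul, ← Complex.ofReal_exp,
    Real.exp_log ht]

lemma ps_norm (w : ℂ) {t : ℝ} (ht : 0 < t) : ‖ps w t‖ = t ^ w.re := by
  rw [ps_pos _ ht, Complex.norm_exp, Real.rpow_def_of_pos ht]
  congr 1
  simp [mul_comm]

lemma ps_norm_le (w : ℂ) (hw : 0 ≤ w.re) (t B : ℝ) (hB : 1 ≤ B) (ht : t ≤ B) : ‖ps w t‖ ≤ B ^ w.re := by
  rcases le_or_gt t 0 with h | h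
  · rw [ps_np _ h]; simp; positivity
  · rw [ps_norm _ h]; gcongr

lemma ps_hasDerivAt_pos (w : ℂ) {t : ℝ} (ht : 0 < t) : HasDerivAt (ps w) (w * ps (w - 1) t) t := by
  have h1 : HasDerivAt (fun t : ℝ => Complex.exp (w * (Real.log t : ℂ)))
      (Complex.exp (w * (Real.log t : ℂ)) * (w * ((t⁻¹ : ℝ) : ℂ))) t :=
    (((Real.hasDerivAt_log ht.ne').ofReal_comp).const_mul w).cexp
  have h2 : w * ps (w - 1) t = Complex.exp (w * (Real.log t : ℂ)) * (w * ((t⁻¹ : ℝ) : ℂ)) := by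
    have := ps_add_nat (w - 1) 1 ht
    simp only [Nat.cast_one, sub_add_cancel, pow_one] at this
    rw [← ps_pos _ ht, this]
    have : (t : ℂ) ≠ 0 := by exact_mod_cast ht.ne'
    push_cast; field_simp
  rw [h2]
  refine h1.congr_of_eventuallyEq ?_
  filter_upwards [lt_mem_nhds ht] with u hu
  exact ps_pos _ hu

lemma ps_hasDerivAt_neg (w : ℂ) {t : ℝ} (ht : t < 0) : HasDerivAt (ps w) 0 t := by
  refine (hasDerivAt_const t (0 : ℂ)).congr_of_eventuallyEq ?_
  filter_upwards [gt_mem_nhds ht] with u hu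
  exact ps_np _ hu.le

lemma ps_le_rpow (w : ℂ) (hw : 0 < w.re) (t : ℝ) : ‖ps w t‖ ≤ |t| ^ w.re := by
  rcases le_or_gt t 0 with h | h
  · rw [ps_np _ h]; simp; positivity
  · rw [ps_norm _ h, abs_of_pos h]

lemma ps_cont (w : ℂ) (hw : 0 < w.re) : Continuous (ps w) := by
  rw [continuous_iff_continuousAt]
  intro t
  rcases lt_trichotomy t 0 with h | h | h
  · exact (ps_hasDerivAt_neg w h).continuousAt
  · subst h
    rw [ContinuousAt, ps_np _ le_rfl]
    refine squeeze_zero_norm (ps_le_rpow w hw) ?_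
    have : ContinuousAt (fun t : ℝ => |t| ^ w.re) 0 :=
      ContinuousAt.rpow_const continuous_abs.continuousAt (Or.inr hw.le)
    have h2 := this.tendsto
    simpa [Real.zero_rpow hw.ne'] using h2
  · exact (ps_hasDerivAt_pos w h).continuousAt

lemma ps_hasDerivAt (w : ℂ) (hw : 1 < w.re) (t : ℝ) : HasDerivAt (ps w) (w * ps (w - 1) t) t := by
  rcases lt_trichotomy t 0 with h | h | h
  · rw [ps_np _ h.le, mul_zero]; exact ps_hasDerivAt_neg w h
  · subst h
    rw [ps_np _ le_rfl, mul_zero, hasDerivAt_iff_isLittleO]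
    simp only [ps_np _ (le_refl (0:ℝ)), sub_zero, smul_zero]
    have h1 : (ps w) =O[nhds 0] fun t : ℝ => |t| ^ w.re := by
      refine Asymptotics.IsBigO.of_bound 1 (Eventually.of_forall fun t => ?_)
      rw [one_mul, Real.norm_of_nonneg (by positivity)]
      exact ps_le_rpow w (by linarith) t
    refine h1.trans_isLittleO ?_
    rw [Asymptotics.isLittleO_iff]
    intro c hc
    have : ContinuousAt (fun t : ℝ => |t| ^ (w.re - 1)) 0 :=
      ContinuousAt.rpow_const continuous_abs.continuousAt (Or.inr (by linarith))
    have h2 := this.tendsto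
    simp only [abs_zero] at h2
    rw [Real.zero_rpow (by linarith)] at h2
    filter_upwards [h2.eventually (gt_mem_nhds hc)] with u hu
    rw [Real.norm_of_nonneg (by positivity), Real.norm_eq_abs]
    rcases eq_or_ne u 0 with rfl | hu0
    · simp [Real.zero_rpow (by linarith : w.re ≠ 0)]
    · have : |u| ^ w.re = |u| ^ (w.re - 1) * |u| := by
        rw [← Real.rpow_add_one (abs_pos.2 hu0).ne']; simp
      rw [this]; gcongr
  · exact ps_hasDerivAt_pos w h

end
end
end RZ


set_option linter.unusedSimpArgs false
set_option linter.unusedVariables false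
set_option linter.unusedSectionVars false
namespace RZ
noncomputable section

section
variable {n : ℕ}

/-- complexification of a real point -/
def cx (x : Fin n → ℝ) : Fin n → ℂ := fun i => (x i : ℂ)

/-- complexification of a real polynomial -/
def gC (g : MvPolynomial (Fin n) ℝ) : MvPolynomial (Fin n) ℂ := MvPolynomial.map (algebraMap ℝ ℂ) g

lemma eval_gC (g : MvPolynomial (Fin n) ℝ) (x) :
    MvPolynomial.eval (cx x) (gC g) = ((MvPolynomial.eval x g : ℝ) : ℂ) := by
  rw [gC, MvPolynomial.eval_map]
  have := MvPolynomial.eval₂_comp_left (algebraMap ℝ ℂ) (RingHom.id ℝ) x g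
  simp only [RingHom.comp_id, MvPolynomial.eval₂_id] at this
  exact this.symm

lemma hasF (r : MvPolynomial (Fin n) ℂ) (x : Fin n → ℝ) :
    ∃ L : (Fin n → ℝ) →L[ℝ] ℂ, HasFDerivAt (fun x => MvPolynomial.eval (cx x) r) L x ∧
      ∀ i, L (Pi.single i 1) = MvPolynomial.eval (cx x) (MvPolynomial.pderiv i r) := by
  induction r using MvPolynomial.induction_on with
  | C a => exact ⟨0, by simpa using hasFDerivAt_const a x, by simp⟩
  | add p q hp hq =>
    obtain ⟨L1, h1, h1'⟩ := hp
    obtain ⟨L2, h2, h2'⟩ := hq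
    refine ⟨L1 + L2, by simp only [map_add]; exact h1.add h2, fun i => by simp [h1', h2']⟩
  | mul_X p j hp =>
    obtain ⟨L1, h1, h1'⟩ := hp
    have h2 : HasFDerivAt (fun x : Fin n → ℝ => ((x j : ℝ) : ℂ))
        (Complex.ofRealCLM.comp (ContinuousLinearMap.proj j : (Fin n → ℝ) →L[ℝ] ℝ)) x :=
      (Complex.ofRealCLM.comp (ContinuousLinearMap.proj j : (Fin n → ℝ) →L[ℝ] ℝ)).hasFDerivAt
    have h3 := h1.mul h2
    have h4 := h3.congr_of_eventuallyEq (f₁ := fun x => MvPolynomial.eval (cx x) (p * MvPolynomial.X j))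
      (Eventually.of_forall fun y => by simp [cx])
    refine ⟨_, h4, ?_⟩
    · intro i
      simp only [add_apply, smul_apply, h1', cx, Derivation.leibniz,
        MvPolynomial.pderiv_X, smul_eq_mul, map_add, map_mul, MvPolynomial.eval_X, ContinuousLinearMap.comp_apply,
        ContinuousLinearMap.proj_apply, Complex.ofRealCLM_apply]
      rcases eq_or_ne j i with rfl | hji
      · simp
      · simp [Pi.single_apply, hji]

lemma hasFg (g : MvPolynomial (Fin n) ℝ) (x : Fin n → ℝ) :
    ∃ L : (Fin n → ℝ) →L[ℝ] ℝ, HasFDerivAt (fun x => MvPolynomial.eval x g) L x ∧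
      ∀ i, ((L (Pi.single i 1) : ℝ) : ℂ) = MvPolynomial.eval (cx x) (MvPolynomial.pderiv i (gC g)) := by
  obtain ⟨L, h1, h2⟩ := hasF (gC g) x
  refine ⟨Complex.reCLM.comp L, ?_, fun i => ?_⟩
  · have := Complex.reCLM.hasFDerivAt.comp x h1
    simpa [Function.comp_def, eval_gC] using this
  · simp only [ContinuousLinearMap.comp_apply, h2]
    rw [gC, MvPolynomial.pderiv_map]
    change (((MvPolynomial.eval (cx x) (gC _)).re : ℝ) : ℂ) = MvPolynomial.eval (cx x) (gC _)
    rw [eval_gC]; simp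

lemma cont_eval (r : MvPolynomial (Fin n) ℂ) : Continuous (fun x => MvPolynomial.eval (cx x) r) := by
  rw [continuous_iff_continuousAt]
  intro x
  obtain ⟨L, h, _⟩ := hasF r x
  exact h.continuousAt

lemma cont_g (g : MvPolynomial (Fin n) ℝ) : Continuous (fun x => MvPolynomial.eval x g) := by
  rw [continuous_iff_continuousAt]
  intro x
  obtain ⟨L, h, _⟩ := hasFg g x
  exact h.continuousAt

variable (g : MvPolynomial (Fin n) ℝ)

open Classical in
/-- The function attached to an element of `E` -/
def FF (e : ZE (gC g)) (s : ℂ) (x : Fin n → ℝ) : ℂ :=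
  if hx : MvPolynomial.eval (cx x) (gC g) ≠ 0 then
    evE (gC g) (cx x) hx s e * ps s (MvPolynomial.eval x g) else 0

lemma FF_add (e e' s x) : FF g (e + e') s x = FF g e s x + FF g e' s x := by
  unfold FF; split_ifs
  · rw [map_add, add_mul]
  · simp
lemma FF_smul (a : ℂ) (e s x) : FF g (a • e) s x = a * FF g e s x := by
  unfold FF; split_ifs
  · rw [evE_smul, mul_assoc]
  · simp
lemma FF_opX (i e s x) : FF g (opX (gC g) i e) s x = x i * FF g e s x := by
  unfold FF; split_ifs
  · rw [evE_opX, mul_assoc]; rfl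
  · simp
lemma FF_opS (e s x) : FF g (opS (gC g) e) s x = s * FF g e s x := by
  unfold FF; split_ifs
  · rw [evE_opS, mul_assoc]
  · simp
variable (hg : ∀ x, 0 ≤ MvPolynomial.eval x g)
include hg
lemma g_pos {x} (hx : MvPolynomial.eval (cx x) (gC g) ≠ 0) : 0 < MvPolynomial.eval x g := by
  rw [eval_gC] at hx
  exact lt_of_le_of_ne (hg x) (by exact_mod_cast hx.symm)
lemma FF_tt (e s x) : FF g (tt (gC g) e) s x = FF g e (s+1) x := by
  unfold FF; split_ifs with hx
  · have := ps_add_nat s 1 (g_pos g hg hx)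
    rw [Nat.cast_one, pow_one] at this
    rw [evE_tt, this, eval_gC]; ring
  · simp
omit hg in
lemma FF_pS (b : Polynomial ℂ) (s x) : FF g (pS (gC g) b) s x = b.eval s * ps s (MvPolynomial.eval x g) := by
  unfold FF; split_ifs with hx
  · rw [evE_pS]
  · rw [not_not, eval_gC] at hx
    rw [ps_np]; · simp
    · exact (Complex.ofReal_eq_zero.1 hx).le
lemma FF_clear (e) (k : ℕ) (P : Polynomial (MvPolynomial (Fin n) ℂ))
    (hP : Polynomial.C (toP (gC g) (gC g) ^ k) * e = P.map (toP (gC g))) (s x) :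
    FF g e s x = MvPolynomial.eval (cx x) (P.eval (MvPolynomial.C s)) * ps (s - k) (MvPolynomial.eval x g) := by
  unfold FF; split_ifs with hx
  · have := ps_add_nat (s - k) k (g_pos g hg hx)
    rw [sub_add_cancel] at this
    rw [evE_clear _ _ hx s e k P hP, this, eval_gC]; ring
  · rw [not_not, eval_gC] at hx
    rw [ps_np]; · simp
    · exact (Complex.ofReal_eq_zero.1 hx).le

lemma FF_cont (e) : ∃ k : ℕ, ∀ s : ℂ, k < s.re → Continuous (FF g e s) := by
  obtain ⟨k, P, hP⟩ := clearE (gC g) e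
  refine ⟨k, fun s hs => ?_⟩
  have : FF g e s = fun x => MvPolynomial.eval (cx x) (P.eval (MvPolynomial.C s)) * ps (s - k) (MvPolynomial.eval x g) := by
    ext x; exact FF_clear g hg e k P hP s x
  rw [this]
  refine (cont_eval _).mul ((ps_cont _ ?_).comp (cont_g g))
  simp; exact hs

lemma FF_diff (e) : ∃ k : ℕ, ∀ s : ℂ, k < s.re → ∀ x, DifferentiableAt ℝ (FF g e s) x ∧
    ∀ i, fderiv ℝ (FF g e s) x (Pi.single i 1) = FF g (nab (gC g) i e) s x := by
  obtain ⟨k, P, hP⟩ := clearE (gC g) e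
  refine ⟨k + 1, fun s hs x => ?_⟩
  have he : FF g e s = fun x => MvPolynomial.eval (cx x) (P.eval (MvPolynomial.C s)) * ps (s - k) (MvPolynomial.eval x g) := by
    ext x; exact FF_clear g hg e k P hP s x
  obtain ⟨L1, h1, h1'⟩ := hasF (P.eval (MvPolynomial.C s)) x
  obtain ⟨L2, h2, h2'⟩ := hasFg g x
  have hk : 1 < (s - k).re := by simp; push_cast at hs; linarith
  have h3 := h1.mul ((ps_hasDerivAt (s - k) hk (MvPolynomial.eval x g)).hasFDerivAt.comp x h2)
  have h4 := h3.congr_of_eventuallyEq (f₁ := FF g e s) (Eventually.of_forall fun y => congrFun he y)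
  refine ⟨h4.differentiableAt, fun i => ?_⟩
  rw [h4.fderiv]
  simp only [add_apply, smul_apply, h1', smul_eq_mul,
    ContinuousLinearMap.comp_apply, ContinuousLinearMap.toSpanSingleton_apply, Complex.real_smul, h2',
    Function.comp_apply]
  unfold FF
  split_ifs with hx
  · have hpos := g_pos g hg hx
    have e1 := ps_add_nat (s - k - 1) 1 hpos
    have e2 := ps_add_nat (s - k - 1) (k+1) hpos
    have e3 := evE_nab (gC g) (cx x) hx s e k P i hP
    push_cast at e1 e2
    rw [sub_add_cancel, pow_one] at e1
    rw [show s - k - 1 + (k + 1) = s by ring] at e2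
    rw [e1, e2, ← eval_gC]
    linear_combination (-(ps (s - k - 1) (MvPolynomial.eval x g))) * e3
  · rw [not_not, eval_gC] at hx
    have : MvPolynomial.eval x g = 0 := by exact_mod_cast hx
    rw [this, ps_np _ le_rfl, ps_np _ le_rfl]; simp
end
end
end RZ


set_option linter.unusedSimpArgs false
set_option linter.unusedVariables false
set_option linter.unusedSectionVars false
namespace RZ
noncomputable section

section
variable {n : ℕ}

/-- test functions -/
def TF (φ : (Fin n → ℝ) → ℂ) : Prop := ContDiff ℝ (⊤ : ℕ∞) φ ∧ HasCompactSupport φ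

lemma TF.mulx {φ : (Fin n → ℝ) → ℂ} (h : TF φ) (i : Fin n) : TF (fun x => (x i : ℂ) * φ x) := by
  refine ⟨?_, h.2.mul_left⟩
  refine ContDiff.mul ?_ h.1
  exact (Complex.ofRealCLM.comp (ContinuousLinearMap.proj i : (Fin n → ℝ) →L[ℝ] ℝ)).contDiff

lemma TF.der {φ : (Fin n → ℝ) → ℂ} (h : TF φ) (v) : TF (fun x => - fderiv ℝ φ x v) := by
  refine ⟨?_, (h.2.fderiv_apply ℝ v).neg⟩
  refine ContDiff.neg ?_
  have := h.1.fderiv_right (m := ((⊤ : ℕ∞) : WithTop ℕ∞)) (by simp)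
  exact this.clm_apply contDiff_const

lemma TF.integrable {φ : (Fin n → ℝ) → ℂ} (h : TF φ) {F : (Fin n → ℝ) → ℂ} (hF : Continuous F) :
    Integrable (fun x => F x * φ x) :=
  (hF.mul h.1.continuous).integrable_of_hasCompactSupport h.2.mul_left

variable (g : MvPolynomial (Fin n) ℝ)

/-- the zeta function -/
def Zs (φ : (Fin n → ℝ) → ℂ) (s : ℂ) : ℂ := ∫ x, ps s (MvPolynomial.eval x g) * φ x

/-- Polynomial combinations of zeta functions -/
inductive Rp : (ℂ → ℂ) → Prop
  | base (φ) (h : TF φ) : Rp (Zs g φ)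
  | zero : Rp 0
  | add (u v) (hu : Rp u) (hv : Rp v) : Rp (u + v)
  | mul (q : Polynomial ℂ) (u) (hu : Rp u) : Rp (fun s => q.eval s * u s)

/-- Elements whose integrals are polynomial combinations of zeta functions. -/
def Gd (e : ZE (gC g)) : Prop := ∀ φ, TF φ → ∃ h, Rp g h ∧ ∃ R : ℝ, ∀ s : ℂ, R < s.re →
  ∫ x, FF g e s x * φ x = h s

variable (hg : ∀ x, 0 ≤ MvPolynomial.eval x g)
include hg

lemma Gd_add (e e') (h : Gd g e) (h' : Gd g e') : Gd g (e + e') := by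
  intro φ hφ
  obtain ⟨u, hu, R, hR⟩ := h φ hφ
  obtain ⟨u', hu', R', hR'⟩ := h' φ hφ
  obtain ⟨k, hk⟩ := FF_cont g hg e
  obtain ⟨k', hk'⟩ := FF_cont g hg e'
  refine ⟨_, Rp.add _ _ hu hu', max (max R R') (max k k'), fun s hs => ?_⟩
  simp only [max_lt_iff] at hs
  simp only [FF_add, add_mul]
  rw [integral_add (hφ.integrable (hk s hs.2.1)) (hφ.integrable (hk' s hs.2.2)), hR s hs.1.1, hR' s hs.1.2]
  rfl

omit hg in
lemma Gd_smul (a : ℂ) (e) (h : Gd g e) : Gd g (a • e) := by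
  intro φ hφ
  obtain ⟨u, hu, R, hR⟩ := h φ hφ
  refine ⟨_, Rp.mul (Polynomial.C a) _ hu, R, fun s hs => ?_⟩
  simp only [FF_smul, mul_assoc]
  rw [integral_const_mul, hR s hs]; simp

omit hg in
lemma Gd_opS (e) (h : Gd g e) : Gd g (opS (gC g) e) := by
  intro φ hφ
  obtain ⟨u, hu, R, hR⟩ := h φ hφ
  refine ⟨_, Rp.mul Polynomial.X _ hu, R, fun s hs => ?_⟩
  simp only [FF_opS, mul_assoc]
  rw [integral_const_mul, hR s hs]; simp

omit hg in
lemma Gd_opX (i e) (h : Gd g e) : Gd g (opX (gC g) i e) := by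
  intro φ hφ
  obtain ⟨u, hu, R, hR⟩ := h _ (hφ.mulx i)
  refine ⟨_, hu, R, fun s hs => ?_⟩
  rw [← hR s hs]
  congr 1; ext x; rw [FF_opX]; ring

lemma Gd_nab (i e) (h : Gd g e) : Gd g (nab (gC g) i e) := by
  intro φ hφ
  have h2 := hφ.der (Pi.single i 1)
  obtain ⟨u, hu, R, hR⟩ := h _ h2
  obtain ⟨k1, hk1⟩ := FF_cont g hg e
  obtain ⟨k2, hk2⟩ := FF_cont g hg (nab (gC g) i e)
  obtain ⟨k3, hk3⟩ := FF_diff g hg e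
  refine ⟨_, hu, max R (max k1 (max k2 k3)), fun s hs => ?_⟩
  simp only [max_lt_iff] at hs
  rw [← hR s hs.1]
  have e1 : ∀ x, FF g (nab (gC g) i e) s x = fderiv ℝ (FF g e s) x (Pi.single i 1) :=
    fun x => ((hk3 s hs.2.2.2 x).2 i).symm
  have := integral_mul_fderiv_eq_neg_fderiv_mul_of_integrable (μ := volume) (f := FF g e s) (g := φ)
    (v := Pi.single i 1) ?_ ?_ (hφ.integrable (hk1 s hs.2.1)) (fun x _ => (hk3 s hs.2.2.2 x).1)
    (fun x _ => hφ.1.differentiable (by simp) x)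
  · simp only [mul_neg, integral_neg, this, neg_neg, e1]
  · simp only [← e1]; exact hφ.integrable (hk2 s hs.2.2.1)
  · have := (h2.integrable (hk1 s hs.2.1)).neg
    refine this.congr (Eventually.of_forall fun x => ?_)
    simp

omit hg in
lemma Gd_one : Gd g 1 := by
  intro φ hφ
  refine ⟨_, Rp.base φ hφ, 0, fun s hs => ?_⟩
  have : (1 : ZE (gC g)) = pS (gC g) 1 := by simp [pS]
  simp only [this, FF_pS]; simp [Zs]

lemma Gd_zero : Gd g 0 := by
  have := Gd_smul g 0 1 (Gd_one g)
  rwa [zero_smul] at this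

/-- the good elements as a submodule -/
def GdM : Submodule ℂ (ZE (gC g)) where
  carrier := {e | Gd g e}
  add_mem' h h' := Gd_add g hg _ _ h h'
  zero_mem' := Gd_zero g hg
  smul_mem' a e h := Gd_smul g a e h

lemma NN_le : NN (gC g) ≤ GdM g hg := by
  refine Submodule.span_le.2 ?_
  rintro _ ⟨μ, rfl⟩
  induction hm : (mo n).toSyn μ using WellFoundedLT.induction generalizing μ with
  | ind x ih =>
  subst hm
  by_cases hμ : μ = 0
  · subst hμ; rw [ee_zero]; exact Gd_one g
  · obtain ⟨a, ha⟩ := Finsupp.ne_iff.1 hμ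
    have e1 : μ = (μ - Finsupp.single a 1) + Finsupp.single a 1 := by
      refine (tsub_add_cancel_of_le ?_).symm
      rw [Finsupp.single_le_iff]
      exact Nat.one_le_iff_ne_zero.2 ha
    set ν := μ - Finsupp.single a 1
    obtain ⟨r, hr, hr2⟩ := opA_ee (gC g) a ν
    rw [← e1] at hr hr2
    have e2 : ee (gC g) μ = opA (gC g) a (ee (gC g) ν) - r := by rw [hr2]; simp
    rw [e2]
    refine Submodule.sub_mem _ ?_ ?_
    · have h1 : ee (gC g) ν ∈ GdM g hg := by
        refine ih _ ?_ ν rfl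
        rw [e1, map_add]
        exact lt_add_of_pos_right _ (syn_single_pos a)
      rcases a with (i | i) | u
      · exact Gd_opX g i _ h1
      · exact Gd_nab g hg i _ h1
      · exact Gd_opS g _ h1
    · refine (Submodule.span_le.2 ?_ : Lt (gC g) μ ≤ _) hr
      rintro _ ⟨ν, hν, rfl⟩
      exact ih _ hν ν rfl

lemma funeq_large (b : Polynomial ℂ) (hb : pS (gC g) b ∈ tN (gC g)) (φ) (hφ : TF φ) :
    ∃ h, Rp g h ∧ ∃ R : ℝ, ∀ s : ℂ, R < s.re → b.eval s * Zs g φ s = h (s + 1) := by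
  obtain ⟨v, hv, hv2⟩ := hb
  obtain ⟨h, hh, R, hR⟩ := NN_le g hg hv φ hφ
  refine ⟨h, hh, R, fun s hs => ?_⟩
  rw [← hR (s+1) (by simp; linarith), Zs, ← integral_const_mul]
  congr 1; ext x
  rw [← mul_assoc, ← FF_pS, ← hv2, FF_tt g hg]
end
end
end RZ


set_option linter.unusedSimpArgs false
set_option linter.unusedVariables false
set_option linter.unusedSectionVars false
namespace RZ
noncomputable section

section
/-- right half planes -/
def HP (a : ℝ) : Set ℂ := {s | a < s.re}

lemma HP_open (a) : IsOpen (HP a) := isOpen_lt continuous_const Complex.continuous_re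
lemma HP_preconn (a) : IsPreconnected (HP a) := (convex_halfSpace_re_gt a).isPreconnected

lemma HP_ident (a R : ℝ) (u v : ℂ → ℂ) (hu : DifferentiableOn ℂ u (HP a)) (hv : DifferentiableOn ℂ v (HP a))
    (h : ∀ s : ℂ, R < s.re → u s = v s) : ∀ s : ℂ, a < s.re → u s = v s := by
  intro s hs
  have h1 : ((max a R + 1 : ℝ) : ℂ) ∈ HP a := by
    simp only [HP, Set.mem_ofPred_eq, Complex.ofReal_re]; linarith [le_max_left a R]
  refine (hu.analyticOnNhd (HP_open a)).eqOn_of_preconnected_of_eventuallyEq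
    (hv.analyticOnNhd (HP_open a)) (HP_preconn a) h1 ?_ hs
  filter_upwards [(HP_open R).mem_nhds (x := ((max a R + 1 : ℝ) : ℂ)) (by
    simp only [HP, Set.mem_ofPred_eq, Complex.ofReal_re]; linarith [le_max_right a R])] with z hz
  exact h z hz

lemma ps_hasDerivAt_s (t : ℝ) (s : ℂ) : HasDerivAt (fun w => ps w t) ((Real.log t : ℂ) * ps s t) s := by
  rcases le_or_gt t 0 with h | h
  · simp only [ps_np _ h, mul_zero]; exact hasDerivAt_const _ _
  · simp only [ps_pos _ h]
    have := ((hasDerivAt_id s).mul_const (Real.log t : ℂ)).cexp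
    simpa [mul_comm] using this

variable {n : ℕ} (g : MvPolynomial (Fin n) ℝ)

lemma g_bdd (φ : (Fin n → ℝ) → ℂ) (hφ : TF φ) : ∃ B : ℝ, 1 ≤ B ∧ ∀ x, φ x ≠ 0 → MvPolynomial.eval x g ≤ B := by
  obtain ⟨C, hC⟩ := hφ.2.isCompact.exists_bound_of_continuousOn (cont_g g).continuousOn
  refine ⟨max 1 C, le_max_left _ _, fun x hx => ?_⟩
  exact (le_abs_self _).trans ((hC x (subset_tsupport _ hx)).trans (le_max_right _ _))

lemma Zs_bound (φ : (Fin n → ℝ) → ℂ) (hφ : TF φ) : ∃ B : ℝ, 1 ≤ B ∧ ∀ s : ℂ, 0 < s.re →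
    ‖Zs g φ s‖ ≤ B ^ s.re * ∫ x, ‖φ x‖ := by
  obtain ⟨B, hB, hB2⟩ := g_bdd g φ hφ
  refine ⟨B, hB, fun s hs => ?_⟩
  rw [Zs, ← integral_const_mul]
  refine norm_integral_le_of_norm_le ?_ (Eventually.of_forall fun x => ?_)
  · exact ((hφ.1.continuous.integrable_of_hasCompactSupport hφ.2).norm).const_mul _
  · rw [norm_mul]
    by_cases hx : φ x = 0
    · simp [hx]
    · gcongr; exact ps_norm_le s hs.le _ B hB (hB2 x hx)

lemma Zs_diff (φ : (Fin n → ℝ) → ℂ) (hφ : TF φ) : DifferentiableOn ℂ (Zs g φ) (HP 0) := by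
  intro s0 hs0
  change 0 < s0.re at hs0
  obtain ⟨B, hB, hB2⟩ := g_bdd g φ hφ
  refine DifferentiableAt.differentiableWithinAt ?_
  have hε : 0 < s0.re / 4 := by positivity
  have key := hasDerivAt_integral_of_dominated_loc_of_deriv_le (μ := (volume : Measure (Fin n → ℝ)))
    (F := fun s x => ps s (MvPolynomial.eval x g) * φ x)
    (F' := fun s x => ((Real.log (MvPolynomial.eval x g) : ℂ) * ps s (MvPolynomial.eval x g)) * φ x)
    (x₀ := s0) (s := Metric.ball s0 (s0.re / 4)) (bound := fun x => (B ^ (2 * s0.re) / (s0.re / 4)) * ‖φ x‖)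
    (Metric.ball_mem_nhds _ hε) ?_ ?_ ?_ ?_ ?_ ?_
  · exact key.2.differentiableAt
  · filter_upwards [(HP_open 0).mem_nhds hs0] with s hs
    exact (hφ.integrable ((ps_cont s hs).comp (cont_g g))).aestronglyMeasurable
  · exact hφ.integrable ((ps_cont s0 hs0).comp (cont_g g))
  · have h1 : Measurable (fun x : Fin n → ℝ => (Real.log (MvPolynomial.eval x g) : ℂ)) :=
      Complex.measurable_ofReal.comp (Real.measurable_log.comp (cont_g g).measurable)
    exact ((h1.mul ((ps_cont s0 hs0).comp (cont_g g)).measurable).mul hφ.1.continuous.measurable).aestronglyMeasurable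
  · refine Eventually.of_forall fun x s hs => ?_
    rw [norm_mul]
    by_cases hx : φ x = 0
    · simp [hx]
    gcongr
    rw [← (ps_hasDerivAt_s (MvPolynomial.eval x g) s).deriv]
    refine Complex.norm_deriv_le_of_forall_mem_sphere_norm_le hε ?_ ?_
    · refine Differentiable.diffContOnCl ?_
      exact fun z => (ps_hasDerivAt_s _ z).differentiableAt
    · intro z hz
      have h1 : |(z - s).re| ≤ s0.re / 4 := (Complex.abs_re_le_norm _).trans (by
        rw [mem_sphere_iff_norm] at hz; exact hz.le)
      have h2 : |(s - s0).re| ≤ s0.re / 4 := (Complex.abs_re_le_norm _).trans (by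
        rw [mem_ball_iff_norm] at hs; exact hs.le)
      rw [Complex.sub_re, abs_le] at h1 h2
      refine (ps_norm_le z (by linarith) _ B hB (hB2 x hx)).trans ?_
      refine Real.rpow_le_rpow_of_exponent_le hB ?_
      linarith
  · exact ((hφ.1.continuous.integrable_of_hasCompactSupport hφ.2).norm).const_mul _
  · exact Eventually.of_forall fun x s hs => (ps_hasDerivAt_s _ s).mul_const _

lemma Rp_diff (h : ℂ → ℂ) (hh : Rp g h) : DifferentiableOn ℂ h (HP 0) := by
  induction hh with
  | base φ hφ => exact Zs_diff g φ hφ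
  | zero => exact differentiableOn_const _
  | add u v _ _ hu hv => exact hu.add hv
  | mul q u _ hu => exact (q.differentiable.differentiableOn).mul hu

variable (hg : ∀ x, 0 ≤ MvPolynomial.eval x g)
include hg

lemma funeq (b : Polynomial ℂ) (hb : pS (gC g) b ∈ tN (gC g)) (φ) (hφ : TF φ) :
    ∃ h, Rp g h ∧ ∀ s : ℂ, 0 < s.re → b.eval s * Zs g φ s = h (s + 1) := by
  obtain ⟨h, hh, R, hR⟩ := funeq_large g hg b hb φ hφ
  refine ⟨h, hh, HP_ident 0 R _ _ ?_ ?_ hR⟩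
  · exact (b.differentiable.differentiableOn).mul (Zs_diff g φ hφ)
  · refine (Rp_diff g h hh).comp (by fun_prop) ?_
    intro s hs
    simp only [HP, Set.mem_ofPred_eq, Complex.add_re, Complex.one_re] at *
    linarith

/-- product of shifts -/
def bk (b : Polynomial ℂ) (k : ℕ) (s : ℂ) : ℂ := ∏ i ∈ Finset.range k, b.eval (s + i)

omit hg in
lemma bk_diff (b : Polynomial ℂ) (k) : Differentiable ℂ (bk b k) := by
  unfold bk
  refine Differentiable.fun_finsetProd fun i _ => ?_
  exact b.differentiable.comp (by fun_prop)

omit hg in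
lemma bk_succ (b : Polynomial ℂ) (k s) : bk b (k+1) s = b.eval s * bk b k (s+1) := by
  unfold bk
  rw [Finset.prod_range_succ', mul_comm]
  congr 1
  · simp
  · refine Finset.prod_congr rfl fun i _ => ?_
    congr 1; push_cast; ring

lemma ext_k (b : Polynomial ℂ) (hb : pS (gC g) b ∈ tN (gC g)) (k : ℕ) : ∀ φ, TF φ →
    ∃ H : ℂ → ℂ, DifferentiableOn ℂ H (HP (-k)) ∧ ∀ s : ℂ, 0 < s.re → bk b k s * Zs g φ s = H s := by
  induction k with
  | zero =>
    intro φ hφ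
    exact ⟨Zs g φ, by simpa using Zs_diff g φ hφ, fun s hs => by simp [bk]⟩
  | succ k ih =>
    have ih2 : ∀ h, Rp g h → ∃ H : ℂ → ℂ, DifferentiableOn ℂ H (HP (-k)) ∧
        ∀ s : ℂ, 0 < s.re → bk b k s * h s = H s := by
      intro h hh
      induction hh with
      | base φ hφ => exact ih φ hφ
      | zero => exact ⟨0, differentiableOn_const _, by simp⟩
      | add u v _ _ hu hv =>
        obtain ⟨U, hU, hU2⟩ := hu
        obtain ⟨V, hV, hV2⟩ := hv
        exact ⟨U + V, hU.add hV, fun s hs => by simp [mul_add, hU2 s hs, hV2 s hs]⟩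
      | mul q u _ hu =>
        obtain ⟨U, hU, hU2⟩ := hu
        refine ⟨fun s => q.eval s * U s, (q.differentiable.differentiableOn).mul hU, fun s hs => ?_⟩
        simp only [← hU2 s hs]; ring
    intro φ hφ
    obtain ⟨h, hh, hh2⟩ := funeq g hg b hb φ hφ
    obtain ⟨H, hH, hH2⟩ := ih2 h hh
    refine ⟨fun s => H (s + 1), hH.comp (by fun_prop) ?_, fun s hs => ?_⟩
    · intro s hs
      simp only [HP, Set.mem_ofPred_eq, Complex.add_re, Complex.one_re] at *
      push_cast at hs
      linarith
    · change _ = H (s + 1)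
      rw [← hH2 (s+1) (by simp; linarith), ← hh2 s hs, bk_succ]; ring
end
end
end RZ


set_option linter.unusedSimpArgs false
set_option linter.unusedVariables false
set_option linter.unusedSectionVars false
namespace RZ
noncomputable section

section

/-- product of shifts, as a polynomial -/
def bp (b : Polynomial ℂ) (k : ℕ) : Polynomial ℂ := ∏ i ∈ Finset.range k, b.comp (Polynomial.X + Polynomial.C (i : ℂ))

lemma bp_eval (b : Polynomial ℂ) (k s) : (bp b k).eval s = bk b k s := by
  simp [bp, bk, Polynomial.eval_prod]

lemma bp_ne (b : Polynomial ℂ) (hb : b.Monic) (k) : bp b k ≠ 0 := by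
  refine (Polynomial.monic_prod_of_monic _ _ fun i _ => ?_).ne_zero
  exact hb.comp_X_add_C _

lemma ev_ne (q : Polynomial ℂ) (hq : q ≠ 0) (s0 : ℂ) : ∀ᶠ z in nhdsWithin s0 {s0}ᶜ, q.eval z ≠ 0 := by
  have h1 := (Polynomial.finite_setOfPred_isRoot hq).subset (Set.sdiff_subset (t := {s0}))
  have h2 := h1.isClosed.isOpen_compl.mem_nhds (x := s0) (by simp)
  rw [eventually_nhdsWithin_iff]
  filter_upwards [h2] with z hz hz2 h3
  exact hz ⟨h3, hz2⟩

lemma bk_ne_of_le (b : Polynomial ℂ) {m k : ℕ} (h : m ≤ k) (s) (hk : bk b k s ≠ 0) : bk b m s ≠ 0 := by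
  unfold bk at *
  rw [Finset.prod_ne_zero_iff] at *
  intro i hi
  exact hk i (Finset.mem_range.2 ((Finset.mem_range.1 hi).trans_le h))

theorem glue (Z : ℂ → ℂ) (b : Polynomial ℂ) (hb : b.Monic) (hq : ∀ lam, b.IsRoot lam → ∃ q : ℚ, lam = q)
    (B C : ℝ) (hB : 1 ≤ B) (hC : 0 ≤ C) (hZ : ∀ s : ℂ, 0 < s.re → ‖Z s‖ ≤ B ^ s.re * C)
    (hH : ∀ k : ℕ, ∃ H : ℂ → ℂ, DifferentiableOn ℂ H (HP (-k)) ∧ ∀ s : ℂ, 0 < s.re → bk b k s * Z s = H s) :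
    ∃ G : ℂ → ℂ, MeromorphicOn G Set.univ ∧ (∀ s : ℂ, 0 < s.re → G s = Z s) ∧
      ∀ s₀, Tendsto (fun s => ‖G s‖) (nhdsWithin s₀ {s₀}ᶜ) atTop → ∃ q : ℚ, q < 0 ∧ s₀ = (q : ℂ) := by
  classical
  choose H hHd hHe using hH
  let G : ℂ → ℂ := fun s => if 0 < s.re then Z s else
    H (⌊-s.re⌋₊ + 1) s / bk b (⌊-s.re⌋₊ + 1) s
  have G1 : ∀ s : ℂ, 0 < s.re → G s = Z s := fun s hs => by simp [G, hs]
  have key : ∀ (M : ℕ) (s : ℂ), -(M:ℝ) < s.re → bk b M s ≠ 0 → G s = H M s / bk b M s := by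
    intro M s hs hM
    by_cases h0 : 0 < s.re
    · rw [G1 s h0, ← hHe M s h0]; field_simp
    · simp only [G, h0, if_false]
      set m := ⌊-s.re⌋₊ + 1 with hm
      have hmM : m ≤ M := by
        have : ⌊-s.re⌋₊ < M := (Nat.floor_lt (by linarith)).2 (by linarith)
        omega
      have hms : -(m:ℝ) < s.re := by
        have := Nat.lt_floor_add_one (-s.re)
        rw [hm]; push_cast; linarith
      have hm0 := bk_ne_of_le b hmM s hM
      have hsub : HP (-(m:ℝ)) ⊆ HP (-(M:ℝ)) := by
        intro z hz
        simp only [HP, Set.mem_ofPred_eq] at *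
        have : (m:ℝ) ≤ M := by exact_mod_cast hmM
        linarith
      have := HP_ident (-(m:ℝ)) 0 (fun s => H m s * bk b M s) (fun s => H M s * bk b m s)
        ((hHd m).mul (bk_diff b M).differentiableOn)
        (((hHd M).mono hsub).mul (bk_diff b m).differentiableOn)
        (fun z hz => by simp only [← hHe m z hz, ← hHe M z hz]; ring) s hms
      rw [div_eq_div_iff hm0 hM]; exact this
  have exM : ∀ s0 : ℂ, ∃ M : ℕ, -(M:ℝ) < s0.re := fun s0 => by
    obtain ⟨M, hM⟩ := exists_nat_gt (-s0.re)
    exact ⟨M, by linarith⟩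
  have anH : ∀ (M : ℕ) (s0 : ℂ), -(M:ℝ) < s0.re → AnalyticAt ℂ (H M) s0 := fun M s0 h =>
    (hHd M).analyticAt ((HP_open _).mem_nhds h)
  have anb : ∀ (M : ℕ) (s0 : ℂ), AnalyticAt ℂ (bk b M) s0 := fun M s0 => (bk_diff b M).analyticAt s0
  have evG : ∀ (M : ℕ) (s0 : ℂ), -(M:ℝ) < s0.re →
      G =ᶠ[nhdsWithin s0 {s0}ᶜ] fun s => H M s / bk b M s := by
    intro M s0 hM
    filter_upwards [ev_ne (bp b M) (bp_ne b hb M) s0, mem_nhdsWithin_of_mem_nhds ((HP_open _).mem_nhds hM)] with z hz hz2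
    rw [bp_eval] at hz
    exact key M z hz2 hz
  refine ⟨G, ?_, G1, ?_⟩
  · intro s0 _
    obtain ⟨M, hM⟩ := exM s0
    refine MeromorphicAt.congr ?_ (evG M s0 hM).symm
    exact (anH M s0 hM).meromorphicAt.fun_div (anb M s0).meromorphicAt
  · intro s0 hp
    obtain ⟨M, hM⟩ := exM s0
    have hb0 : bk b M s0 = 0 := by
      by_contra hne
      have h1 : Tendsto (fun s => ‖H M s / bk b M s‖) (nhdsWithin s0 {s0}ᶜ) (nhds ‖H M s0 / bk b M s0‖) :=
        ((((anH M s0 hM).continuousAt.div (anb M s0).continuousAt hne).norm).tendsto).mono_left nhdsWithin_le_nhds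
      have h2 : Tendsto (fun s => ‖G s‖) (nhdsWithin s0 {s0}ᶜ) (nhds ‖H M s0 / bk b M s0‖) := by
        refine h1.congr' ?_
        filter_upwards [evG M s0 hM] with z hz
        rw [hz]
      exact not_tendsto_nhds_of_tendsto_atTop hp _ h2
    unfold bk at hb0
    obtain ⟨i, _, hi⟩ := Finset.prod_eq_zero_iff.1 hb0
    obtain ⟨q, hq'⟩ := hq _ hi
    have hs : s0 = ((q - i : ℚ) : ℂ) := by push_cast; rw [← hq']; ring
    refine ⟨q - i, ?_, hs⟩
    by_contra hneg
    have hre : 0 ≤ s0.re := by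
      have h3 : s0.re = ((q - i : ℚ) : ℝ) := by
        rw [hs, Complex.ratCast_re]
      rw [h3]; exact_mod_cast not_lt.1 hneg
    have ht : Tendsto (fun t : ℝ => s0 + (t : ℂ)) (nhdsWithin 0 (Set.Ioi 0)) (nhdsWithin s0 {s0}ᶜ) := by
      rw [tendsto_nhdsWithin_iff]
      constructor
      · have : Continuous (fun t : ℝ => s0 + (t : ℂ)) := by fun_prop
        have h4 := this.tendsto 0
        simp only [Complex.ofReal_zero, add_zero] at h4
        exact h4.mono_left nhdsWithin_le_nhds
      · filter_upwards [self_mem_nhdsWithin] with t ht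
        have : t ≠ 0 := (ne_of_gt ht)
        simpa using this
    have h5 := hp.comp ht
    have h6 : ∀ᶠ t : ℝ in nhdsWithin 0 (Set.Ioi 0), ‖G (s0 + (t:ℂ))‖ ≤ B ^ (s0.re + 1) * C := by
      filter_upwards [self_mem_nhdsWithin, mem_nhdsWithin_of_mem_nhds (Iio_mem_nhds (show (0:ℝ) < 1 by norm_num))]
        with t ht ht1
      have ht0 : 0 < t := ht
      have ht1' : t < 1 := ht1
      have hr : 0 < (s0 + (t:ℂ)).re := by simp; linarith
      rw [G1 _ hr]
      refine (hZ _ hr).trans ?_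
      refine mul_le_mul_of_nonneg_right ?_ hC
      refine Real.rpow_le_rpow_of_exponent_le hB ?_
      simp; linarith
    have h7 := h5.eventually (eventually_gt_atTop (B ^ (s0.re + 1) * C))
    obtain ⟨t, ht1, ht2⟩ := (h6.and h7).exists
    exact absurd ht2 (not_lt.2 ht1)

end

theorem mainG {n : ℕ} (g : MvPolynomial (Fin n) ℝ) (hg : ∀ x, 0 ≤ MvPolynomial.eval x g) (hg0 : g ≠ 0)
    (φ : (Fin n → ℝ) → ℂ) (hφ : TF φ) :
    ∃ G : ℂ → ℂ, MeromorphicOn G Set.univ ∧ (∀ s : ℂ, 0 < s.re → G s = Zs g φ s) ∧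
      ∀ s₀, Tendsto (fun s => ‖G s‖) (nhdsWithin s₀ {s₀}ᶜ) atTop → ∃ q : ℚ, q < 0 ∧ s₀ = (q : ℂ) := by
  have hgC : gC g ≠ 0 := by
    intro h
    exact hg0 (MvPolynomial.map_injective _ (algebraMap ℝ ℂ).injective (h.trans (map_zero _).symm))
  obtain ⟨b, hb, hb2, hb3⟩ := bernsteinRational (gC g) hgC
  obtain ⟨B, hB, hB2⟩ := Zs_bound g φ hφ
  exact glue _ b hb hb3 B _ hB (integral_nonneg fun x => norm_nonneg _) hB2 fun k => ext_k g hg b hb2 k φ hφ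

theorem mainF {n : ℕ} (f : MvPolynomial (Fin n) ℝ) (hf : f ≠ 0)
    (φ : (Fin n → ℝ) → ℂ) (hφ : ContDiff ℝ (⊤ : ℕ∞) φ) (hφc : HasCompactSupport φ) :
    ∃ G : ℂ → ℂ, MeromorphicOn G Set.univ ∧ (∀ s : ℂ, 0 < s.re → G s =
      ∫ x, (if MvPolynomial.eval x f = 0 then 0 else Complex.exp (s * (Real.log |MvPolynomial.eval x f| : ℂ))) * φ x) ∧
      ∀ s₀, Tendsto (fun s => ‖G s‖) (nhdsWithin s₀ {s₀}ᶜ) atTop → ∃ q : ℚ, q < 0 ∧ s₀ = (q : ℂ) := by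
  obtain ⟨G, h1, h2, h3⟩ := mainG (f ^ 2) (fun x => by simp; positivity) (pow_ne_zero 2 hf) φ ⟨hφ, hφc⟩
  refine ⟨fun s => G (s / 2), ?_, ?_, ?_⟩
  · intro s _
    refine MeromorphicAt.comp_analyticAt (h1 (s/2) trivial) ?_
    fun_prop
  · intro s hs
    have : 0 < (s / 2).re := by
      rw [show s / 2 = s / ((2:ℝ):ℂ) by norm_num, Complex.div_ofReal_re]; linarith
    change G (s / 2) = _
    rw [h2 _ this, Zs]
    congr 1; ext x
    congr 1
    rw [map_pow]
    by_cases hx : MvPolynomial.eval x f = 0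
    · simp [hx, ps]
    · rw [if_neg hx, ps_pos _ (by positivity), ← sq_abs, Real.log_pow]
      congr 1; push_cast; ring
  · intro s0 hp
    have ht : Tendsto (fun s : ℂ => 2 * s) (nhdsWithin (s0/2) {s0/2}ᶜ) (nhdsWithin s0 {s0}ᶜ) := by
      rw [tendsto_nhdsWithin_iff]
      constructor
      · have : Continuous (fun s : ℂ => 2 * s) := by fun_prop
        have h4 := this.tendsto (s0/2)
        rw [show 2 * (s0 / 2) = s0 by ring] at h4
        exact h4.mono_left nhdsWithin_le_nhds
      · filter_upwards [self_mem_nhdsWithin] with t ht h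
        apply ht
        simp only [Set.mem_singleton_iff] at *
        rw [← h]; ring
    have h5 := hp.comp ht
    obtain ⟨q, hq, hq2⟩ := h3 (s0/2) (h5.congr fun s => by simp)
    exact ⟨2 * q, by linarith, by push_cast; rw [← hq2]; ring⟩
end
end RZ

theorem stmt2 {n : ℕ} (f : MvPolynomial (Fin n) ℝ) (hf : 0 < f.totalDegree)
    (φ : (Fin n → ℝ) → ℂ) (hφ : ContDiff ℝ (⊤ : ℕ∞) φ) (hφc : HasCompactSupport φ) :
    ∃ G : ℂ → ℂ, MeromorphicOn G Set.univ ∧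
      (∀ s : ℂ, 0 < s.re → G s = realZeta f φ s) ∧
      (∀ s₀ : ℂ, IsPole G s₀ → ∃ q : ℚ, q < 0 ∧ s₀ = (q : ℂ)) := by
  have hf0 : f ≠ 0 := by
    rintro rfl
    simp at hf
  exact RZ.mainF f hf0 φ hφ hφc
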